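/- If a group G admits a finite presentation of deficiency 1 (that is, a presentation with n generators and n − 1 relators for some n), then ω(G) ≥ 2^{1/4}, unless G is isomorphic to ℤ, ℤ × ℤ, or the Klein bottle group, in which case ω(G) = 1. -/

import Mathlib

open Filter

/-- The set of elements of `G` expressible as a word of length at most `n`
in elements of `S` and their inverses. -/
def wordBall {G : Type*} [Group G] (S : Finset G) (n : ℕ) : Set G :=
  { g | ∃ l : List G, l.length ≤ n ∧ (∀ x ∈ l, x ∈ S ∨ x⁻¹ ∈ S) ∧ l.prod = g }

/-- `ω(G,S)`: the exponential growth rate of `G` with respect to the finite set `S`,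
i.e. the limit (= limsup, since the limit exists by submultiplicativity) of `γ_S(n)^(1/n)`. -/
noncomputable def growthRate {G : Type*} [Group G] (S : Finset G) : ℝ :=
  Filter.limsup (fun n : ℕ => ((wordBall S n).ncard : ℝ) ^ (1 / (n : ℝ))) Filter.atTop

/-- `ω(G)`: the growth constant of `G`, the infimum of `ω(G,S)` over all finite
generating sets `S` of `G`. -/
noncomputable def growthOmega (G : Type*) [Group G] : ℝ :=
  sInf { r : ℝ | ∃ S : Finset G, Subgroup.closure (S : Set G) = ⊤ ∧ growthRate S = r }
/-- The single relator `t a t⁻¹ a` of the Klein bottle group `⟨a, t | t a t⁻¹ = a⁻¹⟩`,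
with generator `0` playing the role of `a` and generator `1` the role of `t`. -/
def kleinBottleRels : Set (FreeGroup (Fin 2)) :=
  {FreeGroup.of 1 * FreeGroup.of 0 * (FreeGroup.of 1)⁻¹ * FreeGroup.of 0}

/-- The Klein bottle group `⟨a, t | t a t⁻¹ = a⁻¹⟩`. -/
abbrev KleinBottleGroup : Type := PresentedGroup kleinBottleRels


/-! ### Growth basics -/

/-- The pair `u, v` freely generates a free monoid. -/
def FreePair {G : Type*} [Group G] (u v : G) : Prop :=
  Function.Injective (fun l : List Bool => (l.map (fun b => cond b v u)).prod)

open scoped Pointwise in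
theorem wordBall_subset_pow {G : Type*} [Group G] [DecidableEq G] (S : Finset G) (n : ℕ) :
    wordBall S n ⊆ ((insert 1 (S ∪ S.image (·⁻¹))) ^ n : Finset G) := by
  induction n with
  | zero =>
    rintro g ⟨l, hl, -, rfl⟩
    have : l = [] := List.length_eq_zero_iff.mp (by omega)
    simp [this]
  | succ n ih =>
    rintro g ⟨l, hl, hS, rfl⟩
    rw [pow_succ']
    cases l with
    | nil =>
      have : (1 : G) ∈ wordBall S n := ⟨[], by simp, by simp, by simp⟩
      have h1 := ih this
      simp only [List.prod_nil]
      rw [Finset.mem_coe, Finset.mem_mul]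
      exact ⟨1, by simp, 1, h1, by simp⟩
    | cons a l =>
      rw [Finset.mem_coe, Finset.mem_mul]
      refine ⟨a, ?_, l.prod, ih ⟨l, by simpa using hl, fun x hx => hS x (by simp [hx]), rfl⟩, by simp⟩
      have := hS a (by simp)
      simp only [Finset.mem_insert, Finset.mem_union, Finset.mem_image]
      rcases this with h | h
      · exact Or.inr (Or.inl h)
      · exact Or.inr (Or.inr ⟨_, h, by simp⟩)

theorem wordBall_finite {G : Type*} [Group G] (S : Finset G) (n : ℕ) :
    (wordBall S n).Finite := by
  classical
  exact (Finset.finite_toSet _).subset (wordBall_subset_pow S n)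

open scoped Pointwise in
theorem wordBall_bdd {G : Type*} [Group G] (S : Finset G) :
    IsBoundedUnder (· ≤ ·) atTop
      (fun n : ℕ => ((wordBall S n).ncard : ℝ) ^ (1 / (n : ℝ))) := by
  classical
  set T := insert 1 (S ∪ S.image (·⁻¹)) with hT
  refine ⟨(T.card : ℝ), ?_⟩
  rw [eventually_map]
  filter_upwards [eventually_gt_atTop 0] with n hn
  have h1 : (wordBall S n).ncard ≤ T.card ^ n := by
    calc (wordBall S n).ncard ≤ ((T ^ n : Finset G) : Set G).ncard :=
          Set.ncard_le_ncard (wordBall_subset_pow S n) (Finset.finite_toSet _)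
      _ = (T ^ n).card := Set.ncard_coe_finset _
      _ ≤ _ := Finset.card_pow_le
  have h2 : ((wordBall S n).ncard : ℝ) ≤ (T.card : ℝ) ^ n := by exact_mod_cast h1
  calc ((wordBall S n).ncard : ℝ) ^ (1 / (n : ℝ)) ≤ ((T.card : ℝ) ^ n) ^ (1 / (n : ℝ)) := by
        apply Real.rpow_le_rpow (by positivity) h2 (by positivity)
    _ = _ := by
        rw [one_div, Real.pow_rpow_inv_natCast (by positivity) (by omega)]

theorem one_mem_wordBall {G : Type*} [Group G] (S : Finset G) (n : ℕ) :
    (1 : G) ∈ wordBall S n := ⟨[], by simp, by simp, by simp⟩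

theorem mul_mem_wordBall {G : Type*} [Group G] {S : Finset G} {m n : ℕ} {a b : G}
    (ha : a ∈ wordBall S m) (hb : b ∈ wordBall S n) : a * b ∈ wordBall S (m + n) := by
  obtain ⟨l, h1, h2, rfl⟩ := ha
  obtain ⟨l', h1', h2', rfl⟩ := hb
  refine ⟨l ++ l', by simp; omega, ?_, by simp⟩
  intro x hx
  rcases List.mem_append.mp hx with h | h
  · exact h2 x h
  · exact h2' x h

theorem wordBall_mono {G : Type*} [Group G] {S : Finset G} {m n : ℕ} (h : m ≤ n) :
    wordBall S m ⊆ wordBall S n := by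
  rintro g ⟨l, h1, h2⟩
  exact ⟨l, h1.trans h, h2⟩

theorem mem_wordBall_one {G : Type*} [Group G] {S : Finset G} {s : G} (hs : s ∈ S) :
    s ∈ wordBall S 1 := ⟨[s], by simp, by simp [hs], by simp⟩

theorem inv_mem_wordBall_one {G : Type*} [Group G] {S : Finset G} {s : G} (hs : s ∈ S) :
    s⁻¹ ∈ wordBall S 1 := ⟨[s⁻¹], by simp, by simp [hs], by simp⟩

theorem one_le_growthRate {G : Type*} [Group G] (S : Finset G) : 1 ≤ growthRate S := by
  refine le_limsup_of_frequently_le (Eventually.frequently (Eventually.of_forall fun n => ?_))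
    (wordBall_bdd S)
  apply Real.one_le_rpow
  · have : 0 < (wordBall S n).ncard :=
      (Set.ncard_pos (wordBall_finite S n)).mpr ⟨1, one_mem_wordBall S n⟩
    exact_mod_cast this
  · positivity

theorem list_prod_mem_wordBall {G : Type*} [Group G] {S : Finset G} {m : ℕ} (l : List G)
    (h : ∀ x ∈ l, x ∈ wordBall S m) : l.prod ∈ wordBall S (m * l.length) := by
  induction l with
  | nil => exact one_mem_wordBall _ _
  | cons a l ih =>
    have := mul_mem_wordBall (h a (by simp)) (ih fun x hx => h x (by simp [hx]))
    rw [List.prod_cons, List.length_cons, mul_add, mul_one, add_comm]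
    exact this

theorem growthRate_ge_of_freePair {G : Type*} [Group G] {S : Finset G} {u v : G}
    (hf : FreePair u v) (hu : u ∈ wordBall S 4) (hv : v ∈ wordBall S 4) :
    (2 : ℝ) ^ ((1 : ℝ) / 4) ≤ growthRate S := by
  refine le_limsup_of_frequently_le ?_ (wordBall_bdd S)
  rw [frequently_atTop]
  intro N
  refine ⟨4 * (N + 1), by omega, ?_⟩
  set k := N + 1
  have h1 : 2 ^ k ≤ (wordBall S (4 * k)).ncard := by
    have hinj : Function.Injective
        (fun f : Fin k → Bool => ((List.ofFn f).map (fun b => cond b v u)).prod) :=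
      hf.comp List.ofFn_injective
    have : (Set.range (fun f : Fin k → Bool =>
        ((List.ofFn f).map (fun b => cond b v u)).prod)).ncard = 2 ^ k := by
      rw [← Set.image_univ, Set.ncard_image_of_injective _ hinj, Set.ncard_univ]
      simp
    rw [← this]
    apply Set.ncard_le_ncard _ (wordBall_finite _ _)
    rintro _ ⟨f, rfl⟩
    have := list_prod_mem_wordBall (S := S) (m := 4) ((List.ofFn f).map (fun b => cond b v u)) (by
      intro x hx
      obtain ⟨b, -, rfl⟩ := List.mem_map.mp hx
      cases b <;> simpa)
    simpa using this
  have h2 : (2 : ℝ) ^ k ≤ (wordBall S (4 * k)).ncard := by exact_mod_cast h1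
  calc (2 : ℝ) ^ ((1 : ℝ) / 4) = ((2 : ℝ) ^ k) ^ (1 / ((4 * k : ℕ) : ℝ)) := by
        rw [← Real.rpow_natCast, ← Real.rpow_mul (by norm_num)]
        congr 1
        have : (k : ℝ) ≠ 0 := by positivity
        push_cast
        field_simp
    _ ≤ _ := Real.rpow_le_rpow (by positivity) h2 (by positivity)

theorem cond_prod_flatMap {G : Type*} [Group G] (x y : G) (l : List Bool) :
    ((l.flatMap (fun b => [b, !b])).map (fun b => cond b y x)).prod =
      (l.map (fun b => cond b (y * x) (x * y))).prod := by
  induction l with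
  | nil => rfl
  | cons b l ih => cases b <;> simp [ih, mul_assoc]

theorem FreePair.mul_pair {G : Type*} [Group G] {x y : G} (h : FreePair x y) :
    FreePair (x * y) (y * x) := by
  intro l l' hl
  simp only [← cond_prod_flatMap] at hl
  have := h hl
  clear hl
  induction l generalizing l' with
  | nil => cases l' <;> simp_all
  | cons a l ih =>
    cases l' with
    | nil => simp_all
    | cons a' l' =>
      simp only [List.flatMap_cons, List.cons_append, List.nil_append, List.cons.injEq] at this
      rw [this.1, ih this.2.2]

theorem kt_normal_form {G : Type*} [Group G] [DecidableEq G] (k t : G)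
    (h : t * k * t⁻¹ = k ∨ t * k * t⁻¹ = k⁻¹) (l : List G)
    (hl : ∀ x ∈ l, x ∈ ({k, t} : Finset G) ∨ x⁻¹ ∈ ({k, t} : Finset G)) :
    ∃ i ∈ Finset.Icc (-(l.length : ℤ)) l.length, ∃ j ∈ Finset.Icc (-(l.length : ℤ)) l.length,
      l.prod = k ^ i * t ^ j := by
  induction l with
  | nil => exact ⟨0, by simp, 0, by simp, by simp⟩
  | cons a l ih =>
    obtain ⟨i, hi, j, hj, he⟩ := ih fun x hx => hl x (by simp [hx])
    have ha := hl a (by simp)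
    simp only [Finset.mem_Icc, List.length_cons, List.prod_cons, he, Nat.cast_add,
      Nat.cast_one] at hi hj ⊢
    have h' : (∀ i : ℤ, t * k ^ i = k ^ i * t) ∨ (∀ i : ℤ, t * k ^ i = k ^ (-i) * t) := by
      rcases h with h | h
      · left
        intro i
        have : (t * k * t⁻¹) ^ i = k ^ i := by rw [h]
        rw [conj_zpow] at this
        exact mul_inv_eq_iff_eq_mul.mp this
      · right
        intro i
        have : (t * k * t⁻¹) ^ i = k ^ (-i) := by rw [h, inv_zpow, zpow_neg]
        rw [conj_zpow] at this
        rw [← this]; group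
    have h'' : (∀ i : ℤ, t⁻¹ * k ^ i = k ^ i * t⁻¹) ∨ (∀ i : ℤ, t⁻¹ * k ^ i = k ^ (-i) * t⁻¹) := by
      rcases h' with h | h
      · left
        intro i
        rw [inv_mul_eq_iff_eq_mul, ← mul_assoc, h]; group
      · right
        intro i
        rw [inv_mul_eq_iff_eq_mul, ← mul_assoc, h]; group
    simp only [Finset.mem_insert, Finset.mem_singleton, inv_eq_iff_eq_inv] at ha
    rcases ha with (rfl | rfl) | (rfl | rfl)
    · exact ⟨i + 1, by omega, j, by omega, by rw [← mul_assoc, ← zpow_one_add, add_comm]⟩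
    · rcases h' with h | h
      · exact ⟨i, by omega, j + 1, by omega, by rw [← mul_assoc, h, mul_assoc, ← zpow_one_add, add_comm]⟩
      · exact ⟨-i, by omega, j + 1, by omega, by rw [← mul_assoc, h, mul_assoc, ← zpow_one_add, add_comm]⟩
    · exact ⟨i - 1, by omega, j, by omega, by rw [← mul_assoc, ← zpow_neg_one, ← zpow_add]; ring_nf⟩
    · rcases h'' with h | h
      · exact ⟨i, by omega, j - 1, by omega, by rw [← mul_assoc, h, mul_assoc, ← zpow_neg_one, ← zpow_add]; ring_nf⟩
      · exact ⟨-i, by omega, j - 1, by omega, by rw [← mul_assoc, h, mul_assoc, ← zpow_neg_one, ← zpow_add]; ring_nf⟩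

/-- The polycyclic-type upper bound. -/
theorem growthRate_le_one_of_kt {G : Type*} [Group G] [DecidableEq G] (k t : G)
    (h : t * k * t⁻¹ = k ∨ t * k * t⁻¹ = k⁻¹) :
    growthRate ({k, t} : Finset G) ≤ 1 := by
  have hcard : ∀ n : ℕ, (wordBall ({k, t} : Finset G) n).ncard ≤ (2 * n + 1) ^ 2 := by
    intro n
    have hsub : wordBall ({k, t} : Finset G) n ⊆
        (((Finset.Icc (-(n : ℤ)) n ×ˢ Finset.Icc (-(n : ℤ)) n).image
          (fun p : ℤ × ℤ => k ^ p.1 * t ^ p.2) : Finset G) : Set G) := by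
      rintro g ⟨l, h1, h2, rfl⟩
      obtain ⟨i, hi, j, hj, he⟩ := kt_normal_form k t h l h2
      rw [Finset.mem_Icc] at hi hj
      rw [Finset.mem_coe, Finset.mem_image]
      refine ⟨(i, j), ?_, he.symm⟩
      simp only [Finset.mem_product, Finset.mem_Icc]
      omega
    calc _ ≤ _ := Set.ncard_le_ncard hsub (Finset.finite_toSet _)
      _ ≤ _ := by
        rw [Set.ncard_coe_finset]
        refine Finset.card_image_le.trans ?_
        rw [Finset.card_product, Int.card_Icc]
        have : ((n : ℤ) + 1 - -(n : ℤ)).toNat = 2 * n + 1 := by omega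
        rw [this, sq]
  have htend : Tendsto (fun n : ℕ => (((2 * n + 1 : ℕ) : ℝ)) ^ ((4 : ℝ) / (1 * ((2 * n + 1 : ℕ) : ℝ) + (-1))))
      atTop (nhds 1) := by
    refine (tendsto_rpow_div_mul_add 4 1 (-1) (by norm_num)).comp ?_
    refine tendsto_natCast_atTop_atTop.comp ?_
    exact tendsto_atTop_mono (fun n => by simp only [id]; omega) tendsto_id
  rw [← htend.limsup_eq]
  refine limsup_le_limsup ?_ ?_ htend.isBoundedUnder_le
  · filter_upwards [eventually_gt_atTop 0] with n hn
    have hn' : (0 : ℝ) < n := by exact_mod_cast hn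
    have h1 : ((wordBall ({k, t} : Finset G) n).ncard : ℝ) ≤ (((2 * n + 1 : ℕ) : ℝ)) ^ (2 : ℝ) := by
      rw [Real.rpow_ofNat]
      exact_mod_cast hcard n
    calc _ ≤ ((((2 * n + 1 : ℕ) : ℝ)) ^ (2 : ℝ)) ^ (1 / (n : ℝ)) :=
          Real.rpow_le_rpow (by positivity) h1 (by positivity)
      _ = _ := by
        rw [← Real.rpow_mul (by positivity)]
        congr 1
        push_cast
        field_simp
        ring
  · refine IsBoundedUnder.isCoboundedUnder_le ⟨0, ?_⟩
    rw [eventually_map]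
    exact Eventually.of_forall fun n => by positivity

theorem growthOmega_eq_one_of_kt {G : Type*} [Group G] (k t : G)
    (hgen : Subgroup.closure {k, t} = (⊤ : Subgroup G))
    (h : t * k * t⁻¹ = k ∨ t * k * t⁻¹ = k⁻¹) :
    growthOmega G = 1 := by
  classical
  have h1 : growthRate ({k, t} : Finset G) = 1 :=
    le_antisymm (growthRate_le_one_of_kt k t h) (one_le_growthRate _)
  apply le_antisymm
  · refine csInf_le ⟨1, ?_⟩ ⟨{k, t}, by simpa using hgen, h1⟩
    rintro r ⟨S, -, rfl⟩
    exact one_le_growthRate S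
  · refine le_csInf ⟨1, {k, t}, by simpa using hgen, h1⟩ ?_
    rintro r ⟨S, -, rfl⟩
    exact one_le_growthRate S

/-! ### Homomorphisms to the integers -/

/-- An additive character to the integers, as a bare function. -/
def IsChar {G : Type*} [Group G] (χ : G → ℤ) : Prop := ∀ a b, χ (a * b) = χ a + χ b

namespace IsChar
variable {G : Type*} [Group G] {χ : G → ℤ}

theorem one (h : IsChar χ) : χ 1 = 0 := by
  have := h 1 1
  rw [mul_one] at this
  omega

theorem inv (h : IsChar χ) (a : G) : χ a⁻¹ = -χ a := by
  have := h a a⁻¹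
  rw [mul_inv_cancel, h.one] at this
  omega

theorem npow (h : IsChar χ) (a : G) (n : ℕ) : χ (a ^ n) = n * χ a := by
  induction n with
  | zero => simp [h.one]
  | succ n ih => rw [pow_succ, h, ih]; push_cast; ring

theorem zpow (h : IsChar χ) (a : G) (n : ℤ) : χ (a ^ n) = n * χ a := by
  cases n with
  | ofNat n => simpa using h.npow a n
  | negSucc n => rw [zpow_negSucc, h.inv, h.npow]; push_cast [Int.negSucc_eq]; ring

theorem neg (h : IsChar χ) : IsChar (fun g => -χ g) := fun a b => by
  simp only [h a b]; ring

/-- kernel of a character -/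
def ker (h : IsChar χ) : Subgroup G where
  carrier := {g | χ g = 0}
  mul_mem' := by
    intro a b ha hb
    simp only [Set.mem_setOf_eq] at *
    rw [h, ha, hb, add_zero]
  one_mem' := h.one
  inv_mem' := by
    intro a ha
    simp only [Set.mem_setOf_eq] at *
    rw [h.inv, ha, neg_zero]

theorem mem_ker (h : IsChar χ) {g : G} : g ∈ h.ker ↔ χ g = 0 := Iff.rfl

theorem exists_surj (h : IsChar χ) (hne : ∃ g, χ g ≠ 0) :
    ∃ χ' : G → ℤ, IsChar χ' ∧ (∃ t, χ' t = 1) ∧ ∃ d : ℤ, ∀ g, χ g = d * χ' g := by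
  let R : AddSubgroup ℤ :=
    { carrier := Set.range χ
      add_mem' := by
        rintro _ _ ⟨a, rfl⟩ ⟨b, rfl⟩
        exact ⟨a * b, h a b⟩
      zero_mem' := ⟨1, h.one⟩
      neg_mem' := by
        rintro _ ⟨a, rfl⟩
        exact ⟨a⁻¹, h.inv a⟩ }
  obtain ⟨d, hd⟩ := Int.subgroup_cyclic R
  have hd' : ∀ g, d ∣ χ g := by
    intro g
    have : χ g ∈ R := ⟨g, rfl⟩
    rw [hd, AddSubgroup.mem_closure_singleton] at this
    obtain ⟨n, hn⟩ := this
    exact ⟨n, by rw [← hn, smul_eq_mul, mul_comm]⟩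
  have hd0 : d ≠ 0 := by
    rintro rfl
    obtain ⟨g, hg⟩ := hne
    exact hg (zero_dvd_iff.mp (hd' g))
  have hdR : d ∈ R := by rw [hd]; exact AddSubgroup.subset_closure rfl
  obtain ⟨t, ht⟩ := hdR
  refine ⟨fun g => χ g / d, ?_, ⟨t, ?_⟩, d, fun g => (Int.mul_ediv_cancel' (hd' g)).symm⟩
  · intro a b
    simp only [h a b]
    exact Int.add_ediv_of_dvd_left (hd' a)
  · simp only [ht]
    exact Int.ediv_self hd0

end IsChar

theorem exists_char_of_deficiency {G : Type*} [Group G] {n : ℕ}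
    (rels : Finset (FreeGroup (Fin n))) (hcard : rels.card + 1 = n)
    (e : G ≃* PresentedGroup (rels : Set (FreeGroup (Fin n)))) :
    ∃ χ : G → ℤ, IsChar χ ∧ ∃ t, χ t = 1 := by
  let Φ : (Fin n → ℤ) →+ (rels → ℤ) :=
    { toFun := fun c r => (FreeGroup.lift (fun i => Multiplicative.ofAdd (c i)) r.1).toAdd
      map_zero' := by
        ext r
        have : FreeGroup.lift (fun i => Multiplicative.ofAdd ((0 : Fin n → ℤ) i)) =
          (1 : FreeGroup (Fin n) →* Multiplicative ℤ) := by
          ext i; simp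
        rw [this]; rfl
      map_add' := by
        intro c c'
        ext r
        have : FreeGroup.lift (fun i => Multiplicative.ofAdd ((c + c') i)) =
          FreeGroup.lift (fun i => Multiplicative.ofAdd (c i)) *
          FreeGroup.lift (fun i => Multiplicative.ofAdd (c' i)) := by
          ext i; simp
        rw [this]; rfl }
  have hni : ¬ Function.Injective Φ := by
    intro hinj
    have := card_le_of_injective ℤ Φ.toIntLinearMap hinj
    simp at this
    omega
  rw [injective_iff_map_eq_zero] at hni
  push Not at hni
  obtain ⟨c, hc, hc0⟩ := hni
  have hrel : ∀ r ∈ (rels : Set (FreeGroup (Fin n))),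
      FreeGroup.lift (fun i => Multiplicative.ofAdd (c i)) r = 1 := by
    intro r hr
    exact congrFun hc ⟨r, hr⟩
  let ψ := PresentedGroup.toGroup hrel
  have h1 : IsChar (fun g : G => (ψ (e g)).toAdd) := by
    intro a b
    simp
  obtain ⟨i, hi⟩ := Function.ne_iff.mp hc0
  obtain ⟨χ, h, ht, -⟩ := h1.exists_surj ⟨e.symm (PresentedGroup.of i), by simpa [ψ] using hi⟩
  exact ⟨χ, h, ht⟩

/-! ### Finite generation of the kernel -/

theorem conj_sup_mem {G : Type*} [Group G] {A B C : Subgroup G} {y : G}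
    (hA : ∀ b ∈ A, y * b * y⁻¹ ∈ C) (hB : ∀ b ∈ B, y * b * y⁻¹ ∈ C) :
    ∀ b ∈ A ⊔ B, y * b * y⁻¹ ∈ C := by
  have : A ⊔ B ≤ C.comap (MulAut.conj y).toMonoidHom :=
    sup_le (fun b hb => by simpa using hA b hb) (fun b hb => by simpa using hB b hb)
  intro b hb
  simpa using this hb

theorem conj_closure_mem {G : Type*} [Group G] {T : Set G} {C : Subgroup G} {y : G}
    (hA : ∀ b ∈ T, y * b * y⁻¹ ∈ C) :
    ∀ b ∈ Subgroup.closure T, y * b * y⁻¹ ∈ C := by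
  have : Subgroup.closure T ≤ C.comap (MulAut.conj y).toMonoidHom := by
    rw [Subgroup.closure_le]
    intro b hb
    simpa using hA b hb
  intro b hb
  simpa using this hb

/-- finitely generated `x`-invariant subgroups of `K` -/
structure GoodSub {G : Type*} [Group G] (K : Subgroup G) (x : G) (B : Subgroup G) : Prop where
  le : B ≤ K
  fg : B.FG
  conj : ∀ b ∈ B, x * b * x⁻¹ ∈ B
  conj' : ∀ b ∈ B, x⁻¹ * b * x⁻¹⁻¹ ∈ B

section
variable {G : Type*} [Group G]

theorem GoodSub.sup {K : Subgroup G} {x : G} {B B' : Subgroup G} (h : GoodSub K x B)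
    (h' : GoodSub K x B') : GoodSub K x (B ⊔ B') where
  le := sup_le h.le h'.le
  fg := h.fg.sup h'.fg
  conj := conj_sup_mem (fun b hb => Subgroup.mem_sup_left (h.conj b hb))
    (fun b hb => Subgroup.mem_sup_right (h'.conj b hb))
  conj' := conj_sup_mem (fun b hb => Subgroup.mem_sup_left (h.conj' b hb))
    (fun b hb => Subgroup.mem_sup_right (h'.conj' b hb))

theorem GoodSub.bot (K : Subgroup G) (x : G) : GoodSub K x ⊥ where
  le := bot_le
  fg := ⟨∅, by simp⟩
  conj := by simp
  conj' := by simp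

theorem GoodSub.conj_zpow_mem {K : Subgroup G} {x : G} {B : Subgroup G} (h : GoodSub K x B)
    (m : ℤ) : ∀ b ∈ B, x ^ m * b * (x ^ m)⁻¹ ∈ B := by
  induction m with
  | zero => simp
  | succ m ih =>
    intro b hb
    have := h.conj _ (ih b hb)
    rw [add_comm, zpow_add, zpow_one]
    simpa [mul_assoc] using this
  | pred m ih =>
    intro b hb
    have := h.conj' _ (ih b hb)
    rw [sub_eq_add_neg, add_comm, zpow_add, zpow_neg_one]
    simpa [mul_assoc] using this

/-- the word in `x`, `x*a` -/
def xaWord (x a : G) (l : List Bool) : G := (l.map (fun b => cond b (x * a) x)).prod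

theorem xaWord_spec (x a : G) (l : List Bool) :
    ∃ c ∈ Subgroup.closure ((fun j : ℕ => x⁻¹ ^ j * a * x ^ j) '' Set.Iio l.length),
      xaWord x a l = x ^ l.length * c := by
  induction l with
  | nil => exact ⟨1, one_mem _, by simp [xaWord]⟩
  | cons b l ih =>
    obtain ⟨c, hc, he⟩ := ih
    have hmono : Subgroup.closure ((fun j : ℕ => x⁻¹ ^ j * a * x ^ j) '' Set.Iio l.length) ≤
        Subgroup.closure ((fun j : ℕ => x⁻¹ ^ j * a * x ^ j) '' Set.Iio (b :: l).length) :=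
      Subgroup.closure_mono (Set.image_mono (Set.Iio_subset_Iio (by simp)))
    cases b with
    | false =>
      refine ⟨c, hmono hc, ?_⟩
      simp only [xaWord, List.map_cons, List.prod_cons, List.length_cons, cond_false] at he ⊢
      rw [he, pow_succ', mul_assoc]
    | true =>
      refine ⟨x⁻¹ ^ l.length * a * x ^ l.length * c, mul_mem (Subgroup.subset_closure
        ⟨l.length, by simp, rfl⟩) (hmono hc), ?_⟩
      simp only [xaWord, List.map_cons, List.prod_cons, List.length_cons, cond_true] at he ⊢
      rw [he, pow_succ']
      simp [mul_assoc]

theorem exists_head_diff (x a : G) : ∀ (l l' : List Bool), l ≠ l' → l.length = l'.length →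
    xaWord x a l = xaWord x a l' → ∃ m m' : List Bool, m.length = m'.length ∧
      xaWord x a (true :: m) = xaWord x a (false :: m') := by
  intro l
  induction l with
  | nil => intro l' h1 h2; cases l' <;> simp_all
  | cons b l ih =>
    intro l' h1 h2 h3
    cases l' with
    | nil => simp at h2
    | cons b' l' =>
      by_cases hb : b = b'
      · subst hb
        refine ih l' (fun h => h1 (by rw [h])) (by simpa using h2) ?_
        simpa [xaWord] using h3
      · cases b <;> cases b' <;> try contradiction
        · exact ⟨l', l, by simpa using h2.symm, h3.symm⟩
        · exact ⟨l, l', by simpa using h2, h3⟩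

theorem exists_tail_diff (x a : G) : ∀ (l l' : List Bool), l ≠ l' → l.length = l'.length →
    xaWord x a l = xaWord x a l' → ∃ m m' : List Bool, m.length = m'.length ∧
      xaWord x a (m ++ [true]) = xaWord x a (m' ++ [false]) := by
  intro l
  induction l using List.reverseRecOn with
  | nil => intro l' h1 h2; cases l' <;> simp_all
  | append_singleton l b ih =>
    intro l' h1 h2 h3
    rcases List.eq_nil_or_concat l' with rfl | ⟨l', b', rfl⟩
    · simp at h2
    · rw [List.concat_eq_append] at h1 h2 h3
      by_cases hb : b = b'
      · subst hb
        refine ih l' (fun h => h1 (by rw [h])) (by simpa using h2) ?_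
        simpa [xaWord] using h3
      · cases b <;> cases b' <;> try contradiction
        · exact ⟨l', l, by simpa using h2.symm, h3.symm⟩
        · exact ⟨l, l', by simpa using h2, h3⟩

theorem char_xaWord {χ : G → ℤ} (hχ : IsChar χ) {x a : G} (ha : χ a = 0) (l : List Bool) :
    χ (xaWord x a l) = l.length * χ x := by
  induction l with
  | nil => simp [xaWord, hχ.one]
  | cons b l ih =>
    have : χ (xaWord x a (b :: l)) = χ x + χ (xaWord x a l) := by
      cases b <;> simp [xaWord, hχ _ _, ha]
    rw [this, ih]; push_cast [List.length_cons]; ring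

theorem good_of_not_freePair {χ : G → ℤ} (hχ : IsChar χ) {x a : G} (hx : χ x ≠ 0)
    (ha : χ a = 0) (hn : ¬ FreePair x (x * a)) : ∃ B, GoodSub hχ.ker x B ∧ a ∈ B := by
  unfold FreePair Function.Injective at hn
  push Not at hn
  obtain ⟨l, l', he, hne⟩ := hn
  change xaWord x a l = xaWord x a l' at he
  have hlen : l.length = l'.length := by
    have := congrArg χ he
    rw [char_xaWord hχ ha, char_xaWord hχ ha] at this
    exact_mod_cast mul_right_cancel₀ hx this
  set f : ℕ → G := fun j : ℕ => x⁻¹ ^ j * a * x ^ j with hf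
  have hfs : ∀ j, x⁻¹ * f j * x⁻¹⁻¹ = f (j + 1) := by
    intro j
    simp only [hf]
    rw [pow_succ', pow_succ]
    simp [mul_assoc]
  set B := Subgroup.closure (Set.range f) with hB
  have hconj' : ∀ b ∈ B, x⁻¹ * b * x⁻¹⁻¹ ∈ B := by
    apply conj_closure_mem
    rintro _ ⟨j, rfl⟩
    rw [hfs]
    exact Subgroup.subset_closure ⟨_, rfl⟩
  have hsub : ∀ n, Subgroup.closure (f '' Set.Iio n) ≤ B := fun n =>
    Subgroup.closure_mono (Set.image_subset_range _ _)
  refine ⟨B, ⟨?_, ?_, ?_, hconj'⟩, Subgroup.subset_closure ⟨0, by simp [hf]⟩⟩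
  · rw [hB, Subgroup.closure_le]
    rintro _ ⟨j, rfl⟩
    change χ _ = 0
    simp only [hf, hχ _ _, hχ.npow, hχ.inv, ha]
    ring
  · obtain ⟨m, m', hm, hh⟩ := exists_head_diff x a l l' hne hlen he
    obtain ⟨c, hc, hce⟩ := xaWord_spec x a m
    obtain ⟨c', hc', hce'⟩ := xaWord_spec x a m'
    set C := Subgroup.closure (f '' Set.Iio m.length) with hC
    have h1 : f m.length ∈ C := by
      have h2 : f m.length * c = c' := by
        have : x * a * xaWord x a m = x * xaWord x a m' := by
          simpa [xaWord] using hh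
        rw [hce, hce', hm] at this
        simp only [hf]
        rw [hm]
        have h3 : a * (x ^ m'.length * c) = x ^ m'.length * c' := by
          apply mul_left_cancel (a := x); simpa [mul_assoc] using this
        rw [mul_assoc, mul_assoc, h3]
        simp
      rw [eq_mul_inv_of_mul_eq h2]
      rw [← hm] at hc'
      exact mul_mem hc' (inv_mem hc)
    have h2 : ∀ j, f j ∈ C := by
      intro j
      induction j with
      | zero =>
        rcases Nat.eq_zero_or_pos m.length with h | h
        · rwa [h] at h1
        · exact Subgroup.subset_closure ⟨0, h, rfl⟩
      | succ j ih =>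
        rw [← hfs]
        refine conj_closure_mem (T := f '' Set.Iio m.length) ?_ _ ih
        rintro _ ⟨i, hi, rfl⟩
        rw [hfs]
        rcases Nat.lt_or_ge (i + 1) m.length with h | h
        · exact Subgroup.subset_closure ⟨i + 1, h, rfl⟩
        · have : i + 1 = m.length := le_antisymm hi h
          rw [this]; exact h1
    have : B = C := le_antisymm (by
      rw [hB, Subgroup.closure_le]
      rintro _ ⟨j, rfl⟩
      exact h2 j) (hsub _)
    rw [this, Subgroup.fg_iff]
    exact ⟨_, rfl, (Set.finite_Iio _).image _⟩
  · have key : x * a * x⁻¹ ∈ B := by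
      obtain ⟨m, m', hm, hh⟩ := exists_tail_diff x a l l' hne hlen he
      obtain ⟨c, hc, hce⟩ := xaWord_spec x a m
      obtain ⟨c', hc', hce'⟩ := xaWord_spec x a m'
      have : xaWord x a m * (x * a) = xaWord x a m' * x := by
        simpa [xaWord] using hh
      rw [hce, hce', hm, mul_assoc, mul_assoc] at this
      have := mul_left_cancel this
      have h2 : x * a * x⁻¹ = c⁻¹ * c' := by
        rw [mul_inv_eq_iff_eq_mul, mul_assoc, ← this]; simp
      rw [h2]
      exact mul_mem (inv_mem (hsub _ hc)) (hsub _ hc')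
    apply conj_closure_mem
    rintro _ ⟨j, rfl⟩
    cases j with
    | zero => simpa [hf] using key
    | succ j =>
      rw [← hfs]
      have : x * (x⁻¹ * f j * x⁻¹⁻¹) * x⁻¹ = f j := by simp [mul_assoc]
      rw [this]
      exact Subgroup.subset_closure ⟨_, rfl⟩

/-- image of a subgroup by conjugation -/
def conjSub (g : G) (B : Subgroup G) : Subgroup G := B.map (MulAut.conj g).toMonoidHom

theorem mem_conjSub {g b : G} {B : Subgroup G} : b ∈ conjSub g B ↔ ∃ c ∈ B, g * c * g⁻¹ = b := by
  simp [conjSub, Subgroup.mem_map]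

theorem conjSub_le_ker {χ : G → ℤ} (hχ : IsChar χ) {g : G} {B : Subgroup G} (h : B ≤ hχ.ker) :
    conjSub g B ≤ hχ.ker := by
  intro b hb
  obtain ⟨c, hc, rfl⟩ := mem_conjSub.mp hb
  have : χ c = 0 := h hc
  change χ _ = 0
  rw [hχ, hχ, hχ.inv, this]; ring

theorem conjSub_fg {g : G} {B : Subgroup G} (h : B.FG) : (conjSub g B).FG := by
  classical
  obtain ⟨T, hT⟩ := h
  exact ⟨T.image (MulAut.conj g).toMonoidHom, by
    rw [Finset.coe_image, ← MonoidHom.map_closure, hT, conjSub]⟩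

theorem good_mul {χ : G → ℤ} (hχ : IsChar χ) {x g h : G}
    (hg : ∃ B, GoodSub hχ.ker x B ∧ x⁻¹ * (g * x * g⁻¹) ∈ B)
    (hh : ∃ B, GoodSub hχ.ker x B ∧ x⁻¹ * (h * x * h⁻¹) ∈ B) :
    ∃ B, GoodSub hχ.ker x B ∧ x⁻¹ * ((g * h) * x * (g * h)⁻¹) ∈ B := by
  obtain ⟨B, hB, hb⟩ := hg
  obtain ⟨B', hB', hb'⟩ := hh
  have hl : B ≤ B ⊔ conjSub g B' := le_sup_left
  have hr : ∀ c ∈ B', g * c * g⁻¹ ∈ B ⊔ conjSub g B' := fun c hc =>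
    (le_sup_right : conjSub g B' ≤ _) (mem_conjSub.mpr ⟨c, hc, rfl⟩)
  refine ⟨B ⊔ conjSub g B', ⟨sup_le hB.le (conjSub_le_ker hχ hB'.le), hB.fg.sup (conjSub_fg hB'.fg),
    conj_sup_mem (fun b hb => hl (hB.conj b hb)) ?_,
    conj_sup_mem (fun b hb => hl (hB.conj' b hb)) ?_⟩, ?_⟩
  · intro b hbb
    obtain ⟨c, hc, rfl⟩ := mem_conjSub.mp hbb
    have h1 := hB.conj _ hb
    have h2 := hr _ (hB'.conj c hc)
    have := mul_mem (mul_mem (inv_mem (hl h1)) h2) (hl h1)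
    convert this using 1
    group
  · intro b hbb
    obtain ⟨c, hc, rfl⟩ := mem_conjSub.mp hbb
    have h2 := hr _ (hB'.conj' c hc)
    have := mul_mem (mul_mem (hl hb) h2) (inv_mem (hl hb))
    convert this using 1
    group
  · have := mul_mem (hl hb) (hr _ hb')
    convert this using 1
    group

theorem good_inv {χ : G → ℤ} (hχ : IsChar χ) {x g : G}
    (hg : ∃ B, GoodSub hχ.ker x B ∧ x⁻¹ * (g * x * g⁻¹) ∈ B) :
    ∃ B, GoodSub hχ.ker x B ∧ x⁻¹ * (g⁻¹ * x * g⁻¹⁻¹) ∈ B := by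
  obtain ⟨B, hB, hb⟩ := hg
  refine ⟨conjSub g⁻¹ B, ⟨conjSub_le_ker hχ hB.le, conjSub_fg hB.fg, ?_, ?_⟩, ?_⟩
  · intro b hbb
    obtain ⟨c, hc, rfl⟩ := mem_conjSub.mp hbb
    refine mem_conjSub.mpr ⟨_, hB.conj _ (mul_mem (mul_mem hb hc) (inv_mem hb)), ?_⟩
    group
  · intro b hbb
    obtain ⟨c, hc, rfl⟩ := mem_conjSub.mp hbb
    refine mem_conjSub.mpr ⟨_, mul_mem (mul_mem (inv_mem hb) (hB.conj' _ hc)) hb, ?_⟩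
    group
  · refine mem_conjSub.mpr ⟨_, inv_mem hb, ?_⟩
    group

theorem good_of_mem_ker {χ : G → ℤ} (hχ : IsChar χ) {x k : G} (hk : χ k = 0)
    (hg : ∃ B, GoodSub hχ.ker x B ∧ x⁻¹ * (k * x * k⁻¹) ∈ B) :
    ∃ B, GoodSub hχ.ker x B ∧ k ∈ B := by
  obtain ⟨B, hB, hb⟩ := hg
  have hl : B ≤ B ⊔ Subgroup.closure {k} := le_sup_left
  have hr : k ∈ B ⊔ Subgroup.closure {k} :=
    (le_sup_right : Subgroup.closure {k} ≤ _) (Subgroup.subset_closure rfl)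
  refine ⟨_, ⟨sup_le hB.le ?_, hB.fg.sup ⟨{k}, by simp⟩,
    conj_sup_mem (fun b hb => hl (hB.conj b hb)) (conj_closure_mem ?_),
    conj_sup_mem (fun b hb => hl (hB.conj' b hb)) (conj_closure_mem ?_)⟩, hr⟩
  · rw [Subgroup.closure_le]
    rintro _ rfl
    exact hk
  · rintro _ rfl
    have := mul_mem (inv_mem (hl (hB.conj _ hb))) hr
    convert this using 1
    group
  · rintro k rfl
    have := mul_mem (hl hb) hr
    convert this using 1
    group

theorem ker_fg_of_good {χ : G → ℤ} (hχ : IsChar χ) [Group.FG G] {x : G} (hx : χ x ≠ 0)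
    (hgood : ∀ k, χ k = 0 → ∃ B, GoodSub hχ.ker x B ∧ k ∈ B) : hχ.ker.FG := by
  classical
  let φ : G →* Multiplicative (ZMod (χ x).natAbs) :=
    { toFun := fun g => Multiplicative.ofAdd ((χ g : ℤ) : ZMod (χ x).natAbs)
      map_one' := by simp [hχ.one]
      map_mul' := by
        intro a b
        rw [hχ]
        push_cast
        rfl }
  have : NeZero (χ x).natAbs := ⟨by simpa using hx⟩
  have : Finite (Multiplicative (ZMod (χ x).natAbs)) := inferInstance
  have hfi : φ.ker.FiniteIndex := Subgroup.finiteIndex_ker φ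
  have hL : φ.ker.FG := by
    rw [← Group.fg_iff_subgroup_fg]
    exact Subgroup.fg_of_index_ne_zero _
  obtain ⟨T, hT⟩ := hL
  have hmem : ∀ g, g ∈ φ.ker ↔ χ x ∣ χ g := by
    intro g
    rw [MonoidHom.mem_ker, ← Int.natAbs_dvd, ← ZMod.intCast_zmod_eq_zero_iff_dvd]
    exact Iff.rfl
  have hdec : ∀ g ∈ φ.ker, ∃ m : ℤ, χ (g * x ^ (-m)) = 0 := by
    intro g hg
    obtain ⟨m, hm⟩ := (hmem g).mp hg
    exact ⟨m, by rw [hχ, hχ.zpow, hm]; ring⟩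
  have hfin : ∀ T' : Finset G, (∀ g ∈ T', g ∈ φ.ker) →
      ∃ B, GoodSub hχ.ker x B ∧ ∀ g ∈ T', ∃ m : ℤ, g * x ^ (-m) ∈ B := by
    intro T'
    induction T' using Finset.induction_on with
    | empty => intro _; exact ⟨⊥, GoodSub.bot _ _, by simp⟩
    | insert a T' _ ih =>
      intro h
      obtain ⟨B, hB, hB'⟩ := ih fun g hg => h g (by simp [hg])
      obtain ⟨m, hm⟩ := hdec a (h a (by simp))
      obtain ⟨B1, hB1, hB1'⟩ := hgood _ hm
      refine ⟨B ⊔ B1, hB.sup hB1, ?_⟩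
      intro g hg
      rcases Finset.mem_insert.mp hg with rfl | hg
      · exact ⟨m, Subgroup.mem_sup_right hB1'⟩
      · obtain ⟨m, hm⟩ := hB' g hg
        exact ⟨m, Subgroup.mem_sup_left hm⟩
  obtain ⟨B, hB, hB'⟩ := hfin T fun g hg => by rw [← hT]; exact Subgroup.subset_closure hg
  have hall : ∀ g ∈ Subgroup.closure (T : Set G), ∃ m : ℤ, g * x ^ (-m) ∈ B := by
    intro g hg
    induction hg using Subgroup.closure_induction with
    | mem g hg => exact hB' g hg
    | one => exact ⟨0, by simp⟩
    | mul a b _ _ iha ihb =>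
      obtain ⟨m, hm⟩ := iha
      obtain ⟨m', hm'⟩ := ihb
      refine ⟨m + m', ?_⟩
      have := mul_mem hm (hB.conj_zpow_mem m _ hm')
      convert this using 1
      group
    | inv a _ iha =>
      obtain ⟨m, hm⟩ := iha
      refine ⟨-m, ?_⟩
      have := hB.conj_zpow_mem (-m) _ (inv_mem hm)
      convert this using 1
      group
  have : hχ.ker = B := by
    apply le_antisymm _ hB.le
    intro k hk
    have hk0 : χ k = 0 := hk
    obtain ⟨m, hm⟩ := hall k (by rw [hT, hmem, hk0]; exact dvd_zero _)
    have h2 : χ (k * x ^ (-m)) = 0 := hB.le hm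
    rw [hχ, hχ.zpow, hk0] at h2
    have : m = 0 := by
      rcases mul_eq_zero.mp (by linarith : m * χ x = 0) with h | h
      · exact h
      · exact absurd h hx
    subst this
    simpa using hm
  rw [this]
  exact hB.fg

/-- Lemma A. -/
theorem ker_fg_of_not_freePair {χ : G → ℤ} (hχ : IsChar χ) {S : Finset G}
    (hS : Subgroup.closure (S : Set G) = ⊤) {x : G} (hx : χ x ≠ 0)
    (hn : ∀ s ∈ S, ¬ FreePair x (s * x * s⁻¹)) : hχ.ker.FG := by
  have : Group.FG G := Group.fg_def.mpr ⟨S, hS⟩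
  have hall : ∀ g : G, ∃ B, GoodSub hχ.ker x B ∧ x⁻¹ * (g * x * g⁻¹) ∈ B := by
    intro g
    have hg : g ∈ Subgroup.closure (S : Set G) := by rw [hS]; trivial
    induction hg using Subgroup.closure_induction with
    | mem s hs =>
      refine good_of_not_freePair hχ hx ?_ ?_
      · rw [hχ, hχ, hχ, hχ.inv, hχ.inv]; ring
      · have := hn s hs
        rwa [mul_inv_cancel_left]
    | one => exact ⟨⊥, GoodSub.bot _ _, by simp⟩
    | mul a b _ _ iha ihb => exact good_mul hχ iha ihb
    | inv a _ ih => exact good_inv hχ ih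
  exact ker_fg_of_good hχ hx fun k hk => good_of_mem_ker hχ hk (hall k)

end

/-! ### Group ring tools and Fox calculus -/

/-- The integral group ring. -/
abbrev ZG (G : Type*) [Group G] : Type _ := MonoidAlgebra ℤ G

section grouping
variable {G : Type*} [Group G]

/-- group element as group ring element -/
noncomputable def gr (g : G) : ZG G := MonoidAlgebra.single g 1

theorem gr_mul (a b : G) : gr (a * b) = gr a * gr b := by
  simp [gr, MonoidAlgebra.single_mul_single]

theorem gr_one : gr (1 : G) = 1 := rfl

theorem gr_inv_mul (a : G) : gr a⁻¹ * gr a = 1 := by rw [← gr_mul, inv_mul_cancel, gr_one]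

theorem gr_mul_inv (a : G) : gr a * gr a⁻¹ = 1 := by rw [← gr_mul, mul_inv_cancel, gr_one]

theorem gr_pow (a : G) (n : ℕ) : gr (a ^ n) = gr a ^ n := by
  simp [gr, MonoidAlgebra.single_pow]

theorem single_eq_smul_gr (g : G) (n : ℤ) : (MonoidAlgebra.single g n : ZG G) = n • gr g := by
  simp [gr]

theorem coeff_gr_mul (g : G) (x : ZG G) (h : G) : (gr g * x).coeff h = x.coeff (g⁻¹ * h) := by
  simp [gr, MonoidAlgebra.coeff_single_mul_apply]

theorem coeff_mul_gr (g : G) (x : ZG G) (h : G) : (x * gr g).coeff h = x.coeff (h * g⁻¹) := by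
  simp [gr, MonoidAlgebra.coeff_mul_single_apply]

theorem coeff_gr [DecidableEq G] (g h : G) : (gr g : ZG G).coeff h = if g = h then 1 else 0 := by
  simp [gr, Finsupp.single_apply]

theorem ZG_hom_ext {M : Type*} [AddCommGroup M] {f f' : ZG G →+ M}
    (h : ∀ g, f (gr g) = f' (gr g)) : f = f' := by
  apply MonoidAlgebra.addMonoidHom_ext
  intro g n
  rw [single_eq_smul_gr, map_zsmul, map_zsmul, h]

theorem ZG_induction {P : ZG G → Prop} (x : ZG G) (hg : ∀ g, P (gr g))
    (hadd : ∀ x y, P x → P y → P (x + y)) (hneg : ∀ x, P x → P (-x)) : P x := by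
  have h0 : P 0 := by
    have := hadd _ _ (hg 1) (hneg _ (hg 1))
    rwa [add_neg_cancel] at this
  refine MonoidAlgebra.induction_linear x h0 hadd ?_
  intro g n
  rw [single_eq_smul_gr]
  induction n with
  | zero => simpa using h0
  | succ n ih => rw [add_smul, one_smul]; exact hadd _ _ ih (hg g)
  | pred n ih => rw [sub_smul, one_smul, sub_eq_add_neg]; exact hadd _ _ ih (hneg _ (hg g))

/-- linear extension of a function on the group -/
noncomputable def linExt {M : Type*} [AddCommGroup M] (f : G → M) : ZG G →+ M :=
  (Finsupp.liftAddHom (fun g => (zmultiplesHom M) (f g))).comp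
    (MonoidAlgebra.coeffAddEquiv (R := ℤ) (M := G)).toAddMonoidHom

theorem linExt_gr {M : Type*} [AddCommGroup M] (f : G → M) (g : G) : linExt f (gr g) = f g := by
  change (Finsupp.liftAddHom (fun g => (zmultiplesHom M) (f g))) (Finsupp.single g 1) = _
  simp

theorem linExt_apply {M : Type*} [AddCommGroup M] (f : G → M) (x : ZG G) :
    linExt f x = x.coeff.sum (fun g n => n • f g) := by
  rfl

end grouping

/-- affine permutation of a module -/
noncomputable def affPerm {G : Type*} [Group G] {M : Type*} [AddCommGroup M] [Module (ZG G) M] (g : G) (c : M) :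
    Equiv.Perm M where
  toFun m := gr g • m + c
  invFun m := gr g⁻¹ • (m - c)
  left_inv m := by simp [smul_smul, gr_inv_mul]
  right_inv m := by simp [smul_smul, gr_mul_inv]

theorem fox_exact {G : Type*} [Group G] {n : ℕ}
    (rels : Finset (FreeGroup (Fin n)))
    (e : G ≃* PresentedGroup (rels : Set (FreeGroup (Fin n)))) :
    ∃ (g : Fin n → G) (F : Matrix rels (Fin n) (ZG G)),
      (∀ r, ∑ i, F r i * (gr (g i) - 1) = 0) ∧
      (∀ v : Fin n → ZG G, ∑ i, v i * (gr (g i) - 1) = 0 → ∃ w, v = Matrix.vecMul w F) ∧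
      (∀ h : G, ∃ v : Fin n → ZG G, ∑ i, v i * (gr (g i) - 1) = gr h - 1) := by
  classical
  set g : Fin n → G := fun i => e.symm (PresentedGroup.of i) with hg
  set π : FreeGroup (Fin n) →* G := FreeGroup.lift g with hπ
  have hπe : ∀ w, π w = e.symm (PresentedGroup.mk _ w) := by
    intro w
    have : π = e.symm.toMonoidHom.comp (PresentedGroup.mk (rels : Set (FreeGroup (Fin n)))) := by
      ext i; simp [hπ, hg, PresentedGroup.of]
    rw [this]; rfl
  have hπs : Function.Surjective π := by
    intro h
    obtain ⟨w, hw⟩ := PresentedGroup.mk_surjective _ (e h)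
    exact ⟨w, by rw [hπe, hw]; simp⟩
  have hπr : ∀ r ∈ rels, π r = 1 := by
    intro r hr
    rw [hπe, PresentedGroup.one_of_mem (rels := (rels : Set (FreeGroup (Fin n)))) hr]; simp
  set ρ : FreeGroup (Fin n) →* Equiv.Perm (Fin n → ZG G) :=
    FreeGroup.lift (fun i => affPerm (g i) (Pi.single i 1)) with hρ
  let L : (Fin n → ZG G) → ZG G := fun v => ∑ i, v i * (gr (g i) - 1) + 1
  have hL : ∀ w m, L (ρ w m) = gr (π w) * L m := by
    intro w
    induction w using FreeGroup.induction_on with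
    | C1 => intro m; simp [gr_one]
    | of i =>
      intro m
      simp only [hρ, hπ, FreeGroup.lift_apply_of, L, affPerm, Equiv.coe_fn_mk, Pi.add_apply,
        Pi.smul_apply, smul_eq_mul, add_mul, Finset.sum_add_distrib, mul_add, Finset.mul_sum,
        mul_assoc, mul_one]
      rw [Finset.sum_eq_single i (f := fun j => (Pi.single i 1 : Fin n → ZG G) j * (gr (g j) - 1))]
      · simp [add_assoc]
      · intro j _ hj
        simp [hj]
      · simp
    | inv_of i ih =>
      intro m
      have h1 := ih (ρ (FreeGroup.of i)⁻¹ m)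
      rw [← Equiv.Perm.mul_apply, ← map_mul, mul_inv_cancel, map_one, Equiv.Perm.one_apply] at h1
      rw [h1, map_inv π, ← mul_assoc, gr_inv_mul, one_mul]
    | mul a b ha hb =>
      intro m
      rw [map_mul, Equiv.Perm.mul_apply, ha, hb, map_mul, gr_mul, mul_assoc]
  have hLd : ∀ w, ∑ i, (ρ w 0) i * (gr (g i) - 1) = gr (π w) - 1 := by
    intro w
    have := hL w 0
    simp only [L] at this
    simp only [Pi.zero_apply, zero_mul, Finset.sum_const_zero, zero_add, mul_one] at this
    rw [← this]; simp
  let F : Matrix rels (Fin n) (ZG G) := fun r => ρ r.1 0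
  refine ⟨g, F, ?_, ?_, ?_⟩
  · intro r
    have := hLd r.1
    rw [hπr r.1 r.2, gr_one, sub_self] at this
    exact this
  · let N : Submodule (ZG G) (Fin n → ZG G) := Submodule.span _ (Set.range F)
    let Q := (Fin n → ZG G) ⧸ N
    set ρQ : FreeGroup (Fin n) →* Equiv.Perm Q :=
      FreeGroup.lift (fun i => affPerm (g i) (N.mkQ (Pi.single i 1))) with hρQ
    have h1 : ∀ w m, ρQ w (N.mkQ m) = N.mkQ (ρ w m) := by
      intro w
      induction w using FreeGroup.induction_on with
      | C1 => intro m; simp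
      | of i =>
        intro m
        simp only [hρ, hρQ, FreeGroup.lift_apply_of, affPerm, Equiv.coe_fn_mk, map_add, map_smul]
      | inv_of i ih =>
        intro m
        have := ih (ρ (FreeGroup.of i)⁻¹ m)
        rw [← Equiv.Perm.mul_apply (ρ _), ← map_mul, mul_inv_cancel, map_one,
          Equiv.Perm.one_apply] at this
        rw [← this, ← Equiv.Perm.mul_apply, ← map_mul, inv_mul_cancel, map_one,
          Equiv.Perm.one_apply]
      | mul a b ha hb =>
        intro m
        rw [map_mul, Equiv.Perm.mul_apply, hb, ha, map_mul, Equiv.Perm.mul_apply]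
    have h2 : ∀ w m, ρ w m = gr (π w) • m + ρ w 0 := by
      intro w
      induction w using FreeGroup.induction_on with
      | C1 => intro m; simp [gr_one]
      | of i =>
        intro m
        simp [hρ, hπ, FreeGroup.lift_apply_of, affPerm]
      | inv_of i ih =>
        intro m
        apply (ρ (FreeGroup.of i)).injective
        rw [ih (_ + _), smul_add, smul_smul, ← gr_mul, ← map_mul, mul_inv_cancel, map_one, gr_one,
          one_smul, add_assoc, ← ih, ← Equiv.Perm.mul_apply, ← map_mul, mul_inv_cancel,
          ← Equiv.Perm.mul_apply, ← map_mul, mul_inv_cancel]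
        simp
      | mul a b ha hb =>
        intro m
        rw [map_mul, Equiv.Perm.mul_apply, ha, hb, Equiv.Perm.mul_apply, ha (ρ b 0), map_mul,
          gr_mul, mul_smul, smul_add, add_assoc]
    have h3 : ∀ r ∈ (rels : Set (FreeGroup (Fin n))), ρQ r = 1 := by
      intro r hr
      ext q
      obtain ⟨m, rfl⟩ := N.mkQ_surjective q
      rw [h1, h2, hπr r hr, gr_one, one_smul, map_add]
      have : N.mkQ (ρ r 0) = 0 := by
        rw [Submodule.mkQ_apply, Submodule.Quotient.mk_eq_zero]
        exact Submodule.subset_span ⟨⟨r, hr⟩, rfl⟩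
      rw [this, add_zero]; rfl
    let θ : G →* Equiv.Perm Q := (PresentedGroup.toGroup h3).comp e.toMonoidHom
    have hθ : ∀ w, θ (π w) = ρQ w := by
      intro w
      have : θ.comp π = ρQ := by
        ext i : 1
        simp [θ, hπ, hg, hρQ]
      rw [← this]; rfl
    let D : G → Q := fun h => θ h 0
    have hD : ∀ h h', D (h * h') = gr h • D h' + D h := by
      intro h h'
      obtain ⟨w, rfl⟩ := hπs h
      obtain ⟨m, hm⟩ := N.mkQ_surjective (D (h'))
      have e1 : D (π w * h') = θ (π w) (D h') := by simp [D]
      have e2 : D (π w) = N.mkQ (ρ w 0) := by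
        simp only [D]; rw [hθ, ← h1, map_zero N.mkQ]
      rw [e1, e2, ← hm, hθ, h1, h2, map_add, map_smul]
    have hD1 : ∀ i, D (g i) = N.mkQ (Pi.single i 1) := by
      intro i
      have : g i = π (FreeGroup.of i) := by simp [hπ]
      simp only [D]
      rw [this, hθ, hρQ, FreeGroup.lift_apply_of]
      simp [affPerm]
    have hlin : ∀ (a : ZG G) (h : G), linExt D (a * (gr h - 1)) = a • D h := by
      intro a h
      induction a using ZG_induction with
      | hg k =>
        rw [mul_sub, mul_one, ← gr_mul, map_sub, linExt_gr, linExt_gr, hD]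
        simp
      | hadd x y hx hy =>
        rw [add_mul, map_add, hx, hy, add_smul]
      | hneg x hx =>
        rw [neg_mul, map_neg, hx, neg_smul]
    intro v hv
    have h4 : N.mkQ v = 0 := by
      have h5 : v = ∑ i, v i • (Pi.single i 1 : Fin n → ZG G) := by
        ext j : 1
        simp [Finset.sum_apply, Pi.single_apply]
      have h6 := congrArg (linExt D) hv
      rw [map_sum, map_zero] at h6
      rw [h5, map_sum, ← h6]
      refine Finset.sum_congr rfl fun i _ => ?_
      rw [hlin, hD1, map_smul]
    rw [Submodule.mkQ_apply, Submodule.Quotient.mk_eq_zero] at h4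
    obtain ⟨w, hw⟩ := (Submodule.mem_span_range_iff_exists_fun _).mp h4
    refine ⟨w, ?_⟩
    rw [← hw]
    ext j : 1
    simp [Matrix.vecMul, dotProduct, Finset.sum_apply]
  · intro h
    obtain ⟨w, rfl⟩ := hπs h
    exact ⟨ρ w 0, hLd w⟩

/-! ### The matrix `J` -/

/-- support in `m ≤ χ` -/
def SuppGE {G : Type*} [Group G] (χ : G → ℤ) (m : ℤ) (a : ZG G) : Prop :=
  ∀ h, a.coeff h ≠ 0 → m ≤ χ h

namespace SuppGE
variable {G : Type*} [Group G] {χ : G → ℤ}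

theorem zero (m : ℤ) : SuppGE χ m (0 : ZG G) := by
  intro h hh
  simp at hh

theorem mono {m m' : ℤ} {a : ZG G} (h : SuppGE χ m a) (hm : m' ≤ m) : SuppGE χ m' a :=
  fun g hg => hm.trans (h g hg)

theorem add {m : ℤ} {a b : ZG G} (ha : SuppGE χ m a) (hb : SuppGE χ m b) :
    SuppGE χ m (a + b) := by
  intro h hh
  by_cases h1 : a.coeff h = 0
  · apply hb h
    intro h2
    simp [h1, h2] at hh
  · exact ha h h1

theorem neg {m : ℤ} {a : ZG G} (ha : SuppGE χ m a) : SuppGE χ m (-a) := by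
  intro h hh
  apply ha h
  intro h2
  simp [h2] at hh

theorem sum {ι : Type*} {s : Finset ι} {f : ι → ZG G} {m : ℤ} (h : ∀ i ∈ s, SuppGE χ m (f i)) :
    SuppGE χ m (∑ i ∈ s, f i) := by
  classical
  induction s using Finset.induction_on with
  | empty => simpa using zero m
  | insert a s ha ih =>
    rw [Finset.sum_insert ha]
    exact (h a (by simp)).add (ih fun i hi => h i (by simp [hi]))

theorem mul (hχ : IsChar χ) {m m' : ℤ} {a b : ZG G} (ha : SuppGE χ m a) (hb : SuppGE χ m' b) :
    SuppGE χ (m + m') (a * b) := by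
  intro h hh
  rw [MonoidAlgebra.coeff_mul_apply_left, Finsupp.sum] at hh
  obtain ⟨g, hg, hne⟩ := Finset.exists_ne_zero_of_sum_ne_zero hh
  have h1 := ha g (left_ne_zero_of_mul hne)
  have h2 := hb _ (right_ne_zero_of_mul hne)
  rw [hχ, hχ.inv] at h2
  omega

theorem gr (g : G) : SuppGE χ (χ g) (gr g) := by
  classical
  intro h hh
  rw [coeff_gr] at hh
  split_ifs at hh with h1
  · rw [h1]
  · exact absurd rfl hh

theorem ex (χ : G → ℤ) (a : ZG G) : ∃ m, SuppGE χ m a := by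
  induction a using ZG_induction with
  | hg g => exact ⟨_, SuppGE.gr g⟩
  | hadd x y hx hy =>
    obtain ⟨m, hm⟩ := hx
    obtain ⟨m', hm'⟩ := hy
    exact ⟨min m m', (hm.mono (min_le_left _ _)).add (hm'.mono (min_le_right _ _))⟩
  | hneg x hx =>
    obtain ⟨m, hm⟩ := hx
    exact ⟨m, hm.neg⟩

theorem ex_fin {ι : Type*} [Fintype ι] (χ : G → ℤ) (a : ι → ZG G) :
    ∃ m, ∀ i, SuppGE χ m (a i) := by
  classical
  choose m hm using fun i => ex χ (a i)
  refine ⟨-∑ i, |m i|, fun i => (hm i).mono ?_⟩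
  have := Finset.single_le_sum (f := fun i => |m i|) (fun i _ => abs_nonneg _) (Finset.mem_univ i)
  have := neg_abs_le (m i)
  linarith

end SuppGE

theorem gr_zpow_sub_one {G : Type*} [Group G] (t : G) (m : ℤ) :
    ∃ c : ZG G, gr (t ^ m) - 1 = c * (gr t - 1) := by
  induction m with
  | zero => exact ⟨0, by simp [gr_one]⟩
  | succ m ih =>
    obtain ⟨c, hc⟩ := ih
    refine ⟨gr (t ^ (m : ℤ)) + c, ?_⟩
    rw [add_mul, ← hc, zpow_add, zpow_one, gr_mul, mul_sub, mul_one]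
    abel
  | pred m ih =>
    obtain ⟨c, hc⟩ := ih
    refine ⟨c - gr (t ^ (-(m : ℤ) - 1)), ?_⟩
    rw [sub_mul, ← hc, mul_sub, ← gr_mul, ← zpow_add_one, sub_add_cancel, mul_one]
    abel

theorem exists_T_aux {G : Type*} [Group G] {χ : G → ℤ} (hχ : IsChar χ) {t : G} (ht : χ t = 1)
    (hfg : hχ.ker.FG) {κ : Type*} [Fintype κ] (g : κ → G)
    (hgen : ∀ h : G, ∃ v : κ → ZG G, ∑ i, v i * (gr (g i) - 1) = gr h - 1) (h : G) :
    ∃ (T : κ → ZG G) (c : ZG G), (∀ i, SuppGE χ 1 (T i)) ∧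
      gr h - 1 = ∑ i, T i * (gr (g i) - 1) + c * (gr t - 1) := by
  classical
  let X : ZG G → Prop := fun x => ∃ T : κ → ZG G, (∀ i, SuppGE χ 1 (T i)) ∧
    x = ∑ i, T i * (gr (g i) - 1)
  have Xadd : ∀ x y, X x → X y → X (x + y) := by
    rintro x y ⟨T, hT, rfl⟩ ⟨T', hT', rfl⟩
    refine ⟨fun i => T i + T' i, fun i => (hT i).add (hT' i), ?_⟩
    rw [← Finset.sum_add_distrib]
    exact Finset.sum_congr rfl fun i _ => by rw [add_mul]
  have Xmul : ∀ a x, SuppGE χ 0 a → X x → X (a * x) := by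
    rintro a x ha ⟨T, hT, rfl⟩
    refine ⟨fun i => a * T i, fun i => by simpa using ha.mul hχ (hT i), ?_⟩
    rw [Finset.mul_sum]
    exact Finset.sum_congr rfl fun i _ => by rw [mul_assoc]
  have Xneg : ∀ x, X x → X (-x) := by
    rintro x ⟨T, hT, rfl⟩
    refine ⟨fun i => -T i, fun i => (hT i).neg, ?_⟩
    rw [← Finset.sum_neg_distrib]
    exact Finset.sum_congr rfl fun i _ => by rw [neg_mul]
  have hlarge : ∀ k : G, ∃ N : ℕ, ∀ M : ℕ, N ≤ M → X (gr (t ^ M) * (gr k - 1)) := by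
    intro k
    obtain ⟨v, hv⟩ := hgen k
    obtain ⟨m, hm⟩ := SuppGE.ex_fin χ v
    refine ⟨(1 - m).toNat, fun M hM => ⟨fun i => gr (t ^ M) * v i, fun i => ?_, ?_⟩⟩
    · refine ((SuppGE.gr (t ^ M)).mul hχ (hm i)).mono ?_
      rw [hχ.npow, ht]
      omega
    · rw [← hv, Finset.mul_sum]
      exact Finset.sum_congr rfl fun i _ => by rw [mul_assoc]
  have hlargeS : ∀ S : Finset G, ∃ N : ℕ, ∀ k ∈ S, X (gr (t ^ N) * (gr k - 1)) := by
    intro S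
    choose N hN using hlarge
    exact ⟨∑ k ∈ S, N k, fun k hk => hN k _ (Finset.single_le_sum (f := N) (by simp) hk)⟩
  obtain ⟨S, hS⟩ := hfg
  obtain ⟨N, hN⟩ := hlargeS S
  have hconj : ∀ k, χ k = 0 → SuppGE χ 0 (gr (t ^ N * k * (t ^ N)⁻¹)) := by
    intro k hk
    have h1 : χ (t ^ N * k * (t ^ N)⁻¹) = 0 := by rw [hχ, hχ, hχ.inv, hk]; ring
    have := SuppGE.gr (χ := χ) (t ^ N * k * (t ^ N)⁻¹)
    rwa [h1] at this
  have hallK : ∀ k ∈ hχ.ker, X (gr (t ^ N) * (gr k - 1)) := by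
    intro k hk
    rw [← hS] at hk
    induction hk using Subgroup.closure_induction with
    | mem k hk => exact hN k hk
    | one =>
      rw [gr_one, sub_self, mul_zero]
      exact ⟨0, fun i => SuppGE.zero 1, by simp⟩
    | mul a b ha hb iha ihb =>
      rw [hS] at ha
      have := Xadd _ _ (Xmul _ _ (hconj a ha) ihb) iha
      convert this using 1
      rw [← mul_assoc, ← gr_mul, inv_mul_cancel_right, gr_mul, gr_mul]
      noncomm_ring
    | inv a ha iha =>
      rw [hS] at ha
      have := Xneg _ (Xmul _ _ (hconj _ (inv_mem ha)) iha)
      convert this using 1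
      rw [← mul_assoc, ← gr_mul, inv_mul_cancel_right, gr_mul, mul_sub, mul_sub, mul_assoc,
        gr_inv_mul]
      noncomm_ring
  let Y : ZG G → Prop := fun x => ∃ (T : κ → ZG G) (c : ZG G), (∀ i, SuppGE χ 1 (T i)) ∧
      x = ∑ i, T i * (gr (g i) - 1) + c * (gr t - 1)
  have XY : ∀ x c, X x → Y (x + c * (gr t - 1)) := by
    rintro x c ⟨T, hT, rfl⟩
    exact ⟨T, c, hT, rfl⟩
  change Y (gr h - 1)
  obtain ⟨c1, h1⟩ := gr_zpow_sub_one t (χ h)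
  obtain ⟨c2, h2⟩ := gr_zpow_sub_one t (N : ℤ)
  obtain ⟨c3, h3⟩ := gr_zpow_sub_one t (-(N : ℤ))
  set k := h * t ^ (-χ h) with hk
  have hχk : χ k = 0 := by rw [hk, hχ, hχ.zpow, ht]; ring
  set k' := (t ^ N)⁻¹ * k * t ^ N with hk'
  have hχk' : χ k' = 0 := by rw [hk', hχ, hχ, hχ.inv, hχk]; ring
  have e1 : h = k * t ^ (χ h) := by rw [hk]; group
  have e2 : k = t ^ N * k' * t ^ (-(N : ℤ)) := by rw [hk']; group
  have := XY _ (gr k * c1 + gr (t ^ N * k') * c3 + c2) (hallK k' hχk')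
  convert this using 1
  have e3 : gr h - 1 = gr k * (gr (t ^ χ h) - 1) + (gr k - 1) := by
    conv_lhs => rw [e1, gr_mul]
    noncomm_ring
  have e4 : gr k - 1 = gr (t ^ N * k') * (gr (t ^ (-(N : ℤ))) - 1) + gr (t ^ N) * (gr k' - 1)
      + (gr (t ^ N) - 1) := by
    conv_lhs => rw [e2, gr_mul (t ^ N * k'), gr_mul (t ^ N) k']
    rw [gr_mul (t ^ N) k']
    noncomm_ring
  have e5 : gr (t ^ N) - 1 = c2 * (gr t - 1) := by rw [← h2, zpow_natCast]
  rw [e3, h1, e4, h3, e5]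
  noncomm_ring

/-- The data extracted from the presentation. -/
theorem exists_J {G : Type*} [Group G] {n : ℕ}
    (rels : Finset (FreeGroup (Fin n))) (hcard : rels.card + 1 = n)
    (e : G ≃* PresentedGroup (rels : Set (FreeGroup (Fin n))))
    {χ : G → ℤ} (hχ : IsChar χ) {t : G} (ht : χ t = 1) (hfg : hχ.ker.FG) :
    ∃ (g : Fin n → G) (J : Matrix (Fin n) (Fin n) (ZG G)),
      (∀ h : G, ∃ v : Fin n → ZG G, ∑ i, v i * (gr (g i) - 1) = gr h - 1) ∧
      (∀ w, ∃ c, ∑ i, (Matrix.vecMul w J) i * (gr (g i) - 1) = c * (gr t - 1)) ∧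
      (∀ v : Fin n → ZG G, ∑ i, v i * (gr (g i) - 1) = 0 → ∃ w, v = Matrix.vecMul w J) ∧
      (∃ T V : Matrix (Fin n) (Fin n) (ZG G), (∀ i j, SuppGE χ 1 (T i j)) ∧ V * J = 1 - T) ∧
      (∃ T V : Matrix (Fin n) (Fin n) (ZG G), (∀ i j, SuppGE (fun h => -χ h) 1 (T i j)) ∧
        V * J = 1 - T) := by
  classical
  obtain ⟨g, F, hF, hex, hgen⟩ := fox_exact rels e
  obtain ⟨wt, hwt⟩ := hgen t
  let J0 : Matrix (Option rels) (Fin n) (ZG G) := fun o => Option.elim o wt F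
  have hJA : ∀ w : Option rels → ZG G, ∑ i, (Matrix.vecMul w J0) i * (gr (g i) - 1)
      = w none * (gr t - 1) := by
    intro w
    simp only [Matrix.vecMul, dotProduct, Finset.sum_mul]
    rw [Finset.sum_comm, Fintype.sum_option]
    simp only [J0, Option.elim, mul_assoc]
    rw [← Finset.mul_sum, hwt]
    simp_rw [← Finset.mul_sum, hF]
    simp
  have hb : ∀ (v : Fin n → ZG G) c, ∑ i, v i * (gr (g i) - 1) = c * (gr t - 1) →
      ∃ w, v = Matrix.vecMul w J0 := by
    intro v c hv
    obtain ⟨w, hw⟩ := hex (fun i => v i - c * wt i) (by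
      simp only [sub_mul, Finset.sum_sub_distrib, hv, mul_assoc]
      rw [← Finset.mul_sum, hwt, sub_self])
    refine ⟨fun o => Option.elim o c w, ?_⟩
    ext j : 1
    have := congrFun hw j
    simp only [Matrix.vecMul, dotProduct] at this ⊢
    rw [Fintype.sum_option]
    simp only [J0, Option.elim]
    rw [← this]; abel
  have hTV : ∀ (χ' : G → ℤ) (t' : G) (hχ' : IsChar χ'), χ' t' = 1 → hχ'.ker.FG →
      (∃ c, gr t' - 1 = c * (gr t - 1)) →
      ∃ (T : Matrix (Fin n) (Fin n) (ZG G)) (V : Matrix (Fin n) (Option rels) (ZG G)),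
        (∀ i j, SuppGE χ' 1 (T i j)) ∧ V * J0 = 1 - T := by
    rintro χ' t' hχ' ht' hfg' ⟨c0, hc0⟩
    choose T c hT hc using fun k => exists_T_aux hχ' ht' hfg' g hgen (g k)
    have hrow : ∀ k, ∃ w, ((1 : Matrix (Fin n) (Fin n) (ZG G)) - Matrix.of T) k = Matrix.vecMul w J0 := by
      intro k
      refine hb _ (c k * c0) ?_
      rw [mul_assoc, ← hc0]
      simp only [Matrix.sub_apply, Matrix.of_apply, sub_mul, Finset.sum_sub_distrib]
      rw [sub_eq_iff_eq_add', ← hc k]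
      simp [Matrix.one_apply]
    choose V hV using hrow
    refine ⟨Matrix.of T, V, hT, ?_⟩
    ext1 k
    rw [hV k]
    intro j
    rfl
  have hc : Fintype.card (Fin n) = Fintype.card (Option rels) := by simp [hcard]
  let σ : Fin n ≃ Option rels := Fintype.equivOfCardEq hc
  have hvm : ∀ w : Fin n → ZG G, Matrix.vecMul w (J0.submatrix σ id) =
      Matrix.vecMul (w ∘ σ.symm) J0 := by
    intro w
    ext1 j
    simp only [Matrix.vecMul, dotProduct, Matrix.submatrix_apply, id]
    exact Fintype.sum_equiv σ _ _ fun i => by simp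
  have hTV' : ∀ (χ' : G → ℤ) (t' : G) (hχ' : IsChar χ'), χ' t' = 1 → hχ'.ker.FG →
      (∃ c, gr t' - 1 = c * (gr t - 1)) →
      ∃ (T V : Matrix (Fin n) (Fin n) (ZG G)),
        (∀ i j, SuppGE χ' 1 (T i j)) ∧ V * (J0.submatrix σ id) = 1 - T := by
    intro χ' t' hχ' h1 h2 h3
    obtain ⟨T, V, hT, hV⟩ := hTV χ' t' hχ' h1 h2 h3
    refine ⟨T, V.submatrix id σ, hT, ?_⟩
    rw [Matrix.submatrix_mul_equiv, hV]
    rfl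
  refine ⟨g, J0.submatrix σ id, hgen, ?_, ?_, ?_, ?_⟩
  · intro w
    rw [hvm, hJA]
    exact ⟨_, rfl⟩
  · intro v hv
    obtain ⟨w, hw⟩ := hb v 0 (by rw [hv, zero_mul])
    refine ⟨w ∘ σ, ?_⟩
    rw [hvm, hw]
    congr 1
    ext1 j
    simp
  · exact hTV' χ t hχ ht hfg ⟨1, by simp⟩
  · refine hTV' (fun h => -χ h) t⁻¹ hχ.neg ?_ ?_ ?_
    · simp [hχ.inv, ht]
    · have : hχ.neg.ker = hχ.ker := by
        ext x
        simp [IsChar.mem_ker]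
      rwa [this]
    · have := gr_zpow_sub_one t (-1)
      rwa [zpow_neg_one] at this

/-! ### Hilbert space operators -/

/-- real square summable sequences -/
abbrev L2 (α : Type*) : Type _ := lp (fun _ : α => ℝ) 2

section pmap
variable {α : Type*}

theorem two_toReal_pos : 0 < (2 : ENNReal).toReal := by norm_num

theorem pmap_sum_le (σ : α → Option α)
    (hσ : ∀ a b c, σ a = some c → σ b = some c → a = b) (f : L2 α) (s : Finset α) :
    ∑ a ∈ s, ‖(σ a).elim 0 f‖ ^ (2 : ENNReal).toReal ≤ ‖f‖ ^ (2 : ENNReal).toReal := by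
  classical
  refine le_trans ?_ (lp.sum_rpow_le_norm_rpow two_toReal_pos f (s.biUnion fun a => (σ a).toFinset))
  have h2 : (2 : ENNReal).toReal ≠ 0 := two_toReal_pos.ne'
  rw [Finset.sum_biUnion]
  · refine Finset.sum_le_sum fun a _ => ?_
    rcases h : σ a with _ | c
    · simp
    · simp
  · intro a _ b _ hab
    simp only [Function.onFun, Finset.disjoint_left, Option.mem_toFinset, Option.mem_def]
    intro c h1 h3
    exact hab (hσ a b c h1 h3)

/-- partial permutation operator -/
noncomputable def pmap (σ : α → Option α)
    (hσ : ∀ a b c, σ a = some c → σ b = some c → a = b) : L2 α →L[ℝ] L2 α :=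
  LinearMap.mkContinuous
    { toFun := fun f => ⟨fun a => (σ a).elim 0 f, memℓp_gen' (pmap_sum_le σ hσ f)⟩
      map_add' := by
        intro f g
        apply lp.ext
        funext a
        change (σ a).elim 0 (⇑(f + g)) = (σ a).elim 0 f + (σ a).elim 0 g
        rcases σ a with _ | c
        · exact (add_zero _).symm
        · rfl
      map_smul' := by
        intro r f
        apply lp.ext
        funext a
        change (σ a).elim 0 (⇑(r • f)) = r * (σ a).elim 0 f
        rcases σ a with _ | c
        · exact (mul_zero _).symm
        · rfl } 1 (by
      intro f
      rw [one_mul]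
      exact lp.norm_le_of_forall_sum_le two_toReal_pos (norm_nonneg _) (pmap_sum_le σ hσ f))

theorem pmap_apply (σ : α → Option α)
    (hσ : ∀ a b c, σ a = some c → σ b = some c → a = b) (f : L2 α) (a : α) :
    (pmap σ hσ f : α → ℝ) a = (σ a).elim 0 f := rfl

theorem pmap_norm_le (σ : α → Option α)
    (hσ : ∀ a b c, σ a = some c → σ b = some c → a = b) : ‖pmap σ hσ‖ ≤ 1 :=
  LinearMap.mkContinuous_norm_le _ zero_le_one _

theorem L2_ext {f g : L2 α} (h : ∀ a, (f : α → ℝ) a = (g : α → ℝ) a) : f = g :=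
  lp.ext (funext h)

end pmap

section ops
variable {G : Type*} [Group G] {ι : Type*} [DecidableEq ι]

open scoped Classical in
/-- basis vector -/
noncomputable def dl (a : ι × G) : L2 (ι × G) := lp.single 2 a (1 : ℝ)

open scoped Classical in
theorem dl_apply (a b : ι × G) : (dl a : ι × G → ℝ) b = if b = a then 1 else 0 := by
  simp [dl, lp.single_apply, Pi.single_apply]

theorem inner_dl (a : ι × G) (f : L2 (ι × G)) : inner ℝ (dl a) f = (f : ι × G → ℝ) a := by
  classical
  rw [dl, lp.inner_single_left]
  simp

/-- right translation -/
noncomputable def Rop (h : G) : L2 (ι × G) →L[ℝ] L2 (ι × G) :=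
  pmap (fun a => some (a.1, a.2 * h)) (by
    rintro ⟨a, x⟩ ⟨b, y⟩ c h1 h2
    simp only [Option.some.injEq] at h1 h2
    rw [← h2] at h1
    simpa [Prod.ext_iff] using h1)

theorem Rop_apply (h : G) (f : L2 (ι × G)) (a : ι × G) :
    (Rop h f : ι × G → ℝ) a = (f : ι × G → ℝ) (a.1, a.2 * h) := rfl

theorem Rop_dl (h : G) (i : ι) (x : G) : Rop h (dl (i, x)) = dl (i, x * h⁻¹) := by
  classical
  apply L2_ext
  rintro ⟨j, y⟩
  rw [Rop_apply, dl_apply, dl_apply]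
  simp only [Prod.mk.injEq, eq_mul_inv_iff_mul_eq]

theorem Rop_Rop_inv (h : G) (f : L2 (ι × G)) : Rop h (Rop h⁻¹ f) = f := by
  apply L2_ext
  rintro ⟨j, y⟩
  rw [Rop_apply, Rop_apply]
  simp

theorem Rop_inner (h : G) (f g : L2 (ι × G)) : inner ℝ (Rop h f) g = inner ℝ f (Rop h⁻¹ g) := by
  rw [lp.inner_eq_tsum, lp.inner_eq_tsum]
  rw [← ((Equiv.refl ι).prodCongr (Equiv.mulRight h⁻¹)).tsum_eq]
  refine tsum_congr ?_
  rintro ⟨i, x⟩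
  simp [Rop_apply]

/-- matrix unit times left translation -/
noncomputable def Uop (i j : ι) (g : G) : L2 (ι × G) →L[ℝ] L2 (ι × G) :=
  pmap (fun a => if a.1 = i then some (j, g⁻¹ * a.2) else none) (by
    rintro ⟨a, x⟩ ⟨b, y⟩ c h1 h2
    dsimp only at h1 h2
    split_ifs at h1 h2 with h3 h4
    simp only [Option.some.injEq] at h1 h2
    rw [← h2] at h1
    simp [Prod.ext_iff] at h1
    simp [h1, h3, h4])

theorem Uop_apply (i j : ι) (g : G) (f : L2 (ι × G)) (k : ι) (x : G) :
    (Uop i j g f : ι × G → ℝ) (k, x) = if k = i then (f : ι × G → ℝ) (j, g⁻¹ * x) else 0 := by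
  rw [Uop, pmap_apply]
  split_ifs with h
  · rfl
  · rfl

theorem Uop_mul (i j k : ι) (g h : G) : Uop i j g * Uop j k h = Uop i k (g * h) := by
  refine ContinuousLinearMap.ext fun f => L2_ext ?_
  rintro ⟨l, x⟩
  rw [ContinuousLinearMap.mul_apply, Uop_apply, Uop_apply, Uop_apply]
  simp [mul_assoc]

theorem Uop_mul_ne (i j j' k : ι) (hj : j ≠ j') (g h : G) : Uop i j g * Uop j' k h = 0 := by
  refine ContinuousLinearMap.ext fun f => L2_ext ?_
  rintro ⟨l, x⟩
  rw [ContinuousLinearMap.mul_apply, Uop_apply, Uop_apply]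
  simp [hj]

theorem Uop_Rop (i j : ι) (g h : G) : Commute (Uop i j g) (Rop h) := by
  refine ContinuousLinearMap.ext fun f => L2_ext ?_
  rintro ⟨l, x⟩
  rw [ContinuousLinearMap.mul_apply, ContinuousLinearMap.mul_apply, Uop_apply, Rop_apply,
    Rop_apply, Uop_apply]
  simp [mul_assoc]

theorem Uop_norm (i j : ι) (g : G) : ‖Uop i j g‖ ≤ 1 := pmap_norm_le _ _

variable [Fintype ι]

theorem Uop_one_sum : ∑ i : ι, Uop i i (1 : G) = 1 := by
  refine ContinuousLinearMap.ext fun f => L2_ext ?_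
  rintro ⟨l, x⟩
  rw [ContinuousLinearMap.sum_apply, lp.coeFn_sum, Finset.sum_apply]
  simp only [Uop_apply]
  simp

/-- trace -/
noncomputable def trop (A : L2 (ι × G) →L[ℝ] L2 (ι × G)) : ℝ :=
  ∑ i, (A (dl (i, 1)) : ι × G → ℝ) (i, 1)

theorem trop_add (A B : L2 (ι × G) →L[ℝ] L2 (ι × G)) : trop (A + B) = trop A + trop B := by
  simp [trop, Finset.sum_add_distrib, lp.coeFn_add]

theorem trop_sub (A B : L2 (ι × G) →L[ℝ] L2 (ι × G)) : trop (A - B) = trop A - trop B := by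
  simp [trop, Finset.sum_sub_distrib, lp.coeFn_sub]

/-- commuting with right translations -/
def Equi (A : L2 (ι × G) →L[ℝ] L2 (ι × G)) : Prop := ∀ h, Commute A (Rop h)

theorem Equi.entry {A : L2 (ι × G) →L[ℝ] L2 (ι × G)} (hA : Equi A) (j : ι) (y : G) (i : ι) (x : G) :
    (A (dl (j, y)) : ι × G → ℝ) (i, x) = (A (dl (j, 1)) : ι × G → ℝ) (i, x * y⁻¹) := by
  have := Rop_dl (G := G) y⁻¹ j 1
  rw [one_mul, inv_inv] at this
  rw [← this, ← ContinuousLinearMap.mul_apply, hA y⁻¹, ContinuousLinearMap.mul_apply, Rop_apply]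

theorem trop_mul_eq {A B : L2 (ι × G) →L[ℝ] L2 (ι × G)} (hA : Equi A) :
    trop (A * B) = ∑ i, ∑ j, ∑' y : G, (A (dl (j, 1)) : ι × G → ℝ) (i, y⁻¹) *
      (B (dl (i, 1)) : ι × G → ℝ) (j, y) := by
  refine Finset.sum_congr rfl fun i _ => ?_
  rw [ContinuousLinearMap.mul_apply]
  have h1 : ((A (B (dl (i, 1))) : L2 (ι × G)) : ι × G → ℝ) (i, 1) =
      inner ℝ (ContinuousLinearMap.adjoint A (dl (i, 1))) (B (dl (i, 1))) := by
    rw [ContinuousLinearMap.adjoint_inner_left, inner_dl]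
  have h2 : ∀ a : ι × G, ((ContinuousLinearMap.adjoint A (dl (i, 1)) : L2 (ι × G)) : ι × G → ℝ) a =
      (A (dl (a.1, 1)) : ι × G → ℝ) (i, a.2⁻¹) := by
    rintro ⟨j, y⟩
    rw [← inner_dl, ContinuousLinearMap.adjoint_inner_right, real_inner_comm, inner_dl, hA.entry,
      one_mul]
  have hs := lp.hasSum_inner (𝕜 := ℝ) (ContinuousLinearMap.adjoint A (dl (i, 1))) (B (dl (i, 1)))
  rw [h1, ← hs.tsum_eq, hs.summable.tsum_prod, tsum_fintype]
  refine Finset.sum_congr rfl fun j _ => tsum_congr fun y => ?_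
  rw [h2]
  simp [mul_comm]

theorem trop_comm {A B : L2 (ι × G) →L[ℝ] L2 (ι × G)} (hA : Equi A) (hB : Equi B) :
    trop (A * B) = trop (B * A) := by
  rw [trop_mul_eq hA, trop_mul_eq hB, Finset.sum_comm]
  refine Finset.sum_congr rfl fun j _ => Finset.sum_congr rfl fun i _ => ?_
  rw [← (Equiv.inv G).tsum_eq]
  refine tsum_congr fun y => ?_
  simp [mul_comm]

theorem Equi.mul {A B : L2 (ι × G) →L[ℝ] L2 (ι × G)} (hA : Equi A) (hB : Equi B) : Equi (A * B) :=
  fun h => (hA h).mul_left (hB h)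

theorem Equi.add {A B : L2 (ι × G) →L[ℝ] L2 (ι × G)} (hA : Equi A) (hB : Equi B) : Equi (A + B) :=
  fun h => (hA h).add_left (hB h)

theorem Equi.sub {A B : L2 (ι × G) →L[ℝ] L2 (ι × G)} (hA : Equi A) (hB : Equi B) : Equi (A - B) :=
  fun h => (hA h).sub_left (hB h)

theorem idem_trace_zero {E : L2 (ι × G) →L[ℝ] L2 (ι × G)} (hE : Equi E) (hi : E * E = E)
    (ht : trop E = 0) : E = 0 := by
  let N : Submodule ℝ (L2 (ι × G)) := LinearMap.ker (1 - E).toLinearMap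
  have hN : ∀ x, x ∈ N ↔ E x = x := by
    intro x
    simp only [N, LinearMap.mem_ker]
    change x - E x = 0 ↔ _
    rw [sub_eq_zero, eq_comm]
  have hcl : IsClosed (N : Set (L2 (ι × G))) := by
    have : (N : Set (L2 (ι × G))) = {x | E x = x} := by
      ext x; exact hN x
    rw [this]
    exact isClosed_eq E.continuous continuous_id
  haveI : CompleteSpace N := hcl.completeSpace_coe
  set P := N.starProjection with hP
  have hmem : ∀ x, P x ∈ N := fun x => Submodule.starProjection_apply_mem N x
  have hPE : P * E = E := by
    ext1 x
    rw [ContinuousLinearMap.mul_apply, hP, Submodule.starProjection_eq_self_iff, hN,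
      ← ContinuousLinearMap.mul_apply, hi]
  have hEP : E * P = P := by
    ext1 x
    rw [ContinuousLinearMap.mul_apply]
    exact (hN _).1 (hmem x)
  have hRN : ∀ h x, x ∈ N → Rop h x ∈ N := by
    intro h x hx
    rw [hN] at hx ⊢
    rw [← ContinuousLinearMap.mul_apply, hE h, ContinuousLinearMap.mul_apply, hx]
  have hPequi : Equi P := by
    intro h
    refine ContinuousLinearMap.ext fun x => ?_
    rw [ContinuousLinearMap.mul_apply, ContinuousLinearMap.mul_apply]
    apply Submodule.eq_starProjection_of_mem_of_inner_eq_zero (hRN h _ (hmem x))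
    intro w hw
    rw [← map_sub, Rop_inner]
    have := Submodule.starProjection_inner_eq_zero (K := N) x (Rop h⁻¹ w) (hRN _ _ hw)
    exact this
  have hPt : trop P = 0 := by
    rw [← hEP, trop_comm hE hPequi, hPE, ht]
  have hsymm : ∀ x y, inner ℝ (P x) y = inner ℝ x (P y) := fun x y =>
    Submodule.starProjection_isSymmetric N x y
  have hPP : ∀ x, P (P x) = P x := by
    intro x
    rw [hP, Submodule.starProjection_eq_self_iff]
    exact hmem x
  have hsum : ∑ i : ι, ‖P (dl (i, (1 : G)))‖ ^ 2 = 0 := by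
    rw [← hPt]
    refine Finset.sum_congr rfl fun i _ => ?_
    rw [← inner_dl, ← real_inner_self_eq_norm_sq, hsymm, hPP]
  have h0 : ∀ i, P (dl (i, (1 : G))) = 0 := by
    intro i
    have := (Finset.sum_eq_zero_iff_of_nonneg (fun i _ => by positivity)).1 hsum i
      (Finset.mem_univ i)
    simpa using this
  have h1 : ∀ a, P (dl a) = 0 := by
    rintro ⟨i, x⟩
    apply L2_ext
    rintro ⟨j, y⟩
    rw [hPequi.entry, h0]
    rfl
  have hP0 : P = 0 := by
    refine ContinuousLinearMap.ext fun f => L2_ext fun a => ?_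
    rw [← inner_dl, ← hsymm, h1, inner_zero_left]
    rfl
  rw [← hPE, hP0, zero_mul]

end ops

/-! ### Lemma K -/

theorem commute_of_inv {R : Type*} [Ring R] {a X b : R} (h1 : X * a = 1) (h2 : a * X = 1)
    (h : a * b = b * a) : X * b = b * X := by
  calc X * b = X * b * (a * X) := by rw [h2, mul_one]
    _ = X * (b * a) * X := by simp only [mul_assoc]
    _ = X * (a * b) * X := by rw [h]
    _ = (X * a) * b * X := by simp only [mul_assoc]
    _ = b * X := by rw [h1, one_mul]

section opK
variable {G : Type*} [Group G] {ι : Type*} [DecidableEq ι] [Fintype ι]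

/-- weighted action of the group ring -/
noncomputable def psi (ε : ℝ) (χ : G → ℤ) (i j : ι) : ZG G →+ (L2 (ι × G) →L[ℝ] L2 (ι × G)) :=
  linExt (fun g => (ε ^ χ g) • Uop i j g)

theorem psi_mul {ε : ℝ} (hε : 0 < ε) {χ : G → ℤ} (hχ : IsChar χ) (i j k : ι) (a b : ZG G) :
    psi ε χ i j a * psi ε χ j k b = psi ε χ i k (a * b) := by
  induction a using ZG_induction with
  | hg g =>
    induction b using ZG_induction with
    | hg h =>
      rw [← gr_mul]
      simp only [psi, linExt_gr]
      rw [smul_mul_smul_comm, Uop_mul, hχ, zpow_add₀ hε.ne']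
    | hadd x y hx hy => rw [map_add, mul_add, mul_add, map_add, hx, hy]
    | hneg x hx => rw [map_neg, mul_neg, mul_neg, map_neg, hx]
  | hadd x y hx hy => rw [map_add, add_mul, add_mul, map_add, hx, hy]
  | hneg x hx => rw [map_neg, neg_mul, neg_mul, map_neg, hx]

theorem psi_mul_ne {ε : ℝ} {χ : G → ℤ} (i j j' k : ι) (hj : j ≠ j') (a b : ZG G) :
    psi ε χ i j a * psi ε χ j' k b = 0 := by
  induction a using ZG_induction with
  | hg g =>
    induction b using ZG_induction with
    | hg h =>
      simp only [psi, linExt_gr]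
      rw [smul_mul_smul_comm, Uop_mul_ne _ _ _ _ hj, smul_zero]
    | hadd x y hx hy => rw [map_add, mul_add, hx, hy, add_zero]
    | hneg x hx => rw [map_neg, mul_neg, hx, neg_zero]
  | hadd x y hx hy => rw [map_add, add_mul, hx, hy, add_zero]
  | hneg x hx => rw [map_neg, neg_mul, hx, neg_zero]

theorem psi_equi {ε : ℝ} {χ : G → ℤ} (i j : ι) (a : ZG G) : Equi (psi ε χ i j a) := by
  intro h
  induction a using ZG_induction with
  | hg g =>
    simp only [psi, linExt_gr]
    exact (Uop_Rop i j g h).smul_left _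
  | hadd x y hx hy => rw [map_add]; exact hx.add_left hy
  | hneg x hx => rw [map_neg]; exact hx.neg_left

theorem psi_apply {ε : ℝ} {χ : G → ℤ} (i j k l : ι) (a : ZG G) (x : G) :
    (psi ε χ i j a (dl (k, 1)) : ι × G → ℝ) (l, x) =
      if l = i ∧ k = j then ε ^ χ x * (a.coeff x : ℝ) else 0 := by
  classical
  induction a using ZG_induction with
  | hg g =>
    simp only [psi, linExt_gr]
    rw [ContinuousLinearMap.smul_apply, lp.coeFn_smul, Pi.smul_apply, Uop_apply, dl_apply, coeff_gr]
    by_cases h1 : l = i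
    · by_cases h2 : k = j
      · by_cases h3 : g = x
        · simp [h1, h2, h3]
        · have : ¬ g⁻¹ * x = 1 := fun h => h3 (inv_mul_eq_one.1 h)
          simp [h1, h2, h3, this]
      · simp [h1, h2, Ne.symm h2]
    · simp [h1]
  | hadd y z hx hy =>
    rw [map_add, ContinuousLinearMap.add_apply, lp.coeFn_add, Pi.add_apply, hx, hy]
    split_ifs
    · simp [mul_add]
    · simp
  | hneg y hx =>
    rw [map_neg, ContinuousLinearMap.neg_apply, lp.coeFn_neg, Pi.neg_apply, hx]
    split_ifs
    · simp
    · simp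

theorem psi_norm {χ : G → ℤ} (a : ZG G) (ha : SuppGE χ 1 a) :
    ∃ C : ℝ, 0 ≤ C ∧ ∀ (i j : ι) (ε : ℝ), 0 < ε → ε ≤ 1 → ‖psi ε χ i j a‖ ≤ C * ε := by
  refine ⟨∑ g ∈ a.coeff.support, |(a.coeff g : ℝ)|, Finset.sum_nonneg fun _ _ => abs_nonneg _, ?_⟩
  intro i j ε h0 h1
  rw [psi, linExt_apply, Finsupp.sum, Finset.sum_mul]
  refine (norm_sum_le _ _).trans (Finset.sum_le_sum fun g hg => ?_)
  rw [← Int.cast_smul_eq_zsmul ℝ, norm_smul, norm_smul, Real.norm_eq_abs]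
  refine mul_le_mul_of_nonneg_left ?_ (abs_nonneg _)
  have h2 : ‖ε ^ χ g‖ ≤ ε := by
    rw [norm_zpow, Real.norm_of_nonneg h0.le]
    calc ε ^ χ g ≤ ε ^ (1 : ℤ) :=
          zpow_le_zpow_right_of_le_one₀ h0 h1 (ha g (by simpa using hg))
      _ = ε := zpow_one _
  calc ‖ε ^ χ g‖ * ‖Uop i j g‖ ≤ ε * 1 :=
        mul_le_mul h2 (Uop_norm i j g) (norm_nonneg _) h0.le
    _ = ε := mul_one _

/-- weighted action of matrices -/
noncomputable def opm (ε : ℝ) (χ : G → ℤ) (M : Matrix ι ι (ZG G)) : L2 (ι × G) →L[ℝ] L2 (ι × G) :=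
  ∑ i, ∑ j, psi ε χ i j (M i j)

theorem opm_mul {ε : ℝ} (hε : 0 < ε) {χ : G → ℤ} (hχ : IsChar χ) (M N : Matrix ι ι (ZG G)) :
    opm ε χ (M * N) = opm ε χ M * opm ε χ N := by
  have key : ∀ i j, psi ε χ i j (M i j) * opm ε χ N = ∑ k, psi ε χ i k (M i j * N j k) := by
    intro i j
    rw [opm, Finset.mul_sum, Finset.sum_eq_single j]
    · rw [Finset.mul_sum]
      exact Finset.sum_congr rfl fun k _ => psi_mul hε hχ _ _ _ _ _
    · intro j' _ hj
      rw [Finset.mul_sum]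
      exact Finset.sum_eq_zero fun k _ => psi_mul_ne _ _ _ _ (Ne.symm hj) _ _
    · simp
  rw [opm, opm, Finset.sum_mul]
  refine Finset.sum_congr rfl fun i _ => ?_
  rw [Finset.sum_mul]
  simp only [key]
  rw [Finset.sum_comm]
  refine Finset.sum_congr rfl fun k _ => ?_
  rw [Matrix.mul_apply, map_sum]

theorem opm_sub (ε : ℝ) (χ : G → ℤ) (M N : Matrix ι ι (ZG G)) :
    opm ε χ (M - N) = opm ε χ M - opm ε χ N := by
  simp [opm, Finset.sum_sub_distrib]

theorem opm_one (ε : ℝ) {χ : G → ℤ} (hχ : IsChar χ) : opm ε χ (1 : Matrix ι ι (ZG G)) = 1 := by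
  rw [← Uop_one_sum (G := G), opm]
  refine Finset.sum_congr rfl fun i _ => ?_
  rw [Finset.sum_eq_single i]
  · rw [Matrix.one_apply_eq, ← gr_one, psi, linExt_gr, hχ.one]
    simp
  · intro j _ hj
    rw [Matrix.one_apply_ne (Ne.symm hj), map_zero]
  · simp

theorem opm_pow {ε : ℝ} (hε : 0 < ε) {χ : G → ℤ} (hχ : IsChar χ) (M : Matrix ι ι (ZG G)) (l : ℕ) :
    opm ε χ (M ^ l) = opm ε χ M ^ l := by
  induction l with
  | zero => rw [pow_zero, pow_zero, opm_one ε hχ]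
  | succ l ih => rw [pow_succ, pow_succ, opm_mul hε hχ, ih]

theorem opm_equi (ε : ℝ) (χ : G → ℤ) (M : Matrix ι ι (ZG G)) : Equi (opm ε χ M) := by
  intro h
  exact Commute.sum_left _ _ _ fun i _ => Commute.sum_left _ _ _ fun j _ => psi_equi i j _ h

theorem opm_apply (ε : ℝ) (χ : G → ℤ) (M : Matrix ι ι (ZG G)) (i j : ι) (x : G) :
    (opm ε χ M (dl (j, 1)) : ι × G → ℝ) (i, x) = ε ^ χ x * ((M i j).coeff x : ℝ) := by
  rw [opm, ContinuousLinearMap.sum_apply, lp.coeFn_sum, Finset.sum_apply, Finset.sum_eq_single i]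
  · rw [ContinuousLinearMap.sum_apply, lp.coeFn_sum, Finset.sum_apply, Finset.sum_eq_single j]
    · rw [psi_apply]; simp
    · intro j' _ hj
      rw [psi_apply]; simp [Ne.symm hj]
    · simp
  · intro i' _ hi
    rw [ContinuousLinearMap.sum_apply, lp.coeFn_sum, Finset.sum_apply]
    refine Finset.sum_eq_zero fun j' _ => ?_
    rw [psi_apply]; simp [Ne.symm hi]
  · simp

theorem opm_norm {χ : G → ℤ} (M : Matrix ι ι (ZG G)) (hM : ∀ i j, SuppGE χ 1 (M i j)) :
    ∃ C : ℝ, 0 ≤ C ∧ ∀ (ε : ℝ), 0 < ε → ε ≤ 1 → ‖opm ε χ M‖ ≤ C * ε := by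
  choose C h0 hC using fun i j => psi_norm (ι := ι) (M i j) (hM i j)
  refine ⟨∑ i, ∑ j, C i j, Finset.sum_nonneg fun i _ => Finset.sum_nonneg fun j _ => h0 i j, ?_⟩
  intro ε e0 e1
  rw [opm, Finset.sum_mul]
  refine (norm_sum_le _ _).trans (Finset.sum_le_sum fun i _ => ?_)
  rw [Finset.sum_mul]
  exact (norm_sum_le _ _).trans (Finset.sum_le_sum fun j _ => hC i j i j ε e0 e1)

theorem opm_trop (ε : ℝ) {χ : G → ℤ} (hχ : IsChar χ) (M : Matrix ι ι (ZG G)) :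
    trop (opm ε χ M) = ((∑ i, (M i i).coeff 1 : ℤ) : ℝ) := by
  rw [trop, Int.cast_sum]
  refine Finset.sum_congr rfl fun i _ => ?_
  rw [opm_apply, hχ.one]
  simp

theorem SuppGE.matpow {χ : G → ℤ} (hχ : IsChar χ) {T : Matrix ι ι (ZG G)}
    (hT : ∀ i j, SuppGE χ 1 (T i j)) (l : ℕ) : ∀ i j, SuppGE χ l ((T ^ l) i j) := by
  induction l with
  | zero =>
    intro i j
    rw [pow_zero, Matrix.one_apply]
    split_ifs
    · have := SuppGE.gr (χ := χ) (1 : G)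
      rw [hχ.one] at this
      exact this
    · exact SuppGE.zero _
  | succ l ih =>
    intro i j
    rw [pow_succ, Matrix.mul_apply]
    exact SuppGE.sum fun k _ => by
      have := (ih i k).mul hχ (hT k j)
      exact_mod_cast this

theorem lemmaK_supp {χ : G → ℤ} (hχ : IsChar χ) {J T V : Matrix ι ι (ZG G)}
    (hT : ∀ i j, SuppGE χ 1 (T i j)) : ∃ m : ℤ, ∀ (l : ℕ) i j, SuppGE χ (l + m) ((J * T ^ l * V) i j) := by
  obtain ⟨m1, h1⟩ := SuppGE.ex_fin χ (fun p : ι × ι => J p.1 p.2)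
  obtain ⟨m2, h2⟩ := SuppGE.ex_fin χ (fun p : ι × ι => V p.1 p.2)
  refine ⟨m1 + m2, fun l i j => ?_⟩
  rw [Matrix.mul_apply]
  refine SuppGE.sum fun k _ => ?_
  rw [Matrix.mul_apply, Finset.sum_mul]
  refine SuppGE.sum fun k' _ => ?_
  have := ((h1 (i, k')).mul hχ (SuppGE.matpow hχ hT l k' k)).mul hχ (h2 (k, j))
  exact this.mono (by linarith)

theorem lemmaK {χ : G → ℤ} (hχ : IsChar χ) (J T V q r : Matrix ι ι (ZG G))
    (hq : q * q = q) (hqJ : q * J = J) (hVq : V * q = V) (hrV : r * V = V)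
    (hrT : r * T = T) (hTr : T * r = T) (hVJ : V * J = r - T)
    (hT : ∀ i j, SuppGE χ 1 (T i j))
    (htr : ∑ i, (q i i).coeff 1 = ∑ i, (r i i).coeff 1) (i j : ι) (g : G) :
    ∃ N0, ∀ N ≥ N0, ∑ l ∈ Finset.range N, ((J * T ^ l * V) i j).coeff g = (q i j).coeff g := by
  obtain ⟨C, hC0, hC⟩ := opm_norm T hT
  set ε : ℝ := 1 / (C + 2) with hε
  have e0 : 0 < ε := by positivity
  have e1 : ε ≤ 1 := by
    rw [hε, div_le_one (by positivity)]; linarith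
  have hn : ‖opm ε χ T‖ < 1 := by
    refine (hC ε e0 e1).trans_lt ?_
    rw [hε, mul_one_div, div_lt_one (by positivity)]; linarith
  set t := opm ε χ T with ht
  set X := ∑' l : ℕ, t ^ l with hX
  have hs : HasSum (fun l : ℕ => t ^ l) X := (summable_geometric_of_norm_lt_one hn).hasSum
  have hX1 : X * (1 - t) = 1 := geom_series_mul_neg t hn
  have hX2 : (1 - t) * X = 1 := mul_neg_geom_series t hn
  have hXe : Equi X := by
    intro h
    refine commute_of_inv hX1 hX2 ?_
    have : Commute (1 - t) (Rop h) := (Commute.one_left _).sub_left (opm_equi ε χ T h)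
    exact this
  set j' := opm ε χ J
  set v := opm ε χ V
  set Q := opm ε χ q
  set ρ := opm ε χ r
  have kQ : Q * Q = Q := by rw [← opm_mul e0 hχ, hq]
  have kQJ : Q * j' = j' := by rw [← opm_mul e0 hχ, hqJ]
  have kVQ : v * Q = v := by rw [← opm_mul e0 hχ, hVq]
  have krV : ρ * v = v := by rw [← opm_mul e0 hχ, hrV]
  have krT : ρ * t = t := by rw [← opm_mul e0 hχ, hrT]
  have kTr : t * ρ = t := by rw [← opm_mul e0 hχ, hTr]
  have kVJ : v * j' = ρ - t := by rw [← opm_mul e0 hχ, hVJ, opm_sub]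
  have hXr : X * ρ = ρ * X := by
    refine commute_of_inv hX1 hX2 ?_
    rw [sub_mul, mul_sub, one_mul, mul_one, krT, kTr]
  have kVJ2 : v * j' = (1 - t) * ρ := by rw [kVJ, sub_mul, one_mul, kTr]
  set E := j' * X * v with hE
  have hEe : Equi E := ((opm_equi ε χ J).mul hXe).mul (opm_equi ε χ V)
  have hEE : E * E = E := by
    calc E * E = j' * X * (v * j') * X * v := by simp only [hE, mul_assoc]
      _ = j' * (X * (1 - t)) * (ρ * X) * v := by rw [kVJ2]; simp only [mul_assoc]
      _ = j' * X * (ρ * v) := by rw [hX1, mul_one, ← hXr]; simp only [mul_assoc]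
      _ = E := by rw [krV]
  have hQE : Q * E = E := by rw [hE, ← mul_assoc, ← mul_assoc, kQJ]
  have hEQ : E * Q = E := by rw [hE, mul_assoc, kVQ]
  have hid : (Q - E) * (Q - E) = Q - E := by
    rw [sub_mul, mul_sub, mul_sub, kQ, hQE, hEQ, hEE]; abel
  have htE : trop E = trop Q := by
    have h1 : trop E = trop ρ := by
      rw [hE, mul_assoc, trop_comm (opm_equi ε χ J) (hXe.mul (opm_equi ε χ V)), mul_assoc, kVJ2,
        ← mul_assoc, hX1, one_mul]
    rw [h1, opm_trop ε hχ, opm_trop ε hχ, htr]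
  have hz : Q - E = 0 := by
    apply idem_trace_zero ((opm_equi ε χ q).sub hEe) hid
    rw [trop_sub, htE, sub_self]
  have hQE' : Q = E := sub_eq_zero.1 hz
  obtain ⟨m, hm⟩ := lemmaK_supp (J := J) (V := V) hχ hT
  have hvan : ∀ l : ℕ, χ g < l + m → ((J * T ^ l * V) i j).coeff g = 0 := by
    intro l hl
    by_contra hne
    have := hm l i j g hne
    omega
  refine ⟨(χ g - m + 1).toNat, fun N hN => ?_⟩
  have hs2 : HasSum (fun l : ℕ => ε ^ χ g * (((J * T ^ l * V) i j).coeff g : ℝ))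
      ((E (dl (j, 1)) : ι × G → ℝ) (i, g)) := by
    have h1 := (hs.mul_left j').mul_right v
    have h2 := h1.mapL (ContinuousLinearMap.apply ℝ (L2 (ι × G)) (dl (j, (1 : G))))
    have h3 := h2.mapL (lp.evalCLM ℝ (fun _ : ι × G => ℝ) 2 (i, g))
    suffices h4 : ∀ l : ℕ, ε ^ χ g * (((J * T ^ l * V) i j).coeff g : ℝ) =
      (lp.evalCLM ℝ (fun _ : ι × G => ℝ) 2 (i, g))
        (ContinuousLinearMap.apply ℝ (L2 (ι × G)) (dl (j, (1 : G))) (j' * t ^ l * v)) by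
      rw [funext h4]
      exact h3
    intro l
    rw [← opm_apply, opm_mul e0 hχ, opm_mul e0 hχ, opm_pow e0 hχ]
    rfl
  have hs3 := hasSum_sum_of_ne_finset_zero (f := fun l : ℕ => ε ^ χ g * (((J * T ^ l * V) i j).coeff g : ℝ))
    (s := Finset.range N) (L := SummationFilter.unconditional ℕ) (by
      intro l hl
      rw [hvan l]
      · simp
      · simp only [Finset.mem_range, not_lt] at hl
        have : (χ g - m + 1) ≤ N := by omega
        omega)
  have h4 := hs2.unique hs3
  rw [← hQE', opm_apply, ← Finset.mul_sum] at h4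
  have h5 := mul_left_cancel₀ (zpow_ne_zero _ e0.ne') h4
  exact_mod_cast h5.symm

theorem idem_tr_zero (q : Matrix ι ι (ZG G)) (hq : q * q = q)
    (htr : ∑ i, (q i i).coeff 1 = 0) : q = 0 := by
  have hχ : IsChar (fun _ : G => (0 : ℤ)) := fun _ _ => by simp
  ext i j g
  obtain ⟨N0, h⟩ := lemmaK hχ 0 0 0 q 0 hq (by simp) (by simp) (by simp) (by simp) (by simp) (by simp)
    (fun i j => SuppGE.zero _) (by simpa using htr) i j g
  have := h N0 le_rfl
  simp at this
  simp [← this]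
end opK

/-! ### The retraction -/

section retr
variable {G : Type*} [Group G] {ι : Type*} [DecidableEq ι] [Fintype ι]

open scoped Classical in
/-- truncation to a subset -/
noncomputable def trunc (p : G → Prop) : ZG G →+ ZG G := linExt (fun g => if p g then gr g else 0)

open scoped Classical in
theorem trunc_coeff (p : G → Prop) (a : ZG G) (x : G) :
    (trunc p a).coeff x = if p x then a.coeff x else 0 := by
  induction a using ZG_induction with
  | hg g =>
    rw [trunc, linExt_gr]
    by_cases h : g = x
    · subst h; split_ifs <;> simp
    · split_ifs <;> simp [coeff_gr, h]
  | hadd y z hy hz =>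
    rw [map_add, MonoidAlgebra.coeff_add, Finsupp.add_apply, hy, hz]
    split_ifs <;> simp
  | hneg y hy =>
    rw [map_neg, MonoidAlgebra.coeff_neg, Finsupp.neg_apply, hy]
    split_ifs <;> simp

theorem ZG_ext {a b : ZG G} (h : ∀ x, a.coeff x = b.coeff x) : a = b := by
  ext x
  exact h x

theorem trunc_gr_mul (p : G → Prop) (k : G) (hk : ∀ x, p (k * x) ↔ p x) (a : ZG G) :
    trunc p (gr k * a) = gr k * trunc p a := by
  classical
  apply ZG_ext
  intro x
  rw [trunc_coeff, coeff_gr_mul, coeff_gr_mul, trunc_coeff]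
  have := hk (k⁻¹ * x)
  rw [mul_inv_cancel_left] at this
  simp only [this]

theorem trunc_add_not (p : G → Prop) (a : ZG G) : trunc p a + trunc (fun x => ¬ p x) a = a := by
  classical
  apply ZG_ext
  intro x
  rw [MonoidAlgebra.coeff_add, Finsupp.add_apply, trunc_coeff, trunc_coeff]
  by_cases h : p x <;> simp [h]

theorem ev_coeff_mul {P : ℕ → ZG G} {Q : ZG G} (h : ∀ g, ∀ᶠ N in atTop, (P N).coeff g = Q.coeff g)
    (w : ZG G) : ∀ x, ∀ᶠ N in atTop, (w * P N).coeff x = (w * Q).coeff x := by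
  induction w using ZG_induction with
  | hg g =>
    intro x
    filter_upwards [h (g⁻¹ * x)] with N hN
    rw [coeff_gr_mul, coeff_gr_mul, hN]
  | hadd y z hy hz =>
    intro x
    filter_upwards [hy x, hz x] with N h1 h2
    simp only [add_mul, MonoidAlgebra.coeff_add, Finsupp.add_apply, h1, h2]
  | hneg y hy =>
    intro x
    filter_upwards [hy x] with N h1
    simp only [neg_mul, MonoidAlgebra.coeff_neg, Finsupp.neg_apply, h1]

theorem coeff_sum_apply {κ : Type*} (s : Finset κ) (f : κ → ZG G) (x : G) :
    (∑ k ∈ s, f k).coeff x = ∑ k ∈ s, (f k).coeff x := by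
  classical
  induction s using Finset.induction_on with
  | empty => simp
  | insert a s ha ih => rw [Finset.sum_insert ha, Finset.sum_insert ha, MonoidAlgebra.coeff_add,
      Finsupp.add_apply, ih]

theorem oneSide {χ : G → ℤ} (hχ : IsChar χ) {J T V : Matrix ι ι (ZG G)} (hVJ : V * J = 1 - T)
    (hT : ∀ i j, SuppGE χ 1 (T i j)) (p : G → Prop) (hp : ∀ x, p x → χ x < 1)
    (hpk : ∀ k x, χ k = 0 → (p (k * x) ↔ p x)) :
    ∃ R : (ι → ZG G) → (ι → ZG G), (∀ v w, R (v + w) = R v + R w) ∧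
      (∀ k v, χ k = 0 → R (gr k • v) = gr k • R v) ∧
      (∀ w i, R (Matrix.vecMul w J) i = trunc p (w i)) := by
  classical
  let S : ℕ → Matrix ι ι (ZG G) := fun N => ∑ l ∈ Finset.range N, T ^ l * V
  have hJS : ∀ i j g, ∀ᶠ N in atTop, ((J * S N) i j).coeff g = ((1 : Matrix ι ι (ZG G)) i j).coeff g := by
    intro i j g
    obtain ⟨N0, h⟩ := lemmaK hχ J T V 1 1 (by simp) (by simp) (by simp) (by simp) (by simp) (by simp)
      hVJ hT rfl i j g
    filter_upwards [eventually_ge_atTop N0] with N hN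
    rw [← h N hN, ← coeff_sum_apply, Finset.mul_sum, Matrix.sum_apply]
    simp only [Matrix.mul_assoc]
  have hev : ∀ v : ι → ZG G, ∃ r : ι → ZG G, ∀ᶠ N in atTop, ∀ i, trunc p (Matrix.vecMul v (S N) i) = r i := by
    intro v
    obtain ⟨m, hm⟩ := lemmaK_supp (J := Matrix.of fun _ : ι => v) (V := V) hχ hT
    refine ⟨fun i => trunc p (Matrix.vecMul v (S (1 - m).toNat) i), ?_⟩
    filter_upwards [eventually_ge_atTop (1 - m).toNat] with N hN i
    obtain ⟨d, rfl⟩ := Nat.exists_eq_add_of_le hN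
    have : S ((1 - m).toNat + d) = S (1 - m).toNat +
        ∑ l ∈ Finset.range d, T ^ ((1 - m).toNat + l) * V := Finset.sum_range_add _ _ _
    rw [this, Matrix.vecMul_add, Pi.add_apply, map_add, add_eq_left]
    have h2 : Matrix.vecMul v (∑ l ∈ Finset.range d, T ^ ((1 - m).toNat + l) * V) i =
        ∑ l ∈ Finset.range d, ((Matrix.of fun _ : ι => v) * T ^ ((1 - m).toNat + l) * V) i i := by
      rw [← Matrix.sum_apply]
      simp only [Matrix.mul_assoc]
      rw [← Finset.mul_sum]
      rfl
    rw [h2, map_sum]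
    refine Finset.sum_eq_zero fun l _ => ?_
    apply ZG_ext
    intro x
    rw [trunc_coeff]
    split_ifs with hx
    · by_contra hne
      have h3 := hm _ i i x hne
      have h4 := hp x hx
      omega
    · simp
  choose R hR using hev
  refine ⟨R, ?_, ?_, ?_⟩
  · intro v w
    funext i
    obtain ⟨N, h1, h2, h3⟩ := ((hR v).and ((hR w).and (hR (v + w)))).exists
    rw [← h3 i, Matrix.add_vecMul, Pi.add_apply, map_add, h1, h2, Pi.add_apply]
  · intro k v hk
    funext i
    obtain ⟨N, h1, h2⟩ := ((hR v).and (hR (gr k • v))).exists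
    rw [← h2 i, Matrix.smul_vecMul, Pi.smul_apply, smul_eq_mul, trunc_gr_mul p k (fun x => hpk k x hk),
      h1, Pi.smul_apply, smul_eq_mul]
  · intro w i
    apply ZG_ext
    intro x
    have h1 : ∀ k, ∀ᶠ N in atTop, (w k * (J * S N) k i).coeff x =
        (w k * (1 : Matrix ι ι (ZG G)) k i).coeff x := fun k => ev_coeff_mul (hJS k i) (w k) x
    obtain ⟨N, h2, h3⟩ := ((hR (Matrix.vecMul w J)).and (eventually_all.2 h1)).exists
    rw [← h2 i, trunc_coeff, trunc_coeff, Matrix.vecMul_vecMul]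
    congr 1
    have h4 : w i = Matrix.vecMul w 1 i := by rw [Matrix.vecMul_one]
    rw [h4, Matrix.vecMul, Matrix.vecMul, dotProduct, dotProduct, coeff_sum_apply, coeff_sum_apply]
    exact Finset.sum_congr rfl fun k _ => h3 k

theorem exists_retraction {χ : G → ℤ} (hχ : IsChar χ) {J : Matrix ι ι (ZG G)}
    (hp : ∃ T V : Matrix ι ι (ZG G), (∀ i j, SuppGE χ 1 (T i j)) ∧ V * J = 1 - T)
    (hm : ∃ T V : Matrix ι ι (ZG G), (∀ i j, SuppGE (fun h => -χ h) 1 (T i j)) ∧ V * J = 1 - T) :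
    ∃ R : (ι → ZG G) → (ι → ZG G), (∀ v w, R (v + w) = R v + R w) ∧
      (∀ k v, χ k = 0 → R (gr k • v) = gr k • R v) ∧
      (∀ w, R (Matrix.vecMul w J) = w) := by
  obtain ⟨T, V, hT, hV⟩ := hp
  obtain ⟨T', V', hT', hV'⟩ := hm
  obtain ⟨R, h1, h2, h3⟩ := oneSide hχ hV hT (fun x => χ x < 1) (fun x hx => hx)
    (fun k x hk => by rw [hχ, hk, zero_add])
  obtain ⟨R', h1', h2', h3'⟩ := oneSide hχ.neg hV' hT' (fun x => ¬ χ x < 1)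
    (fun x hx => by omega)
    (fun k x hk => by
      have hk' : χ k = 0 := by simpa using hk
      rw [hχ, hk', zero_add])
  refine ⟨fun v => R v + R' v, ?_, ?_, ?_⟩
  · intro v w
    beta_reduce
    rw [h1, h1']; abel
  · intro k v hk
    beta_reduce
    rw [h2 k v hk, h2' k v (by simpa using hk), smul_add]
  · intro w
    funext i
    beta_reduce
    rw [Pi.add_apply, h3, h3', trunc_add_not]
end retr

/-! ### The derivation on two-generated subgroups of the kernel -/

section der

/-- pairing with the column `(u - 1, v - 1)` -/
noncomputable def pairA {H : Type*} [Group H] (u v : H) (x : Fin 2 → ZG H) : ZG H :=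
  x 0 * (gr u - 1) + x 1 * (gr v - 1)

theorem pairA_add {H : Type*} [Group H] (u v : H) (x y : Fin 2 → ZG H) :
    pairA u v (x + y) = pairA u v x + pairA u v y := by
  simp only [pairA, Pi.add_apply]; noncomm_ring

theorem pairA_neg {H : Type*} [Group H] (u v : H) (x : Fin 2 → ZG H) :
    pairA u v (-x) = - pairA u v x := by
  simp only [pairA, Pi.neg_apply]; noncomm_ring

theorem pairA_sub {H : Type*} [Group H] (u v : H) (x y : Fin 2 → ZG H) :
    pairA u v (x - y) = pairA u v x - pairA u v y := by
  rw [sub_eq_add_neg, pairA_add, pairA_neg, sub_eq_add_neg]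

theorem pairA_smul {H : Type*} [Group H] (u v : H) (a : ZG H) (x : Fin 2 → ZG H) :
    pairA u v (a • x) = a * pairA u v x := by
  simp only [pairA, Pi.smul_apply, smul_eq_mul, mul_add, mul_assoc]

theorem pairA_sum {H : Type*} [Group H] {κ : Type*} (u v : H) (s : Finset κ) (f : κ → Fin 2 → ZG H) :
    pairA u v (∑ i ∈ s, f i) = ∑ i ∈ s, pairA u v (f i) := by
  classical
  induction s using Finset.induction_on with
  | empty => simp [pairA]
  | insert a s ha ih => rw [Finset.sum_insert ha, Finset.sum_insert ha, pairA_add, ih]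

theorem exists_beta {H : Type*} [Group H] (u v : H) (hgen : Subgroup.closure {u, v} = ⊤) (h : H) :
    ∃ x, pairA u v x = gr h - 1 := by
  have hh : h ∈ Subgroup.closure {u, v} := by rw [hgen]; trivial
  induction hh using Subgroup.closure_induction with
  | mem x hx =>
    rcases hx with rfl | rfl
    · exact ⟨![1, 0], by simp [pairA]⟩
    · exact ⟨![0, 1], by simp [pairA]⟩
  | one => exact ⟨0, by simp [pairA, gr_one]⟩
  | mul x y _ _ hx hy =>
    obtain ⟨a, ha⟩ := hx
    obtain ⟨b, hb⟩ := hy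
    refine ⟨a + gr x • b, ?_⟩
    rw [pairA_add, pairA_smul, ha, hb, gr_mul]; noncomm_ring
  | inv x _ hx =>
    obtain ⟨a, ha⟩ := hx
    refine ⟨-(gr x⁻¹ • a), ?_⟩
    rw [pairA_neg, pairA_smul, ha, mul_sub, gr_inv_mul]; simp

theorem exists_theta {G : Type*} [Group G] {χ : G → ℤ} (hχ : IsChar χ) {t : G} (ht : χ t = 1)
    (H : Subgroup G) (hH : ∀ h ∈ H, χ h = 0) :
    ∃ θ : G → H, (∀ (h : H) g, θ (h * g) = h * θ g) ∧ (∀ g, θ (g * t) = θ g) ∧ θ 1 = 1 := by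
  have key : ∀ g : G, ∃ (h : H) (j : ℤ), g = h * (DoubleCoset.mk H (Subgroup.zpowers t) g).out * t ^ j := by
    intro g
    obtain ⟨h, k, hh, hk, e⟩ := DoubleCoset.mk_out_eq_mul H (Subgroup.zpowers t) g
    obtain ⟨j, rfl⟩ := Subgroup.mem_zpowers_iff.1 hk
    refine ⟨⟨h⁻¹, H.inv_mem hh⟩, -j, ?_⟩
    rw [e]
    simp [mul_assoc]
  choose θ0 j hθ using key
  have uniq : ∀ (h h' : H) (r : G) (i i' : ℤ), (h : G) * r * t ^ i = h' * r * t ^ i' → h = h' := by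
    intro h h' r i i' e
    have e2 := congrArg χ e
    rw [hχ, hχ, hχ, hχ, hχ.zpow, hχ.zpow, hH h h.2, hH h' h'.2, ht] at e2
    have : i = i' := by omega
    subst this
    exact Subtype.ext (mul_right_cancel (mul_right_cancel e))
  have hmk1 : ∀ (h : H) g, DoubleCoset.mk H (Subgroup.zpowers t) (h * g) =
      DoubleCoset.mk H (Subgroup.zpowers t) g := by
    intro h g
    rw [DoubleCoset.eq]
    exact ⟨h⁻¹, H.inv_mem h.2, 1, Subgroup.one_mem _, by simp⟩
  have hmk2 : ∀ g, DoubleCoset.mk H (Subgroup.zpowers t) (g * t) =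
      DoubleCoset.mk H (Subgroup.zpowers t) g := by
    intro g
    rw [DoubleCoset.eq]
    exact ⟨1, H.one_mem, t⁻¹, Subgroup.inv_mem _ (Subgroup.mem_zpowers t), by simp⟩
  have h1 : ∀ (h : H) g, θ0 (h * g) = h * θ0 g := by
    intro h g
    refine uniq _ _ (DoubleCoset.mk H (Subgroup.zpowers t) g).out (j (h * g)) (j g) ?_
    have := hθ (h * g)
    rw [hmk1] at this
    rw [← this, Subgroup.coe_mul, mul_assoc, mul_assoc, ← mul_assoc (θ0 g : G), ← hθ g]
  have h2 : ∀ g, θ0 (g * t) = θ0 g := by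
    intro g
    refine uniq _ _ (DoubleCoset.mk H (Subgroup.zpowers t) g).out (j (g * t)) (j g + 1) ?_
    have := hθ (g * t)
    rw [hmk2] at this
    rw [← this, zpow_add_one, ← mul_assoc, ← hθ g]
  refine ⟨fun g => θ0 g * (θ0 1)⁻¹, ?_, ?_, ?_⟩
  · intro h g
    beta_reduce
    rw [h1, mul_assoc]
  · intro g
    beta_reduce
    rw [h2]
  · simp

theorem exists_der_aux {G : Type*} [Group G] {n : ℕ} {χ : G → ℤ} (hχ : IsChar χ) {t : G} (ht : χ t = 1)
    (g : Fin n → G) (J : Matrix (Fin n) (Fin n) (ZG G))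
    (hgen : ∀ h : G, ∃ v : Fin n → ZG G, ∑ i, v i * (gr (g i) - 1) = gr h - 1)
    (hJt : ∀ w, ∃ c, ∑ i, (Matrix.vecMul w J) i * (gr (g i) - 1) = c * (gr t - 1))
    (hJ : ∀ v : Fin n → ZG G, ∑ i, v i * (gr (g i) - 1) = 0 → ∃ w, v = Matrix.vecMul w J)
    (R : (Fin n → ZG G) → (Fin n → ZG G)) (hR1 : ∀ v w, R (v + w) = R v + R w)
    (hR2 : ∀ k v, χ k = 0 → R (gr k • v) = gr k • R v)
    (hR3 : ∀ w, R (Matrix.vecMul w J) = w)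
    (H : Subgroup G) (hH : ∀ h ∈ H, χ h = 0) (u v : H) (hgenH : Subgroup.closure {u, v} = ⊤) :
    ∃ d : H → Fin 2 → ZG H, (∀ h h', d (h * h') = d h + gr h • d h') ∧
      ∀ h, pairA u v (d h) = gr h - 1 := by
  obtain ⟨θ, hθ1, hθ2, hθ3⟩ := exists_theta hχ ht H hH
  choose β hβ using exists_beta u v hgenH
  choose y hy using fun h : H => hgen h
  let Ψi : Fin n → ZG G →+ (Fin 2 → ZG H) := fun i =>
    linExt (fun x => gr (θ x) • β ((θ x)⁻¹ * θ (x * g i)))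
  let ϖ : ZG G →+ ZG H := linExt (fun x => gr (θ x))
  let Ψ : (Fin n → ZG G) → (Fin 2 → ZG H) := fun w => ∑ i, Ψi i (w i)
  have hΨi : ∀ i (h : H) a, Ψi i (gr (h : G) * a) = gr h • Ψi i a := by
    intro i h a
    induction a using ZG_induction with
    | hg x =>
      rw [← gr_mul]
      simp only [Ψi, linExt_gr]
      rw [mul_assoc, hθ1, hθ1, gr_mul, smul_smul]
      congr 2
      group
    | hadd a b ha hb => rw [mul_add, map_add, ha, hb, map_add, smul_add]
    | hneg a ha => rw [mul_neg, map_neg, ha, map_neg, smul_neg]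
  have hΨs : ∀ (h : H) w, Ψ (gr (h : G) • w) = gr h • Ψ w := by
    intro h w
    simp only [Ψ, Finset.smul_sum, Pi.smul_apply, smul_eq_mul, hΨi]
  have hΨa : ∀ w w', Ψ (w + w') = Ψ w + Ψ w' := by
    intro w w'
    simp only [Ψ, Pi.add_apply, map_add, Finset.sum_add_distrib]
  have hΨpi : ∀ i a, pairA u v (Ψi i a) = ϖ (a * (gr (g i) - 1)) := by
    intro i a
    induction a using ZG_induction with
    | hg x =>
      rw [mul_sub, mul_one, ← gr_mul, map_sub]
      simp only [Ψi, ϖ, linExt_gr]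
      rw [pairA_smul, hβ, mul_sub, ← gr_mul, mul_inv_cancel_left, mul_one]
    | hadd a b ha hb => rw [add_mul, map_add, map_add, pairA_add, ha, hb]
    | hneg a ha => rw [neg_mul, map_neg, map_neg, pairA_neg, ha]
  have hΨp : ∀ w, pairA u v (Ψ w) = ϖ (∑ i, w i * (gr (g i) - 1)) := by
    intro w
    simp only [Ψ]
    rw [pairA_sum, map_sum]
    exact Finset.sum_congr rfl fun i _ => hΨpi i _
  have hϖt : ∀ c, ϖ (c * (gr t - 1)) = 0 := by
    intro c
    induction c using ZG_induction with
    | hg x =>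
      rw [mul_sub, mul_one, ← gr_mul, map_sub]
      simp only [ϖ, linExt_gr]
      rw [hθ2, sub_self]
    | hadd a b ha hb => rw [add_mul, map_add, ha, hb, add_zero]
    | hneg a ha => rw [neg_mul, map_neg, ha, neg_zero]
  let E : (Fin n → ZG G) → (Fin n → ZG G) := fun w => w - Matrix.vecMul (R w) J
  have hE1 : ∀ w w', E (w + w') = E w + E w' := by
    intro w w'
    simp only [E, hR1, Matrix.add_vecMul]; abel
  have hE2 : ∀ k w, χ k = 0 → E (gr k • w) = gr k • E w := by
    intro k w hk
    simp only [E, hR2 k w hk, Matrix.smul_vecMul, smul_sub]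
  have hE3 : ∀ w, E (Matrix.vecMul w J) = 0 := by
    intro w
    simp only [E, hR3, sub_self]
  refine ⟨fun h => Ψ (E (y h)), ?_, ?_⟩
  · intro h h'
    have h1 : ∑ i, (y (h * h') - y h - gr (h : G) • y h') i * (gr (g i) - 1) = 0 := by
      simp only [Pi.sub_apply, Pi.smul_apply, smul_eq_mul, sub_mul, Finset.sum_sub_distrib, mul_assoc]
      rw [← Finset.mul_sum]
      have e1 := hy (h * h')
      have e2 := hy h
      have e3 := hy h'
      rw [e1, e2, e3, Subgroup.coe_mul, gr_mul]
      noncomm_ring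
    obtain ⟨w, hw⟩ := hJ _ h1
    have h2 : y (h * h') = y h + gr (h : G) • y h' + Matrix.vecMul w J := by
      rw [← hw]; abel
    beta_reduce
    rw [h2, hE1, hE1, hE3, add_zero, hE2 _ _ (hH h h.2), hΨa, hΨs]
  · intro h
    obtain ⟨c, hc⟩ := hJt (R (y h))
    beta_reduce
    rw [hΨp]
    simp only [E, Pi.sub_apply, sub_mul, Finset.sum_sub_distrib]
    rw [hc, hy, map_sub, hϖt, sub_zero, map_sub, ← gr_one]
    simp only [ϖ, linExt_gr]
    have := hθ1 h 1
    rw [mul_one, hθ3, mul_one] at this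
    rw [this, hθ3, gr_one]

theorem exists_der {G : Type*} [Group G] {n : ℕ}
    (rels : Finset (FreeGroup (Fin n))) (hcard : rels.card + 1 = n)
    (e : G ≃* PresentedGroup (rels : Set (FreeGroup (Fin n))))
    {χ : G → ℤ} (hχ : IsChar χ) {t : G} (ht : χ t = 1) (hfg : hχ.ker.FG)
    (H : Subgroup G) (hH : ∀ h ∈ H, χ h = 0) (u v : H) (hgenH : Subgroup.closure {u, v} = ⊤) :
    ∃ d : H → Fin 2 → ZG H, (∀ h h', d (h * h') = d h + gr h • d h') ∧
      ∀ h, pairA u v (d h) = gr h - 1 := by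
  obtain ⟨g, J, h1, h2, h3, h4, h5⟩ := exists_J rels hcard e hχ ht hfg
  obtain ⟨R, r1, r2, r3⟩ := exists_retraction hχ h4 h5
  exact exists_der_aux hχ ht g J h1 h2 h3 R r1 r2 r3 H hH u v hgenH

end der

/-! ### Coset sums and consequences for the group -/

section cosets
variable {H : Type*} [Group H]

/-- augmentation -/
noncomputable def aug : ZG H →+ ℤ := linExt (fun _ => (1:ℤ))

theorem aug_gr (h : H) : aug (gr h) = 1 := linExt_gr _ _

theorem aug_mul (a b : ZG H) : aug (a * b) = aug a * aug b := by
  induction a using ZG_induction with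
  | hg k =>
    induction b using ZG_induction with
    | hg l => rw [← gr_mul, aug_gr, aug_gr, aug_gr, mul_one]
    | hadd x y hx hy => rw [mul_add, map_add, hx, hy, map_add, mul_add]
    | hneg x hx => rw [mul_neg, map_neg, hx, map_neg, mul_neg]
  | hadd x y hx hy => rw [add_mul, map_add, hx, hy, map_add, add_mul]
  | hneg x hx => rw [neg_mul, map_neg, hx, map_neg, neg_mul]

theorem aug_one : aug (1 : ZG H) = 1 := by rw [← gr_one, aug_gr]

theorem aug_pairA (u v : H) (x : Fin 2 → ZG H) : aug (pairA u v x) = 0 := by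
  simp [pairA, aug_mul, aug_gr, aug_one]

theorem aug_eq_sum (x : ZG H) : aug x = ∑ g ∈ x.coeff.support, x.coeff g := by
  rw [aug, linExt_apply]; simp [Finsupp.sum]

/-- right coset space of the cyclic subgroup -/
abbrev CQ (g : H) : Type _ := Quotient (QuotientGroup.rightRel (Subgroup.zpowers g))

/-- coset sums -/
noncomputable def cs (g : H) : ZG H →+ (CQ g →₀ ℤ) :=
  linExt (fun x => Finsupp.single (Quotient.mk _ x) 1)

theorem cq_eq {g x y : H} : ((Quotient.mk _ x : CQ g) = Quotient.mk _ y) ↔ ∃ m : ℤ, y = g ^ m * x := by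
  rw [Quotient.eq, QuotientGroup.rightRel_apply, Subgroup.mem_zpowers_iff]
  constructor
  · rintro ⟨m, hm⟩; exact ⟨m, by rw [hm]; group⟩
  · rintro ⟨m, hm⟩; exact ⟨m, by rw [hm]; group⟩

theorem cs_gr_mul (g : H) (f : ZG H) : cs g (gr g * f) = cs g f := by
  induction f using ZG_induction with
  | hg k =>
    rw [← gr_mul, cs, linExt_gr, linExt_gr]
    congr 1
    exact (cq_eq.2 ⟨1, by simp⟩).symm
  | hadd x y hx hy => rw [mul_add, map_add, hx, hy, map_add]
  | hneg x hx => rw [mul_neg, map_neg, hx, map_neg]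

theorem gr_zpow_sub_one_left (t : H) (m : ℤ) : ∃ c, gr (t^m) - 1 = (gr t - 1) * c := by
  induction m with
  | zero => exact ⟨0, by simp [gr_one]⟩
  | succ n ih =>
    obtain ⟨c, hc⟩ := ih
    refine ⟨c + gr (t^(n:ℤ)), ?_⟩
    rw [mul_add, ← hc, sub_mul, ← gr_mul, ← zpow_one_add, add_comm (1:ℤ)]
    rw [one_mul]; abel
  | pred n ih =>
    obtain ⟨c, hc⟩ := ih
    refine ⟨c - gr (t^(-(n:ℤ)-1)), ?_⟩
    rw [mul_sub, ← hc, sub_mul, ← gr_mul, ← zpow_one_add, show 1 + (-(n:ℤ)-1) = -n by ring]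
    simp

theorem cs_zero {g : H} {f : ZG H} (h : cs g f = 0) : ∃ b, f = (gr g - 1) * b := by
  let lam : (CQ g →₀ ℤ) →+ ZG H :=
    Finsupp.liftAddHom (fun q : CQ g => (zmultiplesHom (ZG H)) (gr q.out))
  have hl : ∀ x : H, lam (cs g (gr x)) = gr (Quotient.mk _ x : CQ g).out := by
    intro x
    rw [cs, linExt_gr]
    simp [lam]
  have key : ∀ f : ZG H, ∃ b, f - lam (cs g f) = (gr g - 1) * b := by
    intro f
    induction f using ZG_induction with
    | hg k =>
      rw [hl]
      obtain ⟨m, hm⟩ : ∃ m : ℤ, k = g ^ m * (Quotient.mk _ k : CQ g).out := by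
        apply cq_eq.1
        exact Quotient.out_eq _
      obtain ⟨c, hc⟩ := gr_zpow_sub_one_left g m
      refine ⟨c * gr (Quotient.mk _ k : CQ g).out, ?_⟩
      rw [← mul_assoc, ← hc, sub_mul, ← gr_mul, ← hm, one_mul]
    | hadd x y hx hy =>
      obtain ⟨b, hb⟩ := hx
      obtain ⟨c, hc⟩ := hy
      refine ⟨b + c, ?_⟩
      rw [map_add, map_add, mul_add, ← hb, ← hc]; abel
    | hneg x hx =>
      obtain ⟨b, hb⟩ := hx
      refine ⟨-b, ?_⟩
      rw [map_neg, map_neg, mul_neg, ← hb]; abel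
  obtain ⟨b, hb⟩ := key f
  rw [h, map_zero, sub_zero] at hb
  exact ⟨b, hb⟩

theorem cs_translate {g k : H} (hk : Commute k g) (f : ZG H) (x : H) :
    cs g (gr k * f) (Quotient.mk _ (k * x)) = cs g f (Quotient.mk _ x) := by
  classical
  induction f using ZG_induction with
  | hg y =>
    rw [← gr_mul, cs, linExt_gr, linExt_gr, Finsupp.single_apply, Finsupp.single_apply]
    have : ((Quotient.mk _ (k * y) : CQ g) = Quotient.mk _ (k * x)) ↔
        ((Quotient.mk _ y : CQ g) = Quotient.mk _ x) := by
      rw [cq_eq, cq_eq]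
      apply exists_congr
      intro m
      rw [← mul_assoc, ← (hk.zpow_right m).eq, mul_assoc]
      exact mul_right_inj k
    simp only [this]
  | hadd y z hy hz => rw [mul_add, map_add, map_add, Finsupp.add_apply, Finsupp.add_apply, hy, hz]
  | hneg y hy => rw [mul_neg, map_neg, map_neg, Finsupp.neg_apply, Finsupp.neg_apply, hy]

end cosets

theorem lemmaW {α V : Type*} [Fintype α] [DecidableEq α] [AddCommGroup V] {p : ℕ} [Fact p.Prime]
    (hV : ∀ x : V, p • x = 0) (f : α → α) (hf : f^[p] = id) (w : α → V) (hw : ∀ a, w (f a) = w a) :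
    ∑ a, w a = ∑ a ∈ Finset.univ.filter (fun a => f a = a), w a := by
  classical
  have key : ∀ b : V, (Finset.univ.filter (fun a => w a = b)).card • b =
      ((Finset.univ.filter (fun a => f a = a)).filter (fun a => w a = b)).card • b := by
    intro b
    let β := {a : α // w a = b}
    let f' : Function.End β := fun a => ⟨f a.1, by rw [hw]; exact a.2⟩
    have hit : ∀ (n : ℕ) (a : β), ((f' ^ n) a).1 = f^[n] a.1 := by
      intro n
      induction n with
      | zero => intro a; rfl
      | succ n ih =>
        intro a
        rw [pow_succ, Function.iterate_succ_apply]
        exact ih _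
    have h1 : f' ^ p ^ 1 = 1 := by
      rw [pow_one]
      funext a
      apply Subtype.ext
      rw [hit, hf]; rfl
    have h2 := Equiv.Perm.card_fixedPoints_modEq h1
    have e1 : Fintype.card β = (Finset.univ.filter (fun a => w a = b)).card :=
      Fintype.card_subtype _
    have e2 : Fintype.card (Function.fixedPoints f') =
        ((Finset.univ.filter (fun a => f a = a)).filter (fun a => w a = b)).card := by
      rw [← Fintype.card_coe]
      refine Fintype.card_congr ⟨fun a => ⟨a.1.1, ?_⟩, fun a => ⟨⟨a.1, ?_⟩, ?_⟩, ?_, ?_⟩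
      · have := a.2
        simp only [Finset.mem_filter, Finset.mem_univ, true_and]
        exact ⟨congrArg Subtype.val this, a.1.2⟩
      · have := a.2
        simp only [Finset.mem_filter, Finset.mem_univ, true_and] at this
        exact this.2
      · have := a.2
        simp only [Finset.mem_filter, Finset.mem_univ, true_and] at this
        exact Subtype.ext this.1
      · intro a; rfl
      · intro a; rfl
    rw [e1, e2] at h2
    obtain ⟨c, hc⟩ := (Nat.modEq_iff_dvd.1 h2)
    have : ((((Finset.univ.filter (fun a => f a = a)).filter (fun a => w a = b)).card : ℤ) -
      ((Finset.univ.filter (fun a => w a = b)).card : ℤ)) • b = 0 := by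
      rw [hc, mul_comm, mul_smul, natCast_zsmul, hV, smul_zero]
    rw [sub_smul, natCast_zsmul, natCast_zsmul] at this
    exact (sub_eq_zero.1 this).symm
  rw [Finset.sum_comp (fun x => x) w, Finset.sum_comp (fun x => x) w, Finset.sum_congr rfl (fun b _ => key b)]
  symm
  apply Finset.sum_subset
  · apply Finset.image_subset_image; exact Finset.filter_subset _ _
  · intro b _ hb
    rw [Finset.card_eq_zero.2, zero_smul]
    rw [Finset.filter_eq_empty_iff]
    intro a ha hab
    exact hb (Finset.mem_image.2 ⟨a, ha, hab⟩)


section derprops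
variable {H : Type*} [Group H]

theorem inv_elt_aug {g : H} (hg : g ≠ 1) {z : ZG H} (hz : gr g * z = z) : aug z ≠ 1 := by
  classical
  intro ha
  have hpow : ∀ n : ℕ, gr (g^n) * z = z := by
    intro n
    induction n with
    | zero => rw [pow_zero, gr_one, one_mul]
    | succ n ih => rw [pow_succ, gr_mul, mul_assoc, hz, ih]
  have hc : ∀ (n : ℕ) x, z.coeff (g^n * x) = z.coeff x := by
    intro n x
    have := congrArg (fun y : ZG H => y.coeff (g^n * x)) (hpow n)
    beta_reduce at this
    rw [coeff_gr_mul, inv_mul_cancel_left] at this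
    exact this.symm
  have hz0 : z ≠ 0 := by rintro rfl; simp at ha
  by_cases hfin : IsOfFinOrder g
  · set n := orderOf g with hn
    have hn1 : n ≠ 1 := by rw [hn, Ne, orderOf_eq_one_iff]; exact hg
    have hnpos : 0 < n := hfin.orderOf_pos
    obtain ⟨p, hp, m, hm⟩ := Nat.exists_prime_and_dvd hn1
    haveI : Fact p.Prime := ⟨hp⟩
    set g' := g ^ m with hg'
    have hg'p : g' ^ p = 1 := by rw [hg', ← pow_mul, mul_comm, ← hm, hn, pow_orderOf_eq_one]
    have hg'1 : g' ≠ 1 := by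
      intro h
      have h1 := orderOf_dvd_of_pow_eq_one h
      rw [← hn, hm] at h1
      have hmpos : 0 < m := by
        rcases Nat.eq_zero_or_pos m with h0 | h0
        · rw [h0, mul_zero] at hm; omega
        · exact h0
      have h2 := Nat.le_of_dvd hmpos h1
      have := hp.two_le
      nlinarith
    let f : z.coeff.support → z.coeff.support := fun x => ⟨g' * x.1, by
      have := x.2
      rw [Finsupp.mem_support_iff] at this ⊢
      rw [hg', hc]; exact this⟩
    have hit : ∀ (k : ℕ) (a : z.coeff.support), (f^[k] a).1 = g'^k * a.1 := by
      intro k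
      induction k with
      | zero => intro a; simp
      | succ k ih => intro a; rw [Function.iterate_succ_apply, ih, pow_succ, mul_assoc]
    have := lemmaW (p := p) (V := ZMod p) (by intro x; simp) f (by
        funext a; apply Subtype.ext; rw [hit, hg'p, one_mul]; rfl)
      (fun a => (z.coeff a.1 : ZMod p)) (by
        intro a
        simp only [f]
        rw [hg', hc])
    rw [Finset.filter_eq_empty_iff.2, Finset.sum_empty] at this
    · have e := aug_eq_sum z
      rw [ha, ← Finset.sum_coe_sort] at e
      have e' := congrArg (Int.cast : ℤ → ZMod p) e
      rw [Int.cast_sum, this] at e'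
      simp at e'
    · intro a _ hfa
      have := congrArg Subtype.val hfa
      simp only [f] at this
      exact hg'1 (mul_eq_right.1 this)
  · obtain ⟨x, hx⟩ : ∃ x, z.coeff x ≠ 0 := by
      by_contra hcon
      push Not at hcon
      exact hz0 (ZG_ext (by simpa using hcon))
    have hinj : Function.Injective (fun n : ℕ => g^n * x) := by
      intro a b hab
      exact injective_pow_iff_not_isOfFinOrder.2 hfin (mul_right_cancel hab)
    have : (Set.range (fun n : ℕ => g^n * x)) ⊆ (z.coeff.support : Set H) := by
      rintro _ ⟨n, rfl⟩
      simp only [Finset.mem_coe, Finsupp.mem_support_iff]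
      rw [hc]; exact hx
    exact Set.infinite_range_of_injective hinj (z.coeff.support.finite_toSet.subset this)

variable {u v : H} {d : H → Fin 2 → ZG H}
  (hd : ∀ h h', d (h*h') = d h + gr h • d h') (hp : ∀ h, pairA u v (d h) = gr h - 1)
include hd hp

omit hp in
theorem der_one : d 1 = 0 := by
  have := hd 1 1
  rw [mul_one, gr_one, one_smul] at this
  simpa using this

omit hd in
theorem notdiv {g : H} (hg : g ≠ 1) : ¬ ∃ b, d g = (gr g - 1) • b := by
  rintro ⟨b, hb⟩
  have h1 := hp g
  rw [hb, pairA_smul] at h1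
  apply inv_elt_aug hg (z := 1 - pairA u v b)
  · rw [sub_mul, one_mul] at h1
    rw [mul_sub, mul_one]
    have : gr g * pairA u v b = gr g - 1 + pairA u v b := by rw [← h1]; abel
    rw [this]; abel
  · rw [map_sub, aug_one, aug_pairA, sub_zero]

omit hd in
theorem notdiv_cs {g : H} (hg : g ≠ 1) : ∃ j, cs g (d g j) ≠ 0 := by
  by_contra hcon
  push Not at hcon
  obtain ⟨b, hb⟩ : ∃ b : Fin 2 → ZG H, ∀ j, d g j = (gr g - 1) * b j := by
    choose b hb using fun j => cs_zero (hcon j)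
    exact ⟨b, hb⟩
  exact notdiv hp hg ⟨b, funext hb⟩

theorem der_torsionfree {g : H} {m : ℕ} (hm : m ≠ 0) (h : g ^ m = 1) : g = 1 := by
  by_contra hg
  obtain ⟨j, hj⟩ := notdiv_cs hp hg
  have key : ∀ n : ℕ, cs g (d (g^n) j) = n • cs g (d g j) := by
    intro n
    induction n with
    | zero => simp [der_one hd]
    | succ n ih =>
      rw [pow_succ', hd, Pi.add_apply, map_add, Pi.smul_apply, smul_eq_mul, cs_gr_mul, ih,
        add_smul, one_smul, add_comm]
  have := key m
  rw [h, der_one hd, Pi.zero_apply, map_zero] at this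
  rcases smul_eq_zero.1 this.symm with h0 | h0
  · exact hm h0
  · exact hj h0

theorem no_chain {g : H} (hg : g ≠ 1) {p : ℕ} (hp2 : 2 ≤ p) (h : ∀ i : ℕ, ∃ k : H, k ^ (p^i) = g) : False := by
  classical
  obtain ⟨j, hj⟩ := notdiv_cs hp hg
  obtain ⟨q, hq⟩ : ∃ q, cs g (d g j) q ≠ 0 := by
    by_contra hcon
    push Not at hcon
    exact hj (Finsupp.ext hcon)
  obtain ⟨x, rfl⟩ := Quotient.exists_rep q
  set i := (cs g (d g j)).support.card with hi
  obtain ⟨k, hk⟩ := h i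
  have hcom : Commute k g := by rw [← hk]; exact (Commute.refl k).pow_right _
  have e1 : gr k • d g + d k = gr g • d k + d g := by
    rw [add_comm, ← hd, hcom.eq, hd, add_comm]
  have e2 : cs g (gr k * d g j) = cs g (d g j) := by
    have := congrArg (fun y => cs g (y j)) e1
    simp only [Pi.add_apply, map_add, Pi.smul_apply, smul_eq_mul] at this
    rw [cs_gr_mul, add_comm] at this
    exact add_left_cancel this
  have e3 : ∀ y, cs g (d g j) (Quotient.mk _ (k * y)) = cs g (d g j) (Quotient.mk _ y) := by
    intro y
    have := cs_translate hcom (d g j) y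
    rwa [e2] at this
  have e4 : ∀ a : ℕ, cs g (d g j) (Quotient.mk _ (k^a * x)) = cs g (d g j) (Quotient.mk _ x) := by
    intro a
    induction a with
    | zero => simp
    | succ a ih => rw [pow_succ', mul_assoc, e3, ih]
  have hkinf : ¬ IsOfFinOrder k := by
    intro hfin
    have := der_torsionfree hd hp (hfin.orderOf_pos.ne') (pow_orderOf_eq_one k)
    rw [this, one_pow] at hk
    exact hg hk.symm
  have hzinj : Function.Injective (fun n : ℤ => k ^ n) := injective_zpow_iff_not_isOfFinOrder.2 hkinf
  have hinj : Set.InjOn (fun a : ℕ => (Quotient.mk _ (k^a * x) : CQ g)) (Finset.range (p^i)) := by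
    intro a ha b hb hab
    simp only [Finset.coe_range, Set.mem_Iio] at ha hb
    obtain ⟨m, hm⟩ := cq_eq.1 hab
    rw [← mul_assoc] at hm
    have hm := mul_right_cancel hm
    rw [← hk, ← zpow_natCast k b, ← zpow_natCast k a, ← zpow_natCast k, ← zpow_mul, ← zpow_add] at hm
    have hm := hzinj hm
    have hb1 : (b:ℤ) < (p^i:ℕ) := by exact_mod_cast hb
    have ha1 : (a:ℤ) < (p^i:ℕ) := by exact_mod_cast ha
    have : m = 0 := by
      by_contra hne
      rcases lt_or_gt_of_ne hne with h0 | h0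
      · nlinarith
      · nlinarith
    rw [this, mul_zero, zero_add] at hm
    exact_mod_cast hm.symm
  have hle : (Finset.range (p^i)).card ≤ (cs g (d g j)).support.card := by
    apply Finset.card_le_card_of_injOn _ _ hinj
    intro a _
    simp only [Finset.mem_coe, Finsupp.mem_support_iff]
    rw [e4]; exact hq
  rw [Finset.card_range, ← hi] at hle
  have := Nat.lt_pow_self (n := i) (show 1 < p by omega)
  omega

end derprops

/-! ### Traces of idempotents -/

theorem add_pow_expand {A : Type*} [Ring A] (m : Bool → A) (n : ℕ) :
    (m false + m true) ^ n = ∑ f : Fin n → Bool, (List.ofFn (fun i => m (f i))).prod := by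
  induction n with
  | zero => simp
  | succ n ih =>
    rw [pow_succ', ih, ← (Fin.consEquiv (fun _ : Fin (n+1) => Bool)).sum_comp, Fintype.sum_prod_type]
    simp only [Fin.consEquiv, Equiv.coe_fn_mk, List.ofFn_succ, Fin.cons_zero, Fin.cons_succ,
      List.prod_cons, Fintype.sum_bool, ← Finset.mul_sum]
    rw [← add_mul, add_comm]

theorem trace_frob {A V : Type*} [Ring A] [AddCommGroup V] {p : ℕ} [hpf : Fact p.Prime]
    (hV : ∀ x : V, p • x = 0) (τ : A →+ V) (hτ : ∀ a b, τ (a * b) = τ (b * a)) (a b : A) :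
    τ ((a + b) ^ p) = τ (a ^ p) + τ (b ^ p) := by
  classical
  obtain ⟨n, rfl⟩ : ∃ n, p = n + 1 := ⟨p - 1, by have := hpf.out.pos; omega⟩
  let m : Bool → A := fun x => cond x b a
  have h1 := add_pow_expand m (n+1)
  have h2 : m false + m true = a + b := rfl
  rw [h2] at h1
  rw [h1, map_sum]
  let rot : (Fin (n+1) → Bool) → (Fin (n+1) → Bool) := fun f i => f (i + 1)
  have hit : ∀ (k : ℕ) (f : Fin (n+1) → Bool) i, rot^[k] f i = f (i + k • (1 : Fin (n+1))) := by
    intro k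
    induction k with
    | zero => intro f i; simp
    | succ k ih =>
      intro f i
      rw [Function.iterate_succ_apply, ih]
      simp only [rot]
      rw [succ_nsmul, add_assoc]
  rw [lemmaW hV rot (by
      funext f i
      rw [hit]
      have := card_nsmul_eq_zero' (x := (1 : Fin (n+1)))
      rw [Nat.card_eq_fintype_card, Fintype.card_fin] at this
      rw [this, add_zero]; rfl) (fun f => τ (List.ofFn (fun i => m (f i))).prod) (by
      intro f
      beta_reduce
      rw [List.ofFn_succ', List.ofFn_succ, List.concat_eq_append, List.prod_append]
      simp only [rot, Fin.coeSucc_eq_succ, Fin.last_add_one, List.prod_singleton, List.prod_cons, List.prod_nil, mul_one]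
      rw [hτ])]
  have hfix : Finset.univ.filter (fun f => rot f = f) = {fun _ => false, fun _ => true} := by
    ext f
    simp only [Finset.mem_filter, Finset.mem_univ, true_and, Finset.mem_insert, Finset.mem_singleton]
    constructor
    · intro hf
      have hc : ∀ i, f i = f 0 := by
        intro i
        induction i using Fin.induction with
        | zero => rfl
        | succ i ih =>
          rw [← ih, ← Fin.coeSucc_eq_succ]
          exact congrFun hf i.castSucc
      rcases hb : f 0 with _ | _
      · left; funext i; rw [hc, hb]
      · right; funext i; rw [hc, hb]
    · rintro (rfl | rfl) <;> rfl
  rw [hfix, Finset.sum_pair]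
  · simp [m, pow_succ']
  · intro h; simpa using congrFun h 0

section bass
variable {H : Type*} [Group H] {ι : Type*} [Fintype ι] [DecidableEq ι]

/-- class sums -/
noncomputable def cl : ZG H →+ (ConjClasses H →₀ ℤ) :=
  linExt (fun g => Finsupp.single (ConjClasses.mk g) 1)

theorem cl_comm (a b : ZG H) : cl (a * b) = cl (b * a) := by
  induction a using ZG_induction with
  | hg k =>
    induction b using ZG_induction with
    | hg l =>
      rw [← gr_mul, ← gr_mul, cl, linExt_gr, linExt_gr]
      congr 1
      rw [ConjClasses.mk_eq_mk_iff_isConj, isConj_iff]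
      exact ⟨k⁻¹, by group⟩
    | hadd x y hx hy => rw [mul_add, add_mul, map_add, map_add, hx, hy]
    | hneg x hx => rw [mul_neg, neg_mul, map_neg, map_neg, hx]
  | hadd x y hx hy => rw [mul_add, add_mul, map_add, map_add, hx, hy]
  | hneg x hx => rw [mul_neg, neg_mul, map_neg, map_neg, hx]

/-- the Hattori-Stallings trace -/
noncomputable def hs : Matrix ι ι (ZG H) →+ (ConjClasses H →₀ ℤ) where
  toFun M := ∑ i, cl (M i i)
  map_zero' := by simp
  map_add' M N := by simp [Finset.sum_add_distrib]

theorem hs_comm (M N : Matrix ι ι (ZG H)) : hs (M * N) = hs (N * M) := by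
  simp only [hs, AddMonoidHom.coe_mk, ZeroHom.coe_mk, Matrix.mul_apply, map_sum]
  rw [Finset.sum_comm]
  simp only [cl_comm (M _ _)]

theorem mat_hom_ext {V : Type*} [AddCommGroup V] {f f' : Matrix ι ι (ZG H) →+ V}
    (h : ∀ i j g, f (Matrix.single i j (gr g)) = f' (Matrix.single i j (gr g))) : f = f' := by
  ext M
  rw [Matrix.matrix_eq_sum_single M, map_sum, map_sum]
  refine Finset.sum_congr rfl fun i _ => ?_
  rw [map_sum, map_sum]
  refine Finset.sum_congr rfl fun j _ => ?_
  have : f.comp (Matrix.singleAddMonoidHom i j) = f'.comp (Matrix.singleAddMonoidHom i j) := by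
    apply ZG_hom_ext
    intro g
    exact h i j g
  exact DFunLike.congr_fun this (M i j)

open scoped Classical in
/-- evaluation at a class followed by reduction mod `p` -/
noncomputable def evp (p : ℕ) (P : ConjClasses H → Prop) : (ConjClasses H →₀ ℤ) →+ ZMod p :=
  Finsupp.liftAddHom (fun c => if P c then (Int.castAddHom (ZMod p)) else 0)

open scoped Classical in
theorem evp_single (p : ℕ) (P : ConjClasses H → Prop) (c) :
    evp p P (Finsupp.single c 1) = if P c then 1 else 0 := by
  simp only [evp, Finsupp.liftAddHom_apply_single]
  split_ifs <;> simp

theorem hs_single_same (i : ι) (x : ZG H) : hs (Matrix.single i i x) = cl x := by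
  simp only [hs, AddMonoidHom.coe_mk, ZeroHom.coe_mk]
  rw [Finset.sum_eq_single i]
  · simp
  · intro j _ hj; rw [Matrix.single_apply_of_ne]; · simp
    exact fun h => hj h.1.symm
  · simp

theorem hs_single_ne {i j : ι} (hij : i ≠ j) (x : ZG H) : hs (Matrix.single i j x) = 0 := by
  simp only [hs, AddMonoidHom.coe_mk, ZeroHom.coe_mk]
  apply Finset.sum_eq_zero
  intro k _
  rw [Matrix.single_apply_of_ne]
  · simp
  · rintro ⟨rfl, rfl⟩; exact hij rfl

theorem hs_frob {p : ℕ} [hpf : Fact p.Prime] (g0 : H) (M : Matrix ι ι (ZG H)) :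
    evp p (fun c => c = ConjClasses.mk g0) (hs (M ^ p)) =
      evp p (fun c => ∃ g, ConjClasses.mk g = c ∧ ConjClasses.mk (g ^ p) = ConjClasses.mk g0) (hs M) := by
  classical
  let τ : Matrix ι ι (ZG H) →+ ZMod p := (evp p (fun c => c = ConjClasses.mk g0)).comp hs
  let Φ : Matrix ι ι (ZG H) →+ ZMod p := AddMonoidHom.mk' (fun M => τ (M ^ p)) (by
    intro a b
    exact trace_frob (by intro x; simp) τ (by
      intro a b; simp only [τ, AddMonoidHom.comp_apply]; rw [hs_comm]) a b)
  have : Φ = (evp p (fun c => ∃ g, ConjClasses.mk g = c ∧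
      ConjClasses.mk (g ^ p) = ConjClasses.mk g0)).comp hs := by
    apply mat_hom_ext
    intro i j g
    change evp p (fun c => c = ConjClasses.mk g0) (hs ((Matrix.single i j (gr g)) ^ p)) = evp p _ (hs (Matrix.single i j (gr g)))
    by_cases hij : i = j
    · subst hij
      have hpw : ∀ n : ℕ, (Matrix.single i i (gr g)) ^ (n+1) = Matrix.single i i (gr (g^(n+1))) := by
        intro n
        induction n with
        | zero => simp
        | succ n ih => rw [pow_succ, ih, Matrix.single_mul_single_same, ← gr_mul, ← pow_succ]
      obtain ⟨n, hn⟩ : ∃ n, p = n + 1 := ⟨p - 1, by have := hpf.out.pos; omega⟩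
      have : (Matrix.single i i (gr g)) ^ p = Matrix.single i i (gr (g^p)) := by
        have := hpw n; rw [← hn] at this; exact this
      rw [this, hs_single_same, hs_single_same, cl, linExt_gr, linExt_gr, evp_single, evp_single]
      have hiff : (ConjClasses.mk (g ^ p) = ConjClasses.mk g0) ↔
        (∃ g', ConjClasses.mk g' = ConjClasses.mk g ∧ ConjClasses.mk (g' ^ p) = ConjClasses.mk g0) := by
        constructor
        · intro h; exact ⟨g, rfl, h⟩
        · rintro ⟨g', h1, h2⟩
          rw [← h2]
          rw [ConjClasses.mk_eq_mk_iff_isConj] at h1 ⊢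
          exact (h1.pow p).symm
      simp only [hiff]
    · have h0 : (Matrix.single i j (gr g)) ^ p = 0 := by
        obtain ⟨n, hn⟩ : ∃ n, p = n + 2 := ⟨p - 2, by have := hpf.out.two_le; omega⟩
        have : (Matrix.single i j (gr g)) ^ 2 = 0 := by
          rw [pow_two]
          exact Matrix.single_mul_single_of_ne _ _ _ _ (fun h => hij h.symm) _
        rw [hn, pow_add, this, mul_zero]
      rw [h0, hs_single_ne hij, map_zero, map_zero, map_zero]
  exact DFunLike.congr_fun this M

theorem weak_bass (hch : ∀ (g : H), g ≠ 1 → ∀ p : ℕ, 2 ≤ p → ¬ ∀ i : ℕ, ∃ k : H, k ^ (p^i) = g)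
    (q : Matrix ι ι (ZG H)) (hq : q * q = q) :
    ∑ i, (q i i).coeff 1 = ∑ i, aug (q i i) := by
  classical
  set r := hs q with hr
  obtain ⟨p, hp1, hpp⟩ := Nat.exists_infinite_primes (∑ c ∈ r.support, (r c).natAbs + 1)
  haveI : Fact p.Prime := ⟨hpp⟩
  have hqp : q ^ p = q := by
    have : ∀ n : ℕ, q ^ (n+1) = q := by
      intro n
      induction n with
      | zero => simp
      | succ n ih => rw [pow_succ, ih, hq]
    obtain ⟨n, hn⟩ : ∃ n, p = n + 1 := ⟨p - 1, by have := hpp.pos; omega⟩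
    rw [hn]; exact this n
  have hstep : ∀ g, r (ConjClasses.mk g) ≠ 0 → ∃ k, k ^ p = g ∧ r (ConjClasses.mk k) ≠ 0 := by
    intro g hg
    have h1 : evp p (fun c => c = ConjClasses.mk g) r ≠ 0 := by
      have : evp p (fun c => c = ConjClasses.mk g) r = ((r (ConjClasses.mk g) : ℤ) : ZMod p) := by
        simp only [evp, Finsupp.liftAddHom_apply, Finsupp.sum]
        rw [Finset.sum_eq_single (ConjClasses.mk g)]
        · simp
        · intro c _ hc; simp [hc]
        · intro h; simp [Finsupp.notMem_support_iff.1 h]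
      rw [this]
      intro h0
      rw [ZMod.intCast_zmod_eq_zero_iff_dvd] at h0
      have h2 := Int.natAbs_dvd_natAbs.2 h0
      rw [Int.natAbs_natCast] at h2
      have h3 := Nat.le_of_dvd (Int.natAbs_pos.2 hg) h2
      have h4 := Finset.single_le_sum (f := fun c => (r c).natAbs) (fun _ _ => Nat.zero_le _)
        (Finsupp.mem_support_iff.2 hg)
      beta_reduce at h4
      omega
    have h2 := hs_frob (p := p) g q
    rw [hqp, ← hr] at h2
    rw [h2] at h1
    simp only [evp, Finsupp.liftAddHom_apply, Finsupp.sum] at h1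
    obtain ⟨c, hc, hc2⟩ := Finset.exists_ne_zero_of_sum_ne_zero h1
    split_ifs at hc2 with hP
    · obtain ⟨k, rfl, hk⟩ := hP
      rw [ConjClasses.mk_eq_mk_iff_isConj, isConj_iff] at hk
      obtain ⟨x, hx⟩ := hk
      refine ⟨x * k * x⁻¹, by rw [conj_pow, hx], ?_⟩
      have : ConjClasses.mk (x * k * x⁻¹) = ConjClasses.mk k := by
        rw [ConjClasses.mk_eq_mk_iff_isConj]
        exact (isConj_iff.2 ⟨x, rfl⟩).symm
      rw [this]
      exact Finsupp.mem_support_iff.1 hc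
    · simp at hc2
  have hchain : ∀ (i : ℕ) g, r (ConjClasses.mk g) ≠ 0 → ∃ k, k ^ (p^i) = g ∧ r (ConjClasses.mk k) ≠ 0 := by
    intro i
    induction i with
    | zero => intro g hg; exact ⟨g, by simp, hg⟩
    | succ i ih =>
      intro g hg
      obtain ⟨k, hk, hk2⟩ := ih g hg
      obtain ⟨l, hl, hl2⟩ := hstep k hk2
      exact ⟨l, by rw [pow_succ', pow_mul, hl, hk], hl2⟩
  have hvan : ∀ g, g ≠ 1 → r (ConjClasses.mk g) = 0 := by
    intro g hg
    by_contra hne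
    exact hch g hg p hpp.two_le (fun i => by
      obtain ⟨k, hk, _⟩ := hchain i g hne; exact ⟨k, hk⟩)
  -- two functionals
  let tot : (ConjClasses H →₀ ℤ) →+ ℤ := Finsupp.liftAddHom (fun _ => AddMonoidHom.id ℤ)
  have ht : ∀ x : ZG H, tot (cl x) = aug x := by
    intro x
    have : tot.comp cl = aug := by
      apply ZG_hom_ext
      intro g
      rw [AddMonoidHom.comp_apply, cl, linExt_gr, aug_gr]
      simp [tot]
    exact DFunLike.congr_fun this x
  have h1 : ∀ x : ZG H, cl x (ConjClasses.mk 1) = x.coeff 1 := by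
    intro x
    induction x using ZG_induction with
    | hg g =>
      rw [cl, linExt_gr, coeff_gr, Finsupp.single_apply]
      have : (ConjClasses.mk g = ConjClasses.mk 1) ↔ g = 1 := by
        rw [ConjClasses.mk_eq_mk_iff_isConj, isConj_comm, isConj_one_right]
      simp only [this]
    | hadd x y hx hy => rw [map_add, Finsupp.add_apply, hx, hy, MonoidAlgebra.coeff_add, Finsupp.add_apply]
    | hneg x hx => rw [map_neg, Finsupp.neg_apply, hx, MonoidAlgebra.coeff_neg, Finsupp.neg_apply]
  have hr1 : r (ConjClasses.mk 1) = ∑ i, (q i i).coeff 1 := by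
    simp only [hr, hs, AddMonoidHom.coe_mk, ZeroHom.coe_mk, Finsupp.finset_sum_apply, h1]
  have hr2 : tot r = ∑ i, aug (q i i) := by
    simp only [hr, hs, AddMonoidHom.coe_mk, ZeroHom.coe_mk, map_sum, ht]
  rw [← hr1, ← hr2]
  simp only [tot, Finsupp.liftAddHom_apply, Finsupp.sum, AddMonoidHom.id_apply]
  rw [Finset.sum_eq_single (ConjClasses.mk 1)]
  · intro c _ hc
    obtain ⟨g, rfl⟩ := ConjClasses.mk_surjective c
    exact hvan g (fun h => hc (by rw [h]))
  · intro h; exact Finsupp.notMem_support_iff.1 h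

end bass

/-! ### The dichotomy for two-generated subgroups -/

section dich
variable {H : Type*} [Group H]

theorem lemmaK1 {u v : H} (q : Matrix (Fin 2) (Fin 2) (ZG H)) (hq : q * q = q)
    (hq0 : pairA u v (q 0) = gr u - 1) (hq1 : pairA u v (q 1) = gr v - 1)
    (htr : ∑ i, (q i i).coeff 1 = 1)
    {χ : H → ℤ} (hχ : IsChar χ) {k : H} (hk : χ k = 1) (w : Fin 2 → ZG H)
    (hwq : Matrix.vecMul w q = w) (hw : pairA u v w = 1 - gr k) (i j : Fin 2) (g : H) :
    ∃ N0, ∀ N ≥ N0, ∑ l ∈ Finset.range N,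
      ((gr (![u, v] i) - 1) * (gr (k ^ l) * w j)).coeff g = (q i j).coeff g := by
  let J : Matrix (Fin 2) (Fin 2) (ZG H) := !![gr u - 1, 0; gr v - 1, 0]
  let T : Matrix (Fin 2) (Fin 2) (ZG H) := !![gr k, 0; 0, 0]
  let V : Matrix (Fin 2) (Fin 2) (ZG H) := !![w 0, w 1; 0, 0]
  let r : Matrix (Fin 2) (Fin 2) (ZG H) := !![1, 0; 0, 0]
  have hw0 := congrFun hwq 0
  have hw1 := congrFun hwq 1
  simp only [Matrix.vecMul, dotProduct, Fin.sum_univ_two] at hw0 hw1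
  simp only [pairA] at hq0 hq1 hw
  have hqe : q = !![q 0 0, q 0 1; q 1 0, q 1 1] := Matrix.eta_fin_two q
  have h := lemmaK hχ J T V q r hq (by
      rw [hqe]; simp only [J, Matrix.mul_fin_two, mul_zero, add_zero]
      rw [hq0, hq1]) (by
      rw [hqe]; simp only [V, Matrix.mul_fin_two, zero_mul, add_zero]
      rw [hw0, hw1]) (by
      simp only [V, r, Matrix.mul_fin_two, one_mul, zero_mul, mul_zero, add_zero]) (by
      simp only [T, r, Matrix.mul_fin_two, one_mul, zero_mul, mul_zero, add_zero])
      (by simp only [T, r, Matrix.mul_fin_two, mul_one, zero_mul, mul_zero, add_zero]) (by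
      simp only [V, J, r, T, Matrix.mul_fin_two, zero_mul, mul_zero, add_zero]
      rw [hw]
      ext a b : 1
      fin_cases a <;> fin_cases b <;> simp) (by
      intro a b
      fin_cases a <;> fin_cases b
      · have := SuppGE.gr (χ := χ) k
        rw [hk] at this
        exact this
      · exact SuppGE.zero _
      · exact SuppGE.zero _
      · exact SuppGE.zero _) (by
      rw [htr, Fin.sum_univ_two]
      simp only [r]
      simp [MonoidAlgebra.one_def]) i j g
  have hTp : ∀ l : ℕ, J * T ^ l = !![(gr u - 1) * gr (k^l), 0; (gr v - 1) * gr (k^l), 0] := by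
    intro l
    induction l with
    | zero => simp [J, gr_one]
    | succ l ih =>
      rw [pow_succ, ← mul_assoc, ih, pow_succ, gr_mul]
      simp [T, Matrix.mul_fin_two, mul_assoc]
  have e : ∀ l : ℕ, (J * T ^ l * V) i j = (gr (![u, v] i) - 1) * (gr (k ^ l) * w j) := by
    intro l
    rw [hTp]
    simp only [V, Matrix.mul_fin_two]
    fin_cases i <;> fin_cases j <;> simp [mul_assoc]
  simp only [e] at h
  exact h

theorem cs_limit {h : H} (hinf : Function.Injective (fun m : ℤ => h ^ m)) (f : ZG H) (x : H) :
    ∀ᶠ N : ℕ in atTop, ∑ l ∈ Finset.range N, ((gr (h ^ l) * f).coeff x + (gr (h⁻¹ ^ l) * (gr h⁻¹ * f)).coeff x)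
      = cs h f (Quotient.mk _ x) := by
  classical
  induction f using ZG_induction with
  | hg y =>
    rw [cs, linExt_gr, Finsupp.single_apply]
    have e1 : ∀ l : ℕ, (gr (h ^ l) * gr y).coeff x = if h ^ (l : ℤ) * y = x then 1 else 0 := by
      intro l
      rw [← gr_mul, coeff_gr, zpow_natCast]
    have e2 : ∀ l : ℕ, (gr (h⁻¹ ^ l) * (gr h⁻¹ * gr y)).coeff x = if h ^ (-(l : ℤ) - 1) * y = x then 1 else 0 := by
      intro l
      rw [← gr_mul, ← gr_mul, coeff_gr, ← mul_assoc]
      have : h⁻¹ ^ l * h⁻¹ = h ^ (-(l : ℤ) - 1) := by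
        rw [zpow_sub_one, zpow_neg, zpow_natCast, inv_pow]
      rw [this]
    simp only [e1, e2]
    by_cases hm : ∃ m : ℤ, x = h ^ m * y
    · rw [if_pos (cq_eq.2 hm)]
      obtain ⟨m, rfl⟩ := hm
      have e3 : ∀ n : ℤ, (h ^ n * y = h ^ m * y) ↔ n = m := by
        intro n
        rw [mul_left_inj]; exact hinf.eq_iff
      simp only [e3]
      filter_upwards [eventually_gt_atTop m.natAbs] with N hN
      rw [Finset.sum_add_distrib]
      rcases le_or_gt 0 m with h0 | h0
      · obtain ⟨n, rfl⟩ := Int.eq_ofNat_of_zero_le h0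
        rw [Finset.sum_eq_single n, Finset.sum_eq_zero]
        · simp
        · intro l _; rw [if_neg]; omega
        · intro l _ hl; rw [if_neg]; omega
        · intro hn; rw [Finset.mem_range] at hn; omega
      · obtain ⟨n, hn⟩ : ∃ n : ℕ, m = -(n:ℤ) - 1 := ⟨(-m-1).toNat, by omega⟩
        subst hn
        rw [Finset.sum_eq_zero, Finset.sum_eq_single n]
        · simp
        · intro l _ hl; rw [if_neg]; omega
        · intro hn; rw [Finset.mem_range] at hn; omega
        · intro l _; rw [if_neg]; omega
    · rw [if_neg (fun hh => hm (cq_eq.1 hh))]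
      refine Eventually.of_forall fun N => Finset.sum_eq_zero fun l _ => ?_
      rw [if_neg (fun hh => hm ⟨_, hh.symm⟩), if_neg (fun hh => hm ⟨_, hh.symm⟩), add_zero]
  | hadd y z hy hz =>
    filter_upwards [hy, hz] with N h1 h2
    rw [map_add, Finsupp.add_apply, ← h1, ← h2, ← Finset.sum_add_distrib]
    refine Finset.sum_congr rfl fun l _ => ?_
    simp only [mul_add, MonoidAlgebra.coeff_add, Finsupp.add_apply]
    ring
  | hneg y hy =>
    filter_upwards [hy] with N h1
    rw [map_neg, Finsupp.neg_apply, ← h1, ← Finset.sum_neg_distrib]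
    refine Finset.sum_congr rfl fun l _ => ?_
    simp only [mul_neg, MonoidAlgebra.coeff_neg, Finsupp.neg_apply]
    ring

theorem free_of_ident {u v : H} {d : H → Fin 2 → ZG H}
    (hd : ∀ h h', d (h*h') = d h + gr h • d h') (hu : d u = ![1, 0]) (hv : d v = ![0, 1]) :
    FreePair u v := by
  classical
  have d1 : d 1 = 0 := der_one hd
  let m : Bool → H := fun b => cond b v u
  let π : List Bool → H := fun l => (l.map m).prod
  have hπ : ∀ b l, π (b :: l) = m b * π l := fun b l => by simp [π]
  have hnt : ∀ l, π l = 1 → l = [] := by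
    have key : ∀ l, aug (d (π l) 0) + aug (d (π l) 1) = l.length := by
      intro l
      induction l with
      | nil => simp [π, d1]
      | cons b l ih =>
        rw [hπ, hd, List.length_cons]
        push_cast
        rw [← ih]
        cases b <;> simp [m, hu, hv, aug_mul, aug_gr, aug_one] <;> ring
    intro l hl
    have := key l
    rw [hl, d1] at this
    simp at this
    exact List.length_eq_zero_iff.1 (by omega)
  have hco : ∀ l x, 0 ≤ (d (π l) 0).coeff x ∧ ((d (π l) 0).coeff x ≠ 0 → ∃ l', x = π l') := by
    intro l
    induction l with
    | nil => intro x; simp [π, d1]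
    | cons b l ih =>
      intro x
      obtain ⟨i1, i2⟩ := ih ((m b)⁻¹ * x)
      rw [hπ, hd, Pi.add_apply, Pi.smul_apply, smul_eq_mul, MonoidAlgebra.coeff_add, Finsupp.add_apply,
        coeff_gr_mul]
      have hb : 0 ≤ (d (m b) 0).coeff x ∧ ((d (m b) 0).coeff x ≠ 0 → x = 1) := by
        cases b
        · simp only [m, cond_false, hu, Matrix.cons_val_zero]
          rw [← gr_one, coeff_gr]
          constructor
          · split_ifs <;> simp
          · intro h; by_contra hx; rw [if_neg (fun e => hx e.symm)] at h; exact h rfl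
        · simp [m, hv]
      refine ⟨add_nonneg hb.1 i1, fun hne => ?_⟩
      by_cases hz : (d (m b) 0).coeff x = 0
      · rw [hz, zero_add] at hne
        obtain ⟨l', hl'⟩ := i2 hne
        exact ⟨b :: l', by rw [hπ, ← hl', mul_inv_cancel_left]⟩
      · exact ⟨[], by rw [hb.2 hz]; rfl⟩
  have hno : ∀ l l', u * π l ≠ v * π l' := by
    intro l l' he
    have h1 := congrArg (fun y => (d y 0).coeff 1) he
    beta_reduce at h1
    rw [hd, hd, hu, hv] at h1
    simp only [Pi.add_apply, Pi.smul_apply, smul_eq_mul, MonoidAlgebra.coeff_add, Finsupp.add_apply,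
        coeff_gr_mul, Matrix.cons_val_zero, mul_one] at h1
    rw [← gr_one, coeff_gr, if_pos rfl] at h1
    simp only [MonoidAlgebra.coeff_zero, Finsupp.zero_apply, zero_add] at h1
    have h2 := (hco l u⁻¹).1
    obtain ⟨l2, hl2⟩ := (hco l' v⁻¹).2 (by omega)
    have := hnt (true :: l2) (by rw [hπ, ← hl2]; simp [m])
    simp at this
  intro l
  change ∀ l', π l = π l' → l = l'
  induction l with
  | nil =>
    intro l' h
    exact (hnt l' (by rw [← h]; rfl)).symm
  | cons b l ih =>
    intro l' h
    cases l' with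
    | nil => exact hnt _ h
    | cons b' l' =>
      rw [hπ, hπ] at h
      cases b <;> cases b'
      · rw [ih l' (mul_left_cancel h)]
      · exact absurd h (hno _ _)
      · exact absurd h.symm (hno _ _)
      · rw [ih l' (mul_left_cancel h)]

theorem dichotomy {u v : H} (hgen : Subgroup.closure {u, v} = ⊤) {d : H → Fin 2 → ZG H}
    (hd : ∀ h h', d (h*h') = d h + gr h • d h') (hp : ∀ h, pairA u v (d h) = gr h - 1) :
    FreePair u v ∨ ∃ h : H, ∀ x, ∃ m : ℤ, x = h ^ m := by
  classical
  have d1 : d 1 = 0 := der_one hd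
  let q : Matrix (Fin 2) (Fin 2) (ZG H) := ![d u, d v]
  have hq0 : q 0 = d u := rfl
  have hq1 : q 1 = d v := rfl
  have hs : ∀ (x : ZG H) (h : H), linExt d (x * (gr h - 1)) = x • d h := by
    intro a h
    induction a using ZG_induction with
    | hg k =>
      rw [mul_sub, mul_one, ← gr_mul, map_sub, linExt_gr, linExt_gr, hd]
      simp
    | hadd x y hx hy =>
      rw [add_mul, map_add, hx, hy, add_smul]
    | hneg x hx =>
      rw [neg_mul, map_neg, hx, neg_smul]
  have hsw : ∀ w, linExt d (pairA u v w) = Matrix.vecMul w q := by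
    intro w
    rw [pairA, map_add, hs, hs]
    funext j
    simp [Matrix.vecMul, dotProduct, Fin.sum_univ_two, hq0, hq1]
  have hdq : ∀ h, Matrix.vecMul (d h) q = d h := by
    intro h
    rw [← hsw, hp, map_sub, linExt_gr, ← gr_one, linExt_gr, d1, sub_zero]
  have hqq : q * q = q := by
    funext i
    rw [Matrix.mul_apply_eq_vecMul]
    fin_cases i
    · exact hdq u
    · exact hdq v
  have hbass : ∑ i, (q i i).coeff 1 = ∑ i, aug (q i i) :=
    weak_bass (fun g hg p hp2 hch => no_chain hd hp hg hp2 hch) q hqq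
  have htr : ∑ i, aug (q i i) = 0 ∨ ∑ i, aug (q i i) = 1 ∨ ∑ i, aug (q i i) = 2 := by
    have hm : ∀ i j, aug (q i 0) * aug (q 0 j) + aug (q i 1) * aug (q 1 j) = aug (q i j) := by
      intro i j
      conv_rhs => rw [← hqq]
      rw [Matrix.mul_apply, Fin.sum_univ_two, map_add, aug_mul, aug_mul]
    have a00 := hm 0 0
    have a01 := hm 0 1
    have a10 := hm 1 0
    have a11 := hm 1 1
    rw [Fin.sum_univ_two]
    generalize aug (q 0 0) = a at *
    generalize aug (q 0 1) = b at *
    generalize aug (q 1 0) = c at *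
    generalize aug (q 1 1) = e at *
    by_cases h1 : a + e = 1
    · exact Or.inr (Or.inl h1)
    · have hb : b = 0 := by
        have : b * (a + e - 1) = 0 := by linarith
        rcases mul_eq_zero.1 this with h | h
        · exact h
        · omega
      have hx : ∀ y : ℤ, y * y = y → y = 0 ∨ y = 1 := by
        intro y hy
        have : y * (y - 1) = 0 := by linarith
        rcases mul_eq_zero.1 this with h | h
        · exact Or.inl h
        · right; omega
      have ha := hx a (by rw [hb] at a00; linarith)
      have he := hx e (by rw [hb] at a11; linarith)
      omega
  have grinj : ∀ x : H, (gr x : ZG H) = 1 → x = 1 := by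
    intro x hx
    by_contra hne
    have := congrArg (fun y : ZG H => y.coeff 1) hx
    beta_reduce at this
    rw [← gr_one, coeff_gr, coeff_gr, if_neg hne, if_pos rfl] at this
    omega
  rcases htr with h0 | h1 | h2
  · right
    have hq := idem_tr_zero q hqq (by rw [hbass, h0])
    have hu : u = 1 := by
      apply grinj
      have := hp u
      rw [← hq0, hq] at this
      exact sub_eq_zero.1 (this.symm.trans (by simp [pairA]))
    have hv : v = 1 := by
      apply grinj
      have := hp v
      rw [← hq1, hq] at this
      exact sub_eq_zero.1 (this.symm.trans (by simp [pairA]))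
    refine ⟨1, fun x => ⟨0, ?_⟩⟩
    have hx : x ∈ Subgroup.closure {u, v} := by rw [hgen]; trivial
    rw [hu, hv, Set.pair_eq_singleton, Subgroup.closure_singleton_one] at hx
    simpa using hx
  · right
    have hchar : ∀ j, IsChar (fun x => aug (d x j)) := by
      intro j a b
      beta_reduce
      rw [hd, Pi.add_apply, Pi.smul_apply, smul_eq_mul, map_add, aug_mul, aug_gr, one_mul]
    obtain ⟨χ, hχ, ⟨h, hh⟩⟩ : ∃ χ : H → ℤ, IsChar χ ∧ ∃ t, χ t = 1 := by
      rw [Fin.sum_univ_two] at h1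
      by_cases ha : aug (q 0 0) = 0
      · obtain ⟨χ, a, b, _⟩ := (hchar 1).exists_surj ⟨v, by
          beta_reduce; rw [← hq1]; omega⟩
        exact ⟨χ, a, b⟩
      · obtain ⟨χ, a, b, _⟩ := (hchar 0).exists_surj ⟨u, by
          beta_reduce; rw [← hq0]; omega⟩
        exact ⟨χ, a, b⟩
    have hχz : ∀ m : ℤ, χ (h ^ m) = m := by
      intro m; rw [hχ.zpow, hh, mul_one]
    have hinf : Function.Injective (fun m : ℤ => h ^ m) := by
      intro a b hab
      have := congrArg χ hab
      beta_reduce at this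
      rwa [hχz, hχz] at this
    have hne : h ≠ 1 := by
      rintro rfl
      rw [hχ.one] at hh; omega
    have hinv : ∀ i j x, cs h (d h j) (Quotient.mk _ ((![u,v] i)⁻¹ * x)) = cs h (d h j) (Quotient.mk _ x) := by
      intro i j x
      obtain ⟨N1, hN1⟩ := lemmaK1 q hqq (hp u) (hp v) (by rw [hbass, h1]) hχ hh (-(d h))
        (by rw [Matrix.neg_vecMul, hdq]) (by rw [pairA_neg, hp]; abel) i j x
      obtain ⟨N2, hN2⟩ := lemmaK1 q hqq (hp u) (hp v) (by rw [hbass, h1]) hχ.neg (k := h⁻¹)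
        (by simp [hχ.inv, hh]) (gr h⁻¹ • (d h))
        (by rw [Matrix.smul_vecMul, hdq]) (by rw [pairA_smul, hp, mul_sub, gr_inv_mul, mul_one]) i j x
      obtain ⟨N, hN⟩ := (((eventually_ge_atTop N1).and (eventually_ge_atTop N2)).and
        ((cs_limit hinf (d h j) ((![u,v] i)⁻¹ * x)).and (cs_limit hinf (d h j) x))).exists
      obtain ⟨⟨a1, a2⟩, a3, a4⟩ := hN
      have b1 := hN1 N a1
      have b2 := hN2 N a2
      rw [← b1] at b2
      rw [← a3, ← a4, ← sub_eq_zero, ← Finset.sum_sub_distrib]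
      rw [← sub_eq_zero, ← Finset.sum_sub_distrib] at b2
      rw [← b2]
      refine Finset.sum_congr rfl fun l _ => ?_
      simp only [Pi.neg_apply, Pi.smul_apply, smul_eq_mul, mul_neg, sub_mul, one_mul,
        MonoidAlgebra.coeff_sub, MonoidAlgebra.coeff_neg, Finsupp.neg_apply, Finsupp.sub_apply]
      rw [coeff_gr_mul (![u,v] i), coeff_gr_mul (![u,v] i)]
      ring
    have hinv2 : ∀ y j x, cs h (d h j) (Quotient.mk _ (y * x)) = cs h (d h j) (Quotient.mk _ x) := by
      intro y j
      have hy : y ∈ Subgroup.closure {u, v} := by rw [hgen]; trivial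
      induction hy using Subgroup.closure_induction with
      | mem y hy =>
        intro x
        rcases hy with rfl | rfl
        · have := hinv 0 j (y * x)
          simpa using this.symm
        · have := hinv 1 j (y * x)
          simpa using this.symm
      | one => intro x; rw [one_mul]
      | mul y z _ _ hy hz => intro x; rw [mul_assoc, hy, hz]
      | inv y _ hy => intro x; rw [← hy (y⁻¹ * x), mul_inv_cancel_left]
    obtain ⟨j, hj⟩ := notdiv_cs hp hne
    obtain ⟨c, hc⟩ : ∃ c, cs h (d h j) c ≠ 0 := by
      by_contra hcon
      push Not at hcon
      exact hj (Finsupp.ext hcon)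
    obtain ⟨x0, rfl⟩ := Quotient.exists_rep c
    have hall : ∀ c, c ∈ (cs h (d h j)).support := by
      intro c
      obtain ⟨y, rfl⟩ := Quotient.exists_rep c
      rw [Finsupp.mem_support_iff]
      have := hinv2 (y * x0⁻¹) j x0
      rw [inv_mul_cancel_right] at this
      rw [this]; exact hc
    haveI : Finite (CQ h) := by
      apply Set.finite_univ_iff.1
      exact (cs h (d h j)).support.finite_toSet.subset (fun c _ => hall c)
    have hker : ∀ k, χ k = 0 → k = 1 := by
      intro k hk
      obtain ⟨a, b, hab, e⟩ := Finite.exists_ne_map_eq_of_infinite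
        (fun n : ℕ => (Quotient.mk _ (k ^ n) : CQ h))
      obtain ⟨m, hm⟩ := cq_eq.1 e
      have e2 := congrArg χ hm
      rw [hχ, hχ.npow, hχ.npow, hχz, hk] at e2
      have hm0 : m = 0 := by simpa using e2.symm
      rw [hm0, zpow_zero, one_mul] at hm
      rcases lt_or_gt_of_ne hab with hl | hl
      · apply der_torsionfree hd hp (m := b - a) (by omega)
        rw [pow_sub _ hl.le, hm, mul_inv_cancel]
      · apply der_torsionfree hd hp (m := a - b) (by omega)
        rw [pow_sub _ hl.le, hm, mul_inv_cancel]
    refine ⟨h, fun x => ⟨χ x, ?_⟩⟩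
    have := hker (x * (h ^ χ x)⁻¹) (by rw [hχ, hχ.inv, hχz]; ring)
    exact mul_inv_eq_one.1 this
  · left
    have hq : 1 - q = 0 := by
      apply idem_tr_zero
      · rw [sub_mul, mul_sub, mul_sub, hqq]; simp
      · have : ∀ i, ((1 - q) i i).coeff 1 = 1 - (q i i).coeff 1 := by
          intro i
          simp [MonoidAlgebra.one_def, MonoidAlgebra.coeff_sub]
        simp only [this, Finset.sum_sub_distrib]
        rw [hbass, h2]; simp
    have hq' : q = 1 := (sub_eq_zero.1 hq).symm
    apply free_of_ident hd
    · rw [← hq0, hq']; funext j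
      fin_cases j
      · exact Matrix.one_apply_eq 0
      · exact Matrix.one_apply_ne (by decide)
    · rw [← hq1, hq']; funext j
      fin_cases j
      · exact Matrix.one_apply_ne (by decide)
      · exact Matrix.one_apply_eq 1

end dich

/-! ### Group theoretic conclusion -/

theorem dich_G {G : Type*} [Group G] {n : ℕ}
    (rels : Finset (FreeGroup (Fin n))) (hcard : rels.card + 1 = n)
    (e : G ≃* PresentedGroup (rels : Set (FreeGroup (Fin n))))
    {χ : G → ℤ} (hχ : IsChar χ) {t : G} (ht : χ t = 1) (hfg : hχ.ker.FG) (u v : G)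
    (hu : χ u = 0) (hv : χ v = 0) :
    (FreePair u v ∨ ∃ h, χ h = 0 ∧ ∃ i j : ℤ, u = h ^ i ∧ v = h ^ j) ∧
    (∀ m : ℕ, m ≠ 0 → u ^ m = 1 → u = 1) := by
  set H : Subgroup G := Subgroup.closure {u, v} with hHd
  have hH : ∀ h ∈ H, χ h = 0 := by
    have : H ≤ hχ.ker := by
      rw [hHd, Subgroup.closure_le]
      rintro x (rfl | rfl)
      · exact hu
      · exact hv
    intro h hh; exact this hh
  let u' : H := ⟨u, Subgroup.subset_closure (by simp)⟩
  let v' : H := ⟨v, Subgroup.subset_closure (by simp)⟩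
  have hgen : Subgroup.closure {u', v'} = ⊤ := by
    rw [← Subgroup.closure_closure_coe_preimage (k := {u, v})]
    congr 1
    ext x
    simp only [Set.mem_insert_iff, Set.mem_singleton_iff, Set.mem_preimage, u', v', Subtype.ext_iff]
  obtain ⟨d, hd, hp⟩ := exists_der rels hcard e hχ ht hfg H hH u' v' hgen
  constructor
  · rcases dichotomy hgen hd hp with h | ⟨h, hh⟩
    · left
      intro l l' hl
      apply h
      apply Subtype.ext
      beta_reduce at hl ⊢
      have key : ∀ l : List Bool, (((l.map (fun b => cond b v' u')).prod : H) : G) =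
          (l.map (fun b => cond b v u)).prod := by
        intro l
        induction l with
        | nil => simp
        | cons b l ih =>
          rw [List.map_cons, List.prod_cons, List.map_cons, List.prod_cons, Subgroup.coe_mul, ih]
          cases b <;> rfl
      rw [key, key]; exact hl
    · right
      obtain ⟨i, hi⟩ := hh u'
      obtain ⟨j, hj⟩ := hh v'
      refine ⟨h, hH h h.2, i, j, ?_, ?_⟩
      · have := congrArg Subtype.val hi
        simpa [u'] using this
      · have := congrArg Subtype.val hj
        simpa [v'] using this
  · intro m hm h
    have : u' ^ m = 1 := Subtype.ext (by simpa [u'] using h)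
    have := der_torsionfree hd hp hm this
    simpa [u'] using congrArg Subtype.val this

section fin
variable {G : Type*} [Group G]

theorem FreePair.ne {a c : G} (hf : FreePair a c) {l l' : List Bool} (hl : l ≠ l') :
    (l.map (fun b => cond b c a)).prod ≠ (l'.map (fun b => cond b c a)).prod :=
  fun h => hl (hf h)

theorem FreePair.not_rel {a c : G} (hf : FreePair a c) {i : ℕ} (hi : 0 < i) (j : ℤ) :
    a ^ i * c ≠ c * a ^ j := by
  obtain ⟨n, rfl⟩ : ∃ n, i = n + 1 := ⟨i - 1, by omega⟩
  rcases le_or_gt 0 j with h0 | h0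
  · obtain ⟨m, rfl⟩ := Int.eq_ofNat_of_zero_le h0
    have := hf.ne (l := List.replicate (n+1) false ++ [true]) (l' := true :: List.replicate m false)
      (by simp [List.replicate_succ])
    simpa using this
  · obtain ⟨m, rfl⟩ : ∃ m : ℕ, j = -m := ⟨(-j).toNat, by omega⟩
    have := hf.ne (l := List.replicate (n+1) false ++ true :: List.replicate m false) (l' := [true])
      (by simp [List.replicate_succ])
    intro h
    apply this
    simp only [List.map_append, List.map_cons, List.map_replicate, List.prod_append, List.prod_cons,
      List.prod_replicate, cond_false, cond_true, List.map_nil, List.prod_nil, mul_one]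
    rw [← mul_assoc, h, zpow_neg, zpow_natCast, inv_mul_cancel_right]

theorem FreePair.not_rel_int {a c : G} (hf : FreePair a c) {i : ℤ} (hi : i ≠ 0) (j : ℤ) :
    a ^ i * c ≠ c * a ^ j := by
  intro h
  rcases lt_or_gt_of_ne hi with h0 | h0
  · obtain ⟨n, rfl⟩ : ∃ n : ℕ, i = -n := ⟨(-i).toNat, by omega⟩
    refine hf.not_rel (i := n) (by omega) (-j) ?_
    rw [zpow_neg, zpow_natCast] at h
    have : c = a ^ n * (c * a ^ j) := by rw [← h, mul_inv_cancel_left]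
    rw [zpow_neg, eq_mul_inv_iff_mul_eq, mul_assoc]
    exact this.symm
  · obtain ⟨n, rfl⟩ := Int.eq_ofNat_of_zero_le h0.le
    refine hf.not_rel (i := n) (by omega) j ?_
    simpa using h

variable {χ : G → ℤ} (hχ : IsChar χ)
  (D : ∀ u v, χ u = 0 → χ v = 0 → FreePair u v ∨ ∃ h, χ h = 0 ∧ ∃ i j : ℤ, u = h ^ i ∧ v = h ^ j)
include D

theorem comm_of_not_free {a c : G} (ha : χ a = 0) (hc : χ c = 0) (h : ¬ FreePair a c) : Commute a c := by
  rcases D a c ha hc with h' | ⟨k, _, i, j, rfl, rfl⟩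
  · exact absurd h' h
  · exact ((Commute.refl k).zpow_left i).zpow_right j

theorem comm_of_zpow {a c : G} (ha : χ a = 0) (hc : χ c = 0) {P : ℤ} (hP : P ≠ 0)
    (h : Commute (a ^ P) c) : Commute a c := by
  apply comm_of_not_free D ha hc
  intro hf
  exact hf.not_rel_int hP P h.eq

omit D in
theorem not_free_of_comm {a c : G} (h : Commute a c) : ¬ FreePair a c := by
  intro hf
  refine hf.not_rel_int one_ne_zero 1 ?_
  rw [zpow_one]; exact h.eq

theorem cyc_of_comm {a c : G} (ha : χ a = 0) (hc : χ c = 0) (h : Commute a c) :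
    ∃ h, χ h = 0 ∧ ∃ i j : ℤ, a = h ^ i ∧ c = h ^ j := by
  rcases D a c ha hc with h' | h'
  · exact absurd h' (not_free_of_comm h)
  · exact h'

theorem comm_trans {a b c : G} (ha : χ a = 0) (hb : χ b = 0) (hc : χ c = 0) (hb1 : b ≠ 1)
    (h1 : Commute a b) (h2 : Commute b c) : Commute a c := by
  obtain ⟨k, hk, i, j, rfl, rfl⟩ := cyc_of_comm D ha hb h1
  have hj : j ≠ 0 := by rintro rfl; simp at hb1
  exact (comm_of_zpow D hk hc hj h2).zpow_left i

include hχ in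
theorem comm_conj {m k : G} (hm : χ m = 0) (hk : χ k = 0) (hm1 : m ≠ 1)
    (h : Commute m (k⁻¹ * m * k)) : Commute m k := by
  obtain ⟨w, hw, i, j, h1, h2⟩ := cyc_of_comm D hm (by rw [hχ, hχ, hχ.inv, hm, hk]; rfl) h
  have hi : i ≠ 0 := by rintro rfl; simp at h1; exact hm1 h1
  apply comm_of_not_free D hm hk
  intro hf
  refine hf.not_rel_int hi j ?_
  have e1 : (k⁻¹ * m * k) ^ i = m ^ j := by
    rw [h2]
    conv_rhs => rw [h1]
    rw [← zpow_mul, ← zpow_mul, mul_comm]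
  have e2 : (k⁻¹ * m * k) ^ i = k⁻¹ * m ^ i * k := by
    have := conj_zpow (a := k⁻¹) (b := m) (i := i)
    rwa [inv_inv] at this
  rw [e2] at e1
  rw [← e1]; group

include hχ in
theorem ker_comm {S : Finset G} (hS : Subgroup.closure (S : Set G) = ⊤)
    (hnf : ∀ u ∈ wordBall S 4, ∀ v ∈ wordBall S 4, ¬ FreePair u v) :
    ∀ a b, χ a = 0 → χ b = 0 → Commute a b := by
  have E : ∀ a b, χ a = 0 → χ b = 0 → a ∈ wordBall S 4 → b ∈ wordBall S 4 → Commute a b :=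
    fun a b ha hb ha' hb' => comm_of_not_free D ha hb (hnf a ha' b hb')
  have w4 : ∀ a b c d : G, a ∈ wordBall S 1 → b ∈ wordBall S 1 → c ∈ wordBall S 1 → d ∈ wordBall S 1 →
      a * b * c * d ∈ wordBall S 4 := fun a b c d ha hb hc hd =>
    mul_mem_wordBall (mul_mem_wordBall (mul_mem_wordBall ha hb) hc) hd
  have P := fun (s : G) (hs : s ∈ S) => mem_wordBall_one hs
  have I := fun (s : G) (hs : s ∈ S) => inv_mem_wordBall_one hs
  have hχc : ∀ s s', χ (s * s' * s⁻¹ * s'⁻¹) = 0 := by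
    intro s s'; rw [hχ, hχ, hχ, hχ.inv, hχ.inv]; ring
  have hχj : ∀ s g, χ g = 0 → χ (s⁻¹ * g * s) = 0 := by
    intro s g hg; rw [hχ, hχ, hχ.inv, hg]; ring
  by_cases hab : ∀ s ∈ S, ∀ s' ∈ S, s * s' * s⁻¹ * s'⁻¹ = 1
  · have hc : ∀ s ∈ S, ∀ s' ∈ S, s * s' = s' * s := by
      intro s hs s' hs'
      have := hab s hs s' hs'
      rw [mul_assoc, ← mul_inv_rev] at this
      exact mul_inv_eq_one.1 this
    intro a b ha0 hb0
    clear ha0 hb0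
    have h1 : ∀ s ∈ S, ∀ b : G, Commute s b := by
      intro s hs b
      have hb : b ∈ Subgroup.closure (S : Set G) := by rw [hS]; trivial
      induction hb using Subgroup.closure_induction with
      | mem x hx => exact hc s hs x hx
      | one => exact Commute.one_right s
      | mul x y _ _ hx hy => exact hx.mul_right hy
      | inv x _ hx => exact hx.inv_right
    have ha : a ∈ Subgroup.closure (S : Set G) := by rw [hS]; trivial
    induction ha using Subgroup.closure_induction with
    | mem x hx => exact h1 x hx b
    | one => exact Commute.one_left b
    | mul x y _ _ hx hy => exact hx.mul_left hy
    | inv x _ hx => exact hx.inv_left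
  · push Not at hab
    obtain ⟨s, hs, s', hs', hy⟩ := hab
    set y := s * s' * s⁻¹ * s'⁻¹ with hyd
    have hy0 : χ y = 0 := hχc s s'
    have hyw : y ∈ wordBall S 4 := w4 _ _ _ _ (P s hs) (P s' hs') (I s hs) (I s' hs')
    have claim : ∀ x ∈ S, ∃ y', y' ≠ 1 ∧ χ y' = 0 ∧ Commute y' y ∧ Commute (x⁻¹ * y' * x) y := by
      have gen : ∀ x ∈ S, ∀ z ∈ S, x * z * x⁻¹ * z⁻¹ ≠ 1 →
          ∃ y', y' ≠ 1 ∧ χ y' = 0 ∧ Commute y' y ∧ Commute (x⁻¹ * y' * x) y := by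
        intro x hx z hz hne
        refine ⟨_, hne, hχc x z, E _ _ (hχc x z) hy0 (w4 _ _ _ _ (P x hx) (P z hz) (I x hx) (I z hz)) hyw, ?_⟩
        apply E _ _ (hχj x _ (hχc x z)) hy0 _ hyw
        have : x⁻¹ * (x * z * x⁻¹ * z⁻¹) * x = z * x⁻¹ * z⁻¹ * x := by group
        rw [this]
        exact w4 _ _ _ _ (P z hz) (I x hx) (I z hz) (P x hx)
      intro x hx
      by_cases h1 : x * s * x⁻¹ * s⁻¹ = 1
      · by_cases h2 : x * s' * x⁻¹ * s'⁻¹ = 1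
        · have c1 : Commute x s := by
            rw [mul_assoc, ← mul_inv_rev] at h1; exact mul_inv_eq_one.1 h1
          have c2 : Commute x s' := by
            rw [mul_assoc, ← mul_inv_rev] at h2; exact mul_inv_eq_one.1 h2
          have c3 : Commute x y := ((c1.mul_right c2).mul_right c1.inv_right).mul_right c2.inv_right
          refine ⟨y, hy, hy0, Commute.refl y, ?_⟩
          rw [mul_assoc, ← c3.eq, inv_mul_cancel_left]
        · exact gen x hx s' hs' h2
      · exact gen x hx s hs h1
    let M : Subgroup G := hχ.ker ⊓ Subgroup.centralizer {y}
    have hM : ∀ g, g ∈ M ↔ χ g = 0 ∧ Commute g y := by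
      intro g
      rw [Subgroup.mem_inf, Subgroup.mem_centralizer_singleton_iff]
      rfl
    have hN : Subgroup.normalizer (M : Set G) = ⊤ := by
      rw [eq_top_iff, ← hS, Subgroup.closure_le]
      intro x hx
      obtain ⟨y', h1, h2, h3, h4⟩ := claim x hx
      have h2' := hχj x y' h2
      have h1' : x⁻¹ * y' * x ≠ 1 := by
        intro h
        apply h1
        have : y' = x * (x⁻¹ * y' * x) * x⁻¹ := by group
        rw [this, h]; group
      have hA : ∀ g, g ∈ M → x⁻¹ * g * x ∈ M := by
        intro g hg
        rw [hM] at hg ⊢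
        refine ⟨hχj x g hg.1, ?_⟩
        have c1 : Commute g y' := comm_trans D hg.1 hy0 h2 hy hg.2 h3.symm
        have c2 : Commute (x⁻¹ * g * x) (x⁻¹ * y' * x) := by
          have e1 : (x⁻¹ * g * x) * (x⁻¹ * y' * x) = x⁻¹ * (g * y') * x := by group
          have e2 : (x⁻¹ * y' * x) * (x⁻¹ * g * x) = x⁻¹ * (y' * g) * x := by group
          rw [commute_iff_eq, e1, e2, c1.eq]
        exact comm_trans D (hχj x g hg.1) h2' hy0 h1' c2 h4
      have hB : ∀ g, g ∈ M → x * g * x⁻¹ ∈ M := by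
        intro g hg
        rw [hM] at hg ⊢
        have e0 : χ (x * g * x⁻¹) = 0 := by rw [hχ, hχ, hχ.inv, hg.1]; ring
        refine ⟨e0, ?_⟩
        have c1 : Commute g (x⁻¹ * y' * x) := comm_trans D hg.1 hy0 h2' hy hg.2 h4.symm
        have c2 : Commute (x * g * x⁻¹) y' := by
          have e1 : (x * g * x⁻¹) * y' = x * (g * (x⁻¹ * y' * x)) * x⁻¹ := by group
          have e2 : y' * (x * g * x⁻¹) = x * ((x⁻¹ * y' * x) * g) * x⁻¹ := by group
          rw [commute_iff_eq, e1, e2, c1.eq]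
        exact comm_trans D e0 h2 hy0 h1 c2 h3
      rw [SetLike.mem_coe, Subgroup.mem_normalizer_iff]
      intro g
      constructor
      · exact hB g
      · intro h
        have := hA _ h
        have e : x⁻¹ * (x * g * x⁻¹) * x = g := by group
        rwa [e] at this
    haveI : M.Normal := Subgroup.normalizer_eq_top_iff.1 hN
    have hall : ∀ k, χ k = 0 → Commute y k := by
      intro k hk
      apply comm_conj hχ D hy0 hk hy
      have hyM : y ∈ M := (hM y).2 ⟨hy0, Commute.refl y⟩
      have := this.conj_mem y hyM k⁻¹
      rw [inv_inv] at this
      exact ((hM _).1 this).2.symm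
    intro a b ha hb
    exact comm_trans D ha hy0 hb hy (hall a ha).symm (hall b hb)

include hχ in
theorem ker_cyclic (hfg : hχ.ker.FG) (hc : ∀ a b, χ a = 0 → χ b = 0 → Commute a b) :
    ∃ k, χ k = 0 ∧ ∀ g, χ g = 0 → ∃ m : ℤ, g = k ^ m := by
  classical
  obtain ⟨T, hT⟩ := hfg
  have key : ∀ T : Finset G, (∀ x ∈ T, χ x = 0) → ∃ k, χ k = 0 ∧ Subgroup.closure (T : Set G) ≤ Subgroup.zpowers k := by
    intro T
    induction T using Finset.induction_on with
    | empty => intro _; exact ⟨1, hχ.one, by simp⟩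
    | insert a T _ ih =>
      intro h
      obtain ⟨k, hk, hk2⟩ := ih (fun x hx => h x (Finset.mem_insert_of_mem hx))
      have ha := h a (Finset.mem_insert_self _ _)
      obtain ⟨l, hl, i, j, h1, h2⟩ := cyc_of_comm D ha hk (hc a k ha hk)
      refine ⟨l, hl, ?_⟩
      rw [Subgroup.closure_le]
      intro x hx
      rw [Finset.mem_coe, Finset.mem_insert] at hx
      rcases hx with rfl | hx
      · exact Subgroup.mem_zpowers_iff.2 ⟨i, h1.symm⟩
      · obtain ⟨m, hm⟩ := Subgroup.mem_zpowers_iff.1 (hk2 (Subgroup.subset_closure hx))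
        exact Subgroup.mem_zpowers_iff.2 ⟨j * m, by rw [zpow_mul, ← h2, hm]⟩
  obtain ⟨k, hk, hk2⟩ := key T (fun x hx => by
    have : x ∈ hχ.ker := by rw [← hT]; exact Subgroup.subset_closure hx
    exact this)
  refine ⟨k, hk, fun g hg => ?_⟩
  have : g ∈ hχ.ker := hg
  rw [← hT] at this
  obtain ⟨m, hm⟩ := Subgroup.mem_zpowers_iff.1 (hk2 this)
  exact ⟨m, hm.symm⟩

end fin

theorem klein_normal_form (x : KleinBottleGroup) :
    ∃ i j : ℤ, x = (PresentedGroup.of 0 : KleinBottleGroup) ^ i * (PresentedGroup.of 1) ^ j := by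
  set a : KleinBottleGroup := PresentedGroup.of 0 with ha
  set t : KleinBottleGroup := PresentedGroup.of 1 with htd
  have hrel : t * a * t⁻¹ = a⁻¹ := by
    have h := PresentedGroup.one_of_mem (rels := kleinBottleRels)
      (x := FreeGroup.of 1 * FreeGroup.of 0 * (FreeGroup.of 1)⁻¹ * FreeGroup.of 0) (Set.mem_singleton _)
    have h' : t * a * t⁻¹ * a = 1 := h
    exact eq_inv_of_mul_eq_one_left h'
  have hr1 : ∀ i : ℤ, t * a ^ i = a ^ (-i) * t := by
    intro i
    have : t * a ^ i * t⁻¹ = a ^ (-i) := by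
      rw [← conj_zpow, hrel, inv_zpow, zpow_neg]
    rw [← this]; group
  have hr2 : ∀ i : ℤ, t⁻¹ * a ^ i = a ^ (-i) * t⁻¹ := by
    intro i
    have h := hr1 (-i)
    rw [neg_neg] at h
    rw [inv_mul_eq_iff_eq_mul, ← mul_assoc, h, mul_inv_cancel_right]
  have hx : x ∈ Subgroup.closure (Set.range (PresentedGroup.of (rels := kleinBottleRels))) := by
    rw [PresentedGroup.closure_range_of]; trivial
  induction hx using Subgroup.closure_induction_left with
  | one => exact ⟨0, 0, by simp⟩
  | mul_left y hy z _ hz =>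
    obtain ⟨i, j, rfl⟩ := hz
    obtain ⟨b, rfl⟩ := hy
    fin_cases b
    · refine ⟨1 + i, j, ?_⟩
      rw [zpow_add, zpow_one, mul_assoc]; rfl
    · refine ⟨-i, 1 + j, ?_⟩
      rw [zpow_add, zpow_one, ← mul_assoc (a ^ (-i)), ← hr1, mul_assoc]; rfl
  | inv_mul_cancel y hy z _ hz =>
    obtain ⟨i, j, rfl⟩ := hz
    obtain ⟨b, rfl⟩ := hy
    fin_cases b
    · refine ⟨-1 + i, j, ?_⟩
      rw [zpow_add, zpow_neg_one, mul_assoc]; rfl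
    · refine ⟨-i, -1 + j, ?_⟩
      rw [zpow_add, zpow_neg_one, ← mul_assoc (a ^ (-i)), ← hr2, mul_assoc]; rfl

theorem classify {G : Type*} [Group G] {χ : G → ℤ} (hχ : IsChar χ) {t k : G} (ht : χ t = 1)
    (hk : χ k = 0) (htf : ∀ m : ℕ, m ≠ 0 → k ^ m = 1 → k = 1)
    (hcyc : ∀ g, χ g = 0 → ∃ m : ℤ, g = k ^ m) :
    (Nonempty (G ≃* Multiplicative ℤ) ∨ Nonempty (G ≃* Multiplicative (ℤ × ℤ)) ∨
      Nonempty (G ≃* KleinBottleGroup)) ∧ growthOmega G = 1 := by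
  have hχt : ∀ j : ℤ, χ (t ^ j) = j := by intro j; rw [hχ.zpow, ht, mul_one]
  have hχk : ∀ j : ℤ, χ (k ^ j) = 0 := by intro j; rw [hχ.zpow, hk, mul_zero]
  have hform : ∀ g, ∃ i j : ℤ, g = k ^ i * t ^ j := by
    intro g
    obtain ⟨i, hi⟩ := hcyc (g * (t ^ χ g)⁻¹) (by rw [hχ, hχ.inv, hχt]; ring)
    exact ⟨i, χ g, by rw [← hi]; group⟩
  have hgen : Subgroup.closure {k, t} = (⊤ : Subgroup G) := by
    rw [eq_top_iff]
    intro g _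
    obtain ⟨i, j, rfl⟩ := hform g
    exact mul_mem (Subgroup.zpow_mem _ (Subgroup.subset_closure (by simp)) i)
      (Subgroup.zpow_mem _ (Subgroup.subset_closure (by simp)) j)
  by_cases hk1 : k = 1
  · subst hk1
    refine ⟨Or.inl ?_, growthOmega_eq_one_of_kt 1 t hgen (Or.inl (by simp))⟩
    refine ⟨(MulEquiv.ofBijective (zpowersHom G t) ⟨?_, ?_⟩).symm⟩
    · intro a b h
      rw [zpowersHom_apply, zpowersHom_apply] at h
      have := congrArg χ h
      rw [hχt, hχt] at this
      exact Multiplicative.toAdd.injective this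
    · intro g
      obtain ⟨i, j, rfl⟩ := hform g
      exact ⟨Multiplicative.ofAdd j, by simp⟩
  · have hinf : ∀ m : ℤ, k ^ m = 1 → m = 0 := by
      intro m hm
      by_contra hne
      apply hk1
      apply htf m.natAbs (by omega)
      rcases Int.natAbs_eq m with h | h
      · rw [h, zpow_natCast] at hm; exact hm
      · rw [h, zpow_neg, zpow_natCast, inv_eq_one] at hm; exact hm
    have hinj : ∀ a b : ℤ, k ^ a = k ^ b → a = b := by
      intro a b h
      have := hinf (a - b) (by rw [zpow_sub, h, mul_inv_cancel])
      omega
    obtain ⟨a, ha⟩ := hcyc (t * k * t⁻¹) (by rw [hχ, hχ, hχ.inv, hk]; ring)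
    obtain ⟨b, hb⟩ := hcyc (t⁻¹ * k * t) (by rw [hχ, hχ, hχ.inv, hk]; ring)
    have hab : b * a = 1 := by
      apply hinj
      rw [zpow_mul, ← hb, zpow_one]
      have := conj_zpow (a := t⁻¹) (b := k) (i := a)
      rw [inv_inv] at this
      rw [this, ← ha]; group
    have ha1 : a = 1 ∨ a = -1 := by
      apply Int.isUnit_iff.1
      exact IsUnit.of_mul_eq_one b (by rw [mul_comm]; exact hab)
    rcases ha1 with rfl | rfl
    · rw [zpow_one] at ha
      refine ⟨Or.inr (Or.inl ?_), growthOmega_eq_one_of_kt k t hgen (Or.inl ha)⟩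
      have hct : Commute t k := mul_inv_eq_iff_eq_mul.1 ha
      let f : Multiplicative (ℤ × ℤ) →* G :=
        { toFun := fun x => k ^ (Multiplicative.toAdd x).1 * t ^ (Multiplicative.toAdd x).2
          map_one' := by simp
          map_mul' := by
            intro x y
            simp only [toAdd_mul, Prod.fst_add, Prod.snd_add, zpow_add]
            have := ((hct.zpow_left (Multiplicative.toAdd x).2).zpow_right (Multiplicative.toAdd y).1).eq
            simp only [mul_assoc]
            rw [← mul_assoc (t ^ _) (k ^ _) (t ^ _), this]
            simp only [mul_assoc] }
      refine ⟨(MulEquiv.ofBijective f ⟨?_, ?_⟩).symm⟩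
      · rw [injective_iff_map_eq_one]
        intro x hx
        change k ^ (Multiplicative.toAdd x).1 * t ^ (Multiplicative.toAdd x).2 = 1 at hx
        have h1 := congrArg χ hx
        rw [hχ, hχk, hχt, hχ.one, zero_add] at h1
        rw [h1, zpow_zero, mul_one] at hx
        have h2 := hinf _ hx
        apply Multiplicative.toAdd.injective
        exact Prod.ext h2 h1
      · intro g
        obtain ⟨i, j, rfl⟩ := hform g
        exact ⟨Multiplicative.ofAdd (i, j), rfl⟩
    · rw [zpow_neg_one] at ha
      refine ⟨Or.inr (Or.inr ?_), growthOmega_eq_one_of_kt k t hgen (Or.inr ha)⟩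
      have hrel : ∀ r ∈ kleinBottleRels, FreeGroup.lift ![k, t] r = 1 := by
        intro r hr
        rw [kleinBottleRels, Set.mem_singleton_iff] at hr
        rw [hr]
        simp [ha]
      let f : KleinBottleGroup →* G := PresentedGroup.toGroup hrel
      have f0 : f (PresentedGroup.of 0) = k := by simp [f]
      have f1 : f (PresentedGroup.of 1) = t := by simp [f]
      refine ⟨(MulEquiv.ofBijective f ⟨?_, ?_⟩).symm⟩
      · rw [injective_iff_map_eq_one]
        intro x hx
        obtain ⟨i, j, rfl⟩ := klein_normal_form x
        rw [map_mul, map_zpow, map_zpow, f0, f1] at hx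
        have h1 := congrArg χ hx
        rw [hχ, hχk, hχt, hχ.one, zero_add] at h1
        rw [h1, zpow_zero, mul_one] at hx
        have h2 := hinf _ hx
        rw [h1, h2]; simp
      · intro g
        obtain ⟨i, j, rfl⟩ := hform g
        exact ⟨(PresentedGroup.of 0) ^ i * (PresentedGroup.of 1) ^ j, by
          rw [map_mul, map_zpow, map_zpow, f0, f1]⟩

/-- If `G` admits a finite presentation of deficiency 1 (with `n` generators
and `n - 1` relators), then `ω(G) ≥ 2^(1/4)`, unless `G` is `ℤ`, `ℤ × ℤ`, or the Klein
bottle group, in which case `ω(G) = 1`. -/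
theorem statement6 {G : Type*} [Group G]
    (hdef : ∃ (n : ℕ) (rels : Finset (FreeGroup (Fin n))), rels.card + 1 = n ∧
      Nonempty (G ≃* PresentedGroup (rels : Set (FreeGroup (Fin n))))) :
    (2 : ℝ) ^ ((1 : ℝ) / 4) ≤ growthOmega G ∨
    ((Nonempty (G ≃* Multiplicative ℤ) ∨ Nonempty (G ≃* Multiplicative (ℤ × ℤ)) ∨
      Nonempty (G ≃* KleinBottleGroup)) ∧ growthOmega G = 1) := by
  classical
  obtain ⟨n, rels, hcard, ⟨e⟩⟩ := hdef
  by_cases hcase : ∀ S : Finset G, Subgroup.closure (S : Set G) = ⊤ → (2 : ℝ) ^ ((1 : ℝ) / 4) ≤ growthRate S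
  · left
    apply le_csInf
    · have hfgP : Subgroup.closure ((Finset.univ.image (fun i : Fin n => e.symm (PresentedGroup.of i)) : Finset G) : Set G) = ⊤ := by
        rw [eq_top_iff]
        intro g _
        have hg : e g ∈ Subgroup.closure (Set.range (PresentedGroup.of (rels := (rels : Set (FreeGroup (Fin n)))))) := by
          rw [PresentedGroup.closure_range_of]; trivial
        have h2 := Subgroup.mem_map_of_mem e.symm.toMonoidHom hg
        rw [MonoidHom.map_closure] at h2
        have e3 : e.symm.toMonoidHom (e g) = g := e.symm_apply_apply g
        rw [e3] at h2
        refine Subgroup.closure_mono ?_ h2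
        rintro _ ⟨_, ⟨i, rfl⟩, rfl⟩
        simp
      exact ⟨_, _, hfgP, rfl⟩
    · rintro _ ⟨S, hS, rfl⟩
      exact hcase S hS
  · right
    push Not at hcase
    obtain ⟨S, hS, hlt⟩ := hcase
    have hnf : ∀ u ∈ wordBall S 4, ∀ v ∈ wordBall S 4, ¬ FreePair u v := by
      intro u hu v hv hf
      exact absurd (growthRate_ge_of_freePair hf hu hv) (not_le.2 hlt)
    obtain ⟨χ, hχ, t, ht⟩ := exists_char_of_deficiency rels hcard e
    obtain ⟨x, hxS, hx⟩ : ∃ x ∈ S, χ x ≠ 0 := by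
      by_contra hcon
      push Not at hcon
      have hle : Subgroup.closure (S : Set G) ≤ hχ.ker := by
        rw [Subgroup.closure_le]
        intro x hx; exact hcon x hx
      rw [hS] at hle
      have : χ t = 0 := hle (Subgroup.mem_top t)
      omega
    have hfg : hχ.ker.FG := by
      refine ker_fg_of_not_freePair hχ hS hx ?_
      intro s hs
      apply hnf
      · exact wordBall_mono (by norm_num) (mem_wordBall_one hxS)
      · exact wordBall_mono (by norm_num) (mul_mem_wordBall (mul_mem_wordBall (mem_wordBall_one hs)
          (mem_wordBall_one hxS)) (inv_mem_wordBall_one hs))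
    have D := fun u v hu hv => (dich_G rels hcard e hχ ht hfg u v hu hv).1
    have hcomm := ker_comm hχ D hS hnf
    obtain ⟨k, hk, hcyc⟩ := ker_cyclic hχ D hfg hcomm
    exact classify hχ ht hk (dich_G rels hcard e hχ ht hfg k k hk hk).2 hcyc
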